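/- arXiv:2404.13942 — 2 statements merged into one kernel-verified Lean document; each statement's English description precedes it below -/
import Mathlib

section
/- (Hammersley–Welsh) For the hypercubic lattice ℤ^d (d ≥ 2), there exists a constant γ > 1 such that for all n ≥ 1, σ_n ≤ κ^n · γ^{√n}, where κ is the connective constant of ℤ^d. -/
open Filter Topology

/-- `ω` is an `n`-step self-avoiding walk on the hypercubic lattice `ℤ^d`, started at the
origin: consecutive points are at `ℓ¹`-distance `1` and no point is visited twice. -/
def IsSAW (d n : ℕ) (ω : Fin (n + 1) → (Fin d → ℤ)) : Prop :=
  ω 0 = 0 ∧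
  (∀ i : Fin n, (∑ j : Fin d, |ω i.succ j - ω i.castSucc j|) = 1) ∧
  Function.Injective ω

/-- `sawCount d n = σ_n(ℤ^d)`, the number of `n`-step self-avoiding walks on `ℤ^d`. -/
noncomputable def sawCount (d n : ℕ) : ℕ :=
  Set.ncard {ω : Fin (n + 1) → (Fin d → ℤ) | IsSAW d n ω}

section Walks

open scoped ENNReal

variable {V : Type*}

/-- The generating function of a set of step lists, weighted by length. -/
noncomputable def walkGF (x : ℝ≥0∞) (T : Set (List V)) : ℝ≥0∞ :=
  ∑' l : T, x ^ (l : List V).length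

theorem walkGF_mono (x : ℝ≥0∞) {T U : Set (List V)} (h : T ⊆ U) : walkGF x T ≤ walkGF x U :=
  ENNReal.tsum_mono_subtype (fun l : List V => x ^ l.length) h

theorem walkGF_le_mul (x : ℝ≥0∞) {T A B : Set (List V)} (f : List V → List V → List V) (c : ℕ)
    (h : ∀ l ∈ T, ∃ a ∈ A, ∃ b ∈ B, f a b = l ∧ l.length + c = a.length + b.length) :
    x ^ c * walkGF x T ≤ walkGF x A * walkGF x B := by
  choose! a ha b hb hf hlen using h
  let F : T → A × B := fun l => (⟨a l, ha l l.2⟩, ⟨b l, hb l l.2⟩)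
  have hF : Function.Injective F := by
    intro l m hlm
    have h1 : a l = a m := congrArg (fun p => (p.1 : List V)) hlm
    have h2 : b l = b m := congrArg (fun p => (p.2 : List V)) hlm
    exact Subtype.ext (by rw [← hf l l.2, ← hf m m.2, h1, h2])
  calc x ^ c * walkGF x T
      = ∑' l : T, (fun p : A × B => x ^ (p.1 : List V).length * x ^ (p.2 : List V).length)
          (F l) := by
        rw [walkGF, ← ENNReal.tsum_mul_left]
        refine tsum_congr fun l => ?_
        simp only [F]
        rw [← pow_add, ← pow_add, ← hlen l l.2, add_comm]
    _ ≤ ∑' p : A × B, x ^ (p.1 : List V).length * x ^ (p.2 : List V).length :=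
        ENNReal.tsum_comp_le_tsum_of_injective hF _
    _ = walkGF x A * walkGF x B := by
        rw [ENNReal.tsum_prod (f := fun (p : A) (q : B) =>
          x ^ (p : List V).length * x ^ (q : List V).length)]
        simp only [walkGF, ENNReal.tsum_mul_left, ENNReal.tsum_mul_right]

theorem walkGF_of_length (x : ℝ≥0∞) {T : Set (List V)} (hT : T.Finite) {n : ℕ}
    (h : ∀ l ∈ T, l.length = n) : walkGF x T = T.ncard * x ^ n := by
  have : walkGF x T = ∑' _ : T, x ^ n := tsum_congr fun l => by rw [h l l.2]
  rw [this, ENNReal.tsum_set_const, ← hT.cast_ncard_eq]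
  simp

variable [AddCommGroup V] {S : Set V} {φ : V →+ ℤ}

/-- A list of steps from `S` whose partial sums are pairwise distinct. -/
def IsSAWSteps (S : Set V) (l : List V) : Prop :=
  (∀ v ∈ l, v ∈ S) ∧ ∀ s, s <:+: l → s ≠ [] → s.sum ≠ 0

/-- After its start, the walk stays in the open half-space `φ > 0`. -/
def IsHalfSpace (φ : V →+ ℤ) (l : List V) : Prop :=
  ∀ p, p <+: l → p ≠ [] → 0 < φ p.sum

/-- A bridge: a half-space walk whose end point maximises `φ`. -/
def IsBridge (S : Set V) (φ : V →+ ℤ) (l : List V) : Prop :=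
  IsSAWSteps S l ∧ IsHalfSpace φ l ∧ ∀ s, s <:+ l → 0 ≤ φ s.sum

/-- Self-avoiding half-space walks on which `φ` is at most `A`. -/
def halfSpaceSet (S : Set V) (φ : V →+ ℤ) (A : ℕ) : Set (List V) :=
  {l | IsSAWSteps S l ∧ IsHalfSpace φ l ∧ ∀ p, p <+: l → φ p.sum ≤ A}

/-- Bridges of span `A`. -/
def bridgeSpanSet (S : Set V) (φ : V →+ ℤ) (A : ℕ) : Set (List V) :=
  {l | IsBridge S φ l ∧ φ l.sum = A}

/-- Bridges with `n` steps. -/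
def bridgeLengthSet (S : Set V) (φ : V →+ ℤ) (n : ℕ) : Set (List V) :=
  {l | IsBridge S φ l ∧ l.length = n}

/-- Self-avoiding walks with `n` steps. -/
def sawSet (S : Set V) (n : ℕ) : Set (List V) :=
  {l | IsSAWSteps S l ∧ l.length = n}

theorem IsSAWSteps.of_infix {l m : List V} (h : IsSAWSteps S l) (hm : m <:+: l) :
    IsSAWSteps S m :=
  ⟨fun v hv => h.1 v (hm.subset hv), fun s hs => h.2 s (hs.trans hm)⟩

theorem sum_map_neg (l : List V) : (l.map Neg.neg).sum = -l.sum := by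
  induction l with
  | nil => simp
  | cons a l ih => simp [ih]; abel

theorem IsSAWSteps.map_neg {l : List V} (hS : ∀ v ∈ S, -v ∈ S) (h : IsSAWSteps S l) :
    IsSAWSteps S (l.map Neg.neg) := by
  refine ⟨fun v hv => ?_, fun s hs hne => ?_⟩
  · obtain ⟨w, hw, rfl⟩ := List.mem_map.1 hv
    exact hS w (h.1 w hw)
  · obtain ⟨t, ht, rfl⟩ := List.infix_map_iff.1 hs
    rw [sum_map_neg, neg_ne_zero]
    exact h.2 t ht (by simpa using hne)

theorem IsSAWSteps.reverse {l : List V} (h : IsSAWSteps S l) : IsSAWSteps S l.reverse := by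
  refine ⟨fun v hv => h.1 v (by simpa using hv), fun s hs hne => ?_⟩
  rw [← List.sum_reverse]
  exact h.2 _ (by simpa using List.reverse_infix.2 hs) (by simpa using hne)

theorem IsSAWSteps.append {l m : List V} (hl : IsSAWSteps S l) (hm : IsSAWSteps S m)
    (hls : ∀ s, s <:+ l → 0 ≤ φ s.sum) (hmp : IsHalfSpace φ m) : IsSAWSteps S (l ++ m) := by
  refine ⟨fun v hv => (List.mem_append.1 hv).elim (hl.1 v) (hm.1 v), fun s hs hne => ?_⟩
  rcases List.infix_append_iff_ne_nil.1 hs with h | h | ⟨a, b, -, hb, rfl, ha', hb'⟩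
  · exact hl.2 s h hne
  · exact hm.2 s h hne
  · intro h0
    have h1 := hls a ha'
    have h2 := hmp b hb' hb
    have h3 := congrArg φ h0
    simp only [List.sum_append, map_add, map_zero] at h3
    omega

theorem IsBridge.append {l m : List V} (hl : IsBridge S φ l) (hm : IsBridge S φ m) :
    IsBridge S φ (l ++ m) := by
  refine ⟨hl.1.append hm.1 hl.2.2 hm.2.1, fun p hp hne => ?_, fun s hs => ?_⟩
  · obtain ⟨t, ht⟩ := hp
    rcases List.append_eq_append_iff.1 ht with ⟨q, rfl, -⟩ | ⟨q, rfl, rfl⟩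
    · exact hl.2.1 p (List.prefix_append p q) hne
    · have h0 := hl.2.2 l (List.suffix_refl l)
      rw [List.sum_append, map_add]
      by_cases hq0 : q = []
      · subst hq0
        simpa using hl.2.1 l (List.prefix_refl l) (by simpa using hne)
      · have := hm.2.1 q (List.prefix_append q t) hq0
        omega
  · obtain ⟨t, ht⟩ := hs
    rcases List.append_eq_append_iff.1 ht with ⟨q, rfl, rfl⟩ | ⟨q, rfl, rfl⟩
    · have h0 := hm.2.2 m (List.suffix_refl m)
      have := hl.2.2 q (List.suffix_append t q)
      rw [List.sum_append, map_add]
      omega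
    · exact hm.2.2 s (List.suffix_append q s)

theorem isBridge_singleton {e : V} (he : e ∈ S) (hφ : 0 < φ e) : IsBridge S φ [e] := by
  have hne : e ≠ 0 := by
    rintro rfl
    simp at hφ
  refine ⟨⟨by simpa using he, fun s hs h0 => ?_⟩, fun p hp h0 => ?_, fun s hs => ?_⟩
  · rcases (List.infix_singleton_iff _ _).1 hs with rfl | rfl <;> simp_all
  · rcases (List.infix_singleton_iff _ _).1 hp.isInfix with rfl | rfl <;> simp_all
  · rcases (List.infix_singleton_iff _ _).1 hs.isInfix with rfl | rfl <;> simp [hφ.le]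

/-- Cutting a half-space walk at the last visit to its maximal level gives a bridge followed by
the reflection of a half-space walk of smaller height. -/
theorem halfSpaceSet_succ (hS : ∀ v ∈ S, -v ∈ S) {A : ℕ} {l : List V}
    (hl : l ∈ halfSpaceSet S φ (A + 1)) (hl' : l ∉ halfSpaceSet S φ A) :
    ∃ b ∈ bridgeSpanSet S φ (A + 1), ∃ h ∈ halfSpaceSet S φ A,
      b ++ h.map Neg.neg = l := by
  classical
  obtain ⟨h1, h2, h3⟩ := hl
  have hex : ∃ k, k ≤ l.length ∧ φ (l.take k).sum = (A + 1 : ℕ) := by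
    by_contra! hcon
    refine hl' ⟨h1, h2, fun p hp => ?_⟩
    have := h3 p hp
    have h4 := hcon p.length hp.length_le
    rw [← List.prefix_iff_eq_take.1 hp] at h4
    push_cast at *
    omega
  obtain ⟨k0, hk0, hk0'⟩ := hex
  set k := Nat.findGreatest (fun k => φ (l.take k).sum = (A + 1 : ℕ)) l.length with hk
  have hkp : φ (l.take k).sum = (A + 1 : ℕ) :=
    Nat.findGreatest_spec (P := fun k => φ (l.take k).sum = (A + 1 : ℕ)) hk0 hk0'
  have hkl : k ≤ l.length := Nat.findGreatest_le _
  have hlk : l.take k ++ l.drop k = l := List.take_append_drop k l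
  have hk1 : l.take k ≠ [] := by
    intro h
    rw [h] at hkp
    simp at hkp
    omega
  refine ⟨l.take k, ⟨⟨h1.of_infix (List.take_prefix k l).isInfix,
      fun p hp => h2 p (hp.trans (List.take_prefix k l)), ?_⟩, hkp⟩,
    (l.drop k).map Neg.neg, ⟨(h1.of_infix (List.drop_suffix k l).isInfix).map_neg hS, ?_, ?_⟩, ?_⟩
  · rintro s ⟨q, hq⟩
    have h4 := h3 q ((hq ▸ List.prefix_append q s).trans (List.take_prefix k l))
    rw [← hq, List.sum_append, map_add] at hkp
    omega
  · intro p hp hne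
    obtain ⟨q, hq, rfl⟩ := List.prefix_map_iff.1 hp
    have hq' : q ≠ [] := by simpa using hne
    have hpre : l.take k ++ q <+: l := by
      conv_rhs => rw [← hlk]
      exact (List.prefix_append_right_inj _).2 hq
    have h4 := h3 _ hpre
    have hlen : (l.take k ++ q).length = k + q.length := by simp [hkl]
    have h5 := Nat.findGreatest_is_greatest (P := fun k => φ (l.take k).sum = (A + 1 : ℕ))
      (n := l.length) (k := k + q.length)
      (by have := List.length_pos_iff.2 hq'; omega) (hlen ▸ hpre.length_le)
    rw [← hlen, ← List.prefix_iff_eq_take.1 hpre] at h5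
    rw [List.sum_append, map_add] at h4 h5
    rw [sum_map_neg, map_neg]
    push_cast at *
    omega
  · intro p hp
    obtain ⟨q, hq, rfl⟩ := List.prefix_map_iff.1 hp
    have hpre : l.take k ++ q <+: l := by
      conv_rhs => rw [← hlk]
      exact (List.prefix_append_right_inj _).2 hq
    have h4 := h2 _ hpre (by simp [hk1])
    rw [List.sum_append, map_add] at h4
    rw [sum_map_neg, map_neg]
    push_cast at *
    omega
  · simp

theorem sum_le_length (hφ : ∀ v ∈ S, φ v ≤ 1) {l : List V} (hl : ∀ v ∈ l, v ∈ S) :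
    φ l.sum ≤ l.length := by
  induction l with
  | nil => simp
  | cons a l ih =>
    have h1 := ih fun v hv => hl v (by simp [hv])
    have h2 := hφ a (hl a (by simp))
    simp only [List.sum_cons, map_add, List.length_cons]
    push_cast
    omega

/-- Cutting a walk at its last visit to the minimal level gives two half-space walks. -/
theorem sawSet_split (hS : ∀ v ∈ S, -v ∈ S) (hφ : ∀ v ∈ S, φ v ≤ 1) {e : V} (he : e ∈ S)
    (hφe : 0 < φ e) {n : ℕ} {l : List V} (hl : l ∈ sawSet S n) :
    ∃ a ∈ halfSpaceSet S φ (n + 1), ∃ b ∈ halfSpaceSet S φ (n + 1),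
      (a.tail.map Neg.neg).reverse ++ b = l ∧ l.length + 1 = a.length + b.length := by
  classical
  obtain ⟨h1, rfl⟩ := hl
  obtain ⟨m, hm, hmin⟩ := Finset.exists_min_image (Finset.range (l.length + 1))
    (fun k => φ (l.take k).sum) ⟨0, by simp⟩
  set k := Nat.findGreatest (fun k => φ (l.take k).sum = φ (l.take m).sum) l.length with hk
  have hkp : φ (l.take k).sum = φ (l.take m).sum :=
    Nat.findGreatest_spec (P := fun k => φ (l.take k).sum = φ (l.take m).sum)
      (by simpa [Nat.lt_succ_iff] using hm) rfl
  have hkl : k ≤ l.length := Nat.findGreatest_le _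
  have hlk : l.take k ++ l.drop k = l := List.take_append_drop k l
  have hge : ∀ p, p <+: l → φ (l.take k).sum ≤ φ p.sum := by
    intro p hp
    have := hmin p.length (by simpa [Nat.lt_succ_iff] using hp.length_le)
    rw [← List.prefix_iff_eq_take.1 hp] at this
    omega
  set r := ((l.take k).map Neg.neg).reverse with hr
  have hrS : IsSAWSteps S r :=
    ((h1.of_infix (List.take_prefix k l).isInfix).map_neg hS).reverse
  have hrp : ∀ p, p <+: r → 0 ≤ φ p.sum := by
    intro p hp
    have h2 : p.reverse <:+ (l.take k).map Neg.neg := by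
      simpa [hr] using List.reverse_suffix.2 hp
    obtain ⟨s, ⟨q, hq⟩, hs⟩ := List.suffix_map_iff.1 h2
    have h3 := hge q ((hq ▸ List.prefix_append q s).trans (List.take_prefix k l))
    rw [← hq, List.sum_append, map_add] at h3
    rw [← List.sum_reverse, hs, sum_map_neg, map_neg]
    omega
  have hb : IsHalfSpace φ (l.drop k) := by
    intro q hq hne
    have hpre : l.take k ++ q <+: l := by
      conv_rhs => rw [← hlk]
      exact (List.prefix_append_right_inj _).2 hq
    have h4 := hge _ hpre
    have hlen : (l.take k ++ q).length = k + q.length := by simp [hkl]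
    have h5 := Nat.findGreatest_is_greatest (P := fun k => φ (l.take k).sum = φ (l.take m).sum)
      (n := l.length) (k := k + q.length)
      (by have := List.length_pos_iff.2 hne; omega) (hlen ▸ hpre.length_le)
    rw [← hlen, ← List.prefix_iff_eq_take.1 hpre, ← hkp] at h5
    rw [List.sum_append, map_add] at h4 h5
    omega
  have hbS := h1.of_infix (List.drop_suffix k l).isInfix
  have ha : IsHalfSpace φ (e :: r) := by
    intro p hp hne
    rcases List.prefix_cons_iff.1 hp with rfl | ⟨q, rfl, hq⟩
    · exact absurd rfl hne
    · have := hrp q hq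
      rw [List.sum_cons, map_add]
      omega
  have haS : IsSAWSteps S (e :: r) := by
    refine ⟨fun v hv => ?_, fun s hs hne h0 => ?_⟩
    · rcases List.mem_cons.1 hv with rfl | h
      exacts [he, hrS.1 v h]
    · rcases List.infix_cons_iff.1 hs with h | h
      · have := ha s h hne
        simp [h0] at this
      · exact hrS.2 s h hne h0
  have hrl : r.length = k := by simp [hr, hkl]
  refine ⟨e :: r, ⟨haS, ha, fun p hp => ?_⟩, l.drop k, ⟨hbS, hb, fun p hp => ?_⟩, ?_, ?_⟩
  · have h2 := sum_le_length hφ (haS.of_infix hp.isInfix).1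
    have h3 := hp.length_le
    simp only [List.length_cons] at h3
    push_cast
    omega
  · have h2 := sum_le_length hφ (hbS.of_infix hp.isInfix).1
    have h3 := hp.length_le
    simp only [List.length_drop] at h3
    push_cast
    omega
  · simp [hr]
  · simp only [List.length_cons, List.length_drop]
    omega

theorem finite_sawSet (hS : S.Finite) (n : ℕ) : (sawSet S n).Finite := by
  have := hS.to_subtype
  refine ((List.finite_length_eq S n).image (List.map Subtype.val)).subset ?_
  rintro l ⟨hl, rfl⟩
  refine ⟨l.attach.map fun v => ⟨v.1, hl.1 _ v.2⟩, by simp, ?_⟩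
  simp

theorem bridgeLengthSet_subset (n : ℕ) : bridgeLengthSet S φ n ⊆ sawSet S n :=
  fun _ hl => ⟨hl.1.1, hl.2⟩

theorem ncard_bridgeLengthSet_mul (hS : S.Finite) (m n : ℕ) :
    (bridgeLengthSet S φ m).ncard * (bridgeLengthSet S φ n).ncard ≤
      (bridgeLengthSet S φ (m + n)).ncard := by
  rw [← Set.ncard_prod]
  refine Set.ncard_le_ncard_of_injOn (fun p => p.1 ++ p.2) ?_ ?_
    ((finite_sawSet hS _).subset (bridgeLengthSet_subset _))
  · rintro ⟨a, b⟩ ⟨ha, hb⟩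
    exact ⟨ha.1.append hb.1, by simp [ha.2, hb.2]⟩
  · rintro ⟨a, b⟩ ⟨ha, hb⟩ ⟨a', b'⟩ ⟨ha', hb'⟩ h
    obtain ⟨rfl, rfl⟩ := List.append_inj h (ha.2.trans ha'.2.symm)
    rfl

theorem ncard_bridgeLengthSet_pow (hS : S.Finite) (n k : ℕ) :
    (bridgeLengthSet S φ n).ncard ^ (k + 1) ≤ (sawSet S (n * (k + 1))).ncard := by
  refine le_trans ?_ (Set.ncard_le_ncard (bridgeLengthSet_subset (φ := φ) _) (finite_sawSet hS _))
  induction k with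
  | zero => simp
  | succ k ih =>
    rw [pow_succ, mul_add_one n (k + 1)]
    exact (Nat.mul_le_mul_right _ ih).trans (ncard_bridgeLengthSet_mul hS _ _)

/-- The number of bridges with `n` steps is at most `κ ^ n`. -/
theorem ncard_bridgeLengthSet_le (hS : S.Finite) {κ : ℝ}
    (hκ : Tendsto (fun n : ℕ => ((sawSet S n).ncard : ℝ) ^ (1 / (n : ℝ))) atTop (𝓝 κ))
    {n : ℕ} (hn : n ≠ 0) : ((bridgeLengthSet S φ n).ncard : ℝ) ≤ κ ^ n := by
  have hsub : Tendsto (fun k : ℕ => n * (k + 1)) atTop atTop :=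
    tendsto_atTop_mono (fun k => (Nat.le_succ k).trans
      (Nat.le_mul_of_pos_left _ (Nat.pos_of_ne_zero hn))) tendsto_id
  refine ge_of_tendsto' ((hκ.comp hsub).pow n) fun k => ?_
  set s : ℝ := ((sawSet S (n * (k + 1))).ncard : ℝ)
  have hs : 0 ≤ s := Nat.cast_nonneg _
  have h1 : ((bridgeLengthSet S φ n).ncard : ℝ) ^ (k + 1) ≤ s := by
    rw [← Nat.cast_pow]
    exact Nat.cast_le.2 (ncard_bridgeLengthSet_pow hS n k)
  refine le_of_pow_le_pow_left₀ (Nat.succ_ne_zero k)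
    (pow_nonneg (Real.rpow_nonneg (Nat.cast_nonneg _) _) _) (h1.trans_eq ?_)
  simp only [Function.comp]
  rw [← pow_mul, one_div,
    Real.rpow_inv_natCast_pow hs (by positivity)]

theorem one_le_of_tendsto_ncard_sawSet (hS : S.Finite) {e : V} (he : e ∈ S) (hφe : 0 < φ e) {κ : ℝ}
    (hκ : Tendsto (fun n : ℕ => ((sawSet S n).ncard : ℝ) ^ (1 / (n : ℝ))) atTop (𝓝 κ)) :
    1 ≤ κ := by
  have h := ncard_bridgeLengthSet_le (φ := φ) hS hκ one_ne_zero
  rw [pow_one] at h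
  refine le_trans ?_ h
  have : 0 < (bridgeLengthSet S φ 1).ncard :=
    (Set.ncard_pos ((finite_sawSet hS _).subset (bridgeLengthSet_subset _))).2
      ⟨[e], isBridge_singleton he hφe, rfl⟩
  exact_mod_cast this

theorem walkGF_halfSpaceSet_le_prod (hS : ∀ v ∈ S, -v ∈ S) (x : ℝ≥0∞) (A : ℕ) :
    walkGF x (halfSpaceSet S φ A) ≤
      ∏ a ∈ Finset.range A, (1 + walkGF x (bridgeSpanSet S φ (a + 1))) := by
  induction A with
  | zero =>
    have hsub : halfSpaceSet S φ 0 ⊆ {[]} := by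
      rintro l ⟨-, h2, h3⟩
      by_contra hne
      have := h2 l (List.prefix_refl l) hne
      have := h3 l (List.prefix_refl l)
      push_cast at this
      omega
    refine (walkGF_mono x hsub).trans ?_
    simp [walkGF]
  | succ A ih =>
    set C := halfSpaceSet S φ (A + 1) \ halfSpaceSet S φ A
    have h1 : walkGF x (halfSpaceSet S φ (A + 1)) ≤ walkGF x (halfSpaceSet S φ A) + walkGF x C := by
      refine (walkGF_mono x fun l hl => ?_).trans
        (ENNReal.tsum_union_le (fun l : List V => x ^ l.length) (halfSpaceSet S φ A) C)
      by_cases h : l ∈ halfSpaceSet S φ A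
      exacts [Or.inl h, Or.inr ⟨hl, h⟩]
    have h2 : walkGF x C ≤
        walkGF x (bridgeSpanSet S φ (A + 1)) * walkGF x (halfSpaceSet S φ A) := by
      have := walkGF_le_mul x (T := C) (A := bridgeSpanSet S φ (A + 1)) (B := halfSpaceSet S φ A)
        (fun b h => b ++ h.map Neg.neg) 0 fun l hl => by
          obtain ⟨b, hb, h, hh, rfl⟩ := halfSpaceSet_succ hS hl.1 hl.2
          exact ⟨b, hb, h, hh, rfl, by simp⟩
      simpa using this
    calc walkGF x (halfSpaceSet S φ (A + 1))
        ≤ walkGF x (halfSpaceSet S φ A) +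
          walkGF x (bridgeSpanSet S φ (A + 1)) * walkGF x (halfSpaceSet S φ A) := by
          exact h1.trans (by gcongr)
      _ = walkGF x (halfSpaceSet S φ A) * (1 + walkGF x (bridgeSpanSet S φ (A + 1))) := by ring
      _ ≤ _ := by
          rw [Finset.prod_range_succ]
          gcongr

theorem sum_walkGF_bridgeSpanSet_le (x : ℝ≥0∞) (A : ℕ) :
    ∑ a ∈ Finset.range A, walkGF x (bridgeSpanSet S φ (a + 1)) ≤
      ∑' n, walkGF x (bridgeLengthSet S φ (n + 1)) := by
  have hdisj : (Set.univ : Set ℕ).PairwiseDisjoint fun a => bridgeSpanSet S φ (a + 1) := by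
    intro a _ b _ hab
    refine Set.disjoint_left.2 fun l hl hl' => hab ?_
    have := hl.2.symm.trans hl'.2
    omega
  have hsub : (⋃ a, bridgeSpanSet S φ (a + 1)) ⊆ ⋃ n, bridgeLengthSet S φ (n + 1) := by
    refine Set.iUnion_subset fun a l hl => Set.mem_iUnion.2 ⟨l.length - 1, hl.1, ?_⟩
    have hne : l ≠ [] := by
      rintro rfl
      have := hl.2
      simp at this
      omega
    have := List.length_pos_iff.2 hne
    omega
  calc ∑ a ∈ Finset.range A, walkGF x (bridgeSpanSet S φ (a + 1))
      ≤ ∑' a, walkGF x (bridgeSpanSet S φ (a + 1)) := ENNReal.sum_le_tsum _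
    _ = walkGF x (⋃ a, bridgeSpanSet S φ (a + 1)) :=
        (ENNReal.tsum_biUnion (f := fun l : List V => x ^ l.length) hdisj).symm
    _ ≤ walkGF x (⋃ n, bridgeLengthSet S φ (n + 1)) := walkGF_mono x hsub
    _ ≤ _ := ENNReal.tsum_iUnion_le_tsum (fun l : List V => x ^ l.length) _

theorem tsum_walkGF_bridgeLengthSet_le (hS : S.Finite) {κ : ℝ} (hκ1 : 1 ≤ κ)
    (hκ : Tendsto (fun n : ℕ => ((sawSet S n).ncard : ℝ) ^ (1 / (n : ℝ))) atTop (𝓝 κ))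
    {t : ℝ} (ht0 : 0 ≤ t) (ht1 : t < 1) :
    ∑' n, walkGF (ENNReal.ofReal (t / κ)) (bridgeLengthSet S φ (n + 1)) ≤
      ENNReal.ofReal (t / (1 - t)) := by
  have hκ0 : 0 < κ := by linarith
  have hle : ∀ n, walkGF (ENNReal.ofReal (t / κ)) (bridgeLengthSet S φ (n + 1)) ≤
      ENNReal.ofReal (t * t ^ n) := by
    intro n
    rw [walkGF_of_length _ ((finite_sawSet hS _).subset (bridgeLengthSet_subset (n + 1)))
      (fun l hl => hl.2), ← ENNReal.ofReal_pow (by positivity), ← ENNReal.ofReal_natCast,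
      ← ENNReal.ofReal_mul (by positivity)]
    refine ENNReal.ofReal_le_ofReal ?_
    calc _ ≤ κ ^ (n + 1) * (t / κ) ^ (n + 1) := by
          gcongr
          exact ncard_bridgeLengthSet_le hS hκ n.succ_ne_zero
      _ = t * t ^ n := by
          rw [← mul_pow, mul_div_cancel₀ _ hκ0.ne']
          ring
  refine (ENNReal.tsum_le_tsum hle).trans_eq ?_
  have hsum := (hasSum_geometric_of_lt_one ht0 ht1).mul_left t
  rw [← ENNReal.ofReal_tsum_of_nonneg (fun n => by positivity) hsum.summable, hsum.tsum_eq,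
    div_eq_mul_inv]

theorem prod_one_add_le_ofReal_exp (s : Finset ℕ) (f : ℕ → ℝ≥0∞) {c : ℝ}
    (h : ∑ a ∈ s, f a ≤ ENNReal.ofReal c) (hc : 0 ≤ c) :
    ∏ a ∈ s, (1 + f a) ≤ ENNReal.ofReal (Real.exp c) := by
  have hfin : ∀ a ∈ s, f a ≠ ⊤ :=
    ENNReal.sum_ne_top.1 (h.trans_lt ENNReal.ofReal_lt_top).ne
  have hle : ∑ a ∈ s, (f a).toReal ≤ c := by
    rw [← ENNReal.toReal_sum hfin]
    exact ENNReal.toReal_le_of_le_ofReal hc h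
  calc ∏ a ∈ s, (1 + f a) ≤ ∏ a ∈ s, ENNReal.ofReal (Real.exp (f a).toReal) := by
        refine Finset.prod_le_prod' fun a ha => ?_
        rw [← ENNReal.ofReal_toReal (hfin a ha), ← ENNReal.ofReal_one,
          ← ENNReal.ofReal_add zero_le_one ENNReal.toReal_nonneg,
          ENNReal.toReal_ofReal ENNReal.toReal_nonneg, add_comm]
        exact ENNReal.ofReal_le_ofReal (Real.add_one_le_exp _)
    _ = ENNReal.ofReal (Real.exp (∑ a ∈ s, (f a).toReal)) := by
        rw [← ENNReal.ofReal_prod_of_nonneg fun a _ => (Real.exp_pos _).le, Real.exp_sum]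
    _ ≤ _ := ENNReal.ofReal_le_ofReal (Real.exp_le_exp.2 hle)

theorem ncard_sawSet_mul_pow_le (hS : S.Finite) (hneg : ∀ v ∈ S, -v ∈ S) (hφ : ∀ v ∈ S, φ v ≤ 1)
    {e : V} (he : e ∈ S) (hφe : 0 < φ e) {κ : ℝ}
    (hκ : Tendsto (fun n : ℕ => ((sawSet S n).ncard : ℝ) ^ (1 / (n : ℝ))) atTop (𝓝 κ))
    {t : ℝ} (ht0 : 0 ≤ t) (ht1 : t < 1) (n : ℕ) :
    ((sawSet S n).ncard : ℝ) * (t / κ) ^ (n + 1) ≤ Real.exp (2 * (t / (1 - t))) := by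
  have hκ1 := one_le_of_tendsto_ncard_sawSet hS he hφe hκ
  have ht : 0 ≤ t / (1 - t) := div_nonneg ht0 (by linarith)
  have hx : 0 ≤ t / κ := div_nonneg ht0 (by linarith)
  set x := ENNReal.ofReal (t / κ) with hxdef
  have hH : walkGF x (halfSpaceSet S φ (n + 1)) ≤ ENNReal.ofReal (Real.exp (t / (1 - t))) :=
    (walkGF_halfSpaceSet_le_prod hneg x _).trans <| prod_one_add_le_ofReal_exp _ _
      ((sum_walkGF_bridgeSpanSet_le x _).trans
        (tsum_walkGF_bridgeLengthSet_le hS hκ1 hκ ht0 ht1)) ht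
  have h1 := walkGF_le_mul x (T := sawSet S n) (fun a b => (a.tail.map Neg.neg).reverse ++ b) 1
    (fun l hl => by
      obtain ⟨a, ha, b, hb, rfl, hlen⟩ := sawSet_split hneg hφ he hφe hl
      exact ⟨a, ha, b, hb, rfl, hlen⟩)
  have h2 := h1.trans (mul_le_mul' hH hH)
  rw [walkGF_of_length x (finite_sawSet hS n) (fun l hl => hl.2), mul_left_comm, ← pow_add,
    add_comm 1 n, hxdef, ← ENNReal.ofReal_pow hx, ← ENNReal.ofReal_natCast,
    ← ENNReal.ofReal_mul (Nat.cast_nonneg _), ← ENNReal.ofReal_mul (Real.exp_pos _).le,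
    ENNReal.ofReal_le_ofReal_iff (by positivity), ← Real.exp_add, ← two_mul] at h2
  exact h2

/-- The Hammersley–Welsh bound for walks with steps in a finite symmetric set. -/
theorem ncard_sawSet_le (hS : S.Finite) (hneg : ∀ v ∈ S, -v ∈ S) (hφ : ∀ v ∈ S, φ v ≤ 1)
    {e : V} (he : e ∈ S) (hφe : 0 < φ e) {κ : ℝ}
    (hκ : Tendsto (fun n : ℕ => ((sawSet S n).ncard : ℝ) ^ (1 / (n : ℝ))) atTop (𝓝 κ))
    {n : ℕ} (hn : 1 ≤ n) :
    ((sawSet S n).ncard : ℝ) ≤ κ ^ n * (κ * Real.exp 4) ^ Real.sqrt n := by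
  have hκ1 := one_le_of_tendsto_ncard_sawSet hS he hφe hκ
  have hκ0 : 0 < κ := by linarith
  set r := Real.sqrt n with hr
  have hr1 : 1 ≤ r := Real.one_le_sqrt.2 (mod_cast hn)
  have hr0 : 0 < r := by linarith
  have hrr : r * r = n := Real.mul_self_sqrt (Nat.cast_nonneg n)
  set t := (1 + r⁻¹)⁻¹ with ht
  have hri : 0 < r⁻¹ := inv_pos.2 hr0
  have ht0 : 0 < t := by positivity
  have ht1 : t < 1 := inv_lt_one_of_one_lt₀ (by linarith)
  have htt : t / (1 - t) = r := by
    have h1 : 1 + r⁻¹ ≠ 0 := by positivity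
    rw [div_eq_iff (by linarith), ht]
    field_simp
    ring
  have h := ncard_sawSet_mul_pow_le hS hneg hφ he hφe hκ ht0.le ht1 n
  rw [htt, ← le_div_iff₀ (by positivity)] at h
  have h2 : (t ^ (n + 1))⁻¹ ≤ Real.exp (2 * r) := by
    rw [← inv_pow, ht, inv_inv]
    calc (1 + r⁻¹) ^ (n + 1) ≤ Real.exp r⁻¹ ^ (n + 1) := by
          gcongr
          linarith [Real.add_one_le_exp r⁻¹]
      _ = Real.exp ((n + 1) * r⁻¹) := by
          rw [← Real.exp_nat_mul]
          push_cast
          rfl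
      _ ≤ Real.exp (2 * r) := by
          rw [Real.exp_le_exp, ← div_eq_mul_inv, div_le_iff₀ hr0]
          nlinarith
  calc ((sawSet S n).ncard : ℝ) ≤ Real.exp (2 * r) / (t / κ) ^ (n + 1) := h
    _ = κ ^ n * (κ * (Real.exp (2 * r) * (t ^ (n + 1))⁻¹)) := by
        rw [div_pow]
        field_simp
        ring
    _ ≤ κ ^ n * (κ ^ r * (Real.exp (2 * r) * Real.exp (2 * r))) := by
        gcongr
        exact Real.self_le_rpow_of_one_le hκ1 hr1
    _ = κ ^ n * (κ * Real.exp 4) ^ r := by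
        rw [Real.mul_rpow hκ0.le (Real.exp_pos _).le, ← Real.exp_mul, ← Real.exp_add]
        ring_nf

end Walks

section Lattice

variable {d : ℕ}

/-- The unit steps of `ℤ^d`. -/
def unitSteps (d : ℕ) : Set (Fin d → ℤ) := {v | ∑ j, |v j| = 1}

theorem abs_apply_le_one {v : Fin d → ℤ} (hv : v ∈ unitSteps d) (i : Fin d) : |v i| ≤ 1 :=
  (Finset.single_le_sum (f := fun j => |v j|) (fun j _ => abs_nonneg (v j))
    (Finset.mem_univ i)).trans_eq hv

theorem finite_unitSteps (d : ℕ) : (unitSteps d).Finite :=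
  (Set.Finite.pi' fun _ : Fin d => Set.finite_Icc (-1 : ℤ) 1).subset fun _ hv i =>
    Set.mem_Icc.2 (abs_le.1 (abs_apply_le_one hv i))

theorem neg_mem_unitSteps (v : Fin d → ℤ) (hv : v ∈ unitSteps d) : -v ∈ unitSteps d := by
  simpa [unitSteps] using hv

theorem single_mem_unitSteps (i : Fin d) : Pi.single i 1 ∈ unitSteps d := by
  have : ∀ j, |(Pi.single i 1 : Fin d → ℤ) j| = (Pi.single i 1 : Fin d → ℤ) j := fun j =>
    abs_of_nonneg ((Pi.single_nonneg.2 (zero_le_one' ℤ) :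
      (0 : Fin d → ℤ) ≤ Pi.single i 1) j)
  simp [unitSteps, this]

theorem take_sum_injective_iff {V : Type*} [AddCommGroup V] {l : List V} {n : ℕ}
    (hl : l.length = n) :
    Function.Injective (fun i : Fin (n + 1) => (l.take i).sum) ↔
      ∀ s, s <:+: l → s ≠ [] → s.sum ≠ 0 := by
  constructor
  · rintro h s ⟨p, q, rfl⟩ hne hs
    have hlen : (p ++ s ++ q).length = p.length + s.length + q.length := by
      simp only [List.length_append]
    have h1 := @h ⟨p.length, by omega⟩ ⟨p.length + s.length, by omega⟩ (by
      have h2 : (p ++ s ++ q).take (p.length + s.length) = p ++ s := by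
        rw [← List.length_append, List.take_left]
      have h3 : (p ++ s ++ q).take p.length = p := by
        rw [List.append_assoc, List.take_left]
      simp only [h2, h3, List.sum_append, hs, add_zero])
    have := List.length_pos_iff.2 hne
    simp only [Fin.mk.injEq] at h1
    omega
  · intro h i j hij
    wlog hlt : i < j generalizing i j
    · rcases (not_lt.1 hlt).eq_or_lt with h1 | h1
      exacts [h1.symm, (this hij.symm h1).symm]
    exfalso
    have hsplit : (l.take j).take i ++ (l.take j).drop i = l.take j := List.take_append_drop _ _
    rw [List.take_take, min_eq_left (Fin.lt_def.1 hlt).le] at hsplit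
    refine h ((l.take j).drop i)
      ((List.drop_suffix _ _).isInfix.trans (List.take_prefix _ _).isInfix) ?_ ?_
    · have := Fin.lt_def.1 hlt
      have := j.is_lt
      refine List.length_pos_iff.1 ?_
      rw [List.length_drop, List.length_take]
      omega
    · have h1 := congrArg List.sum hsplit
      rw [List.sum_append, ← show (l.take i).sum = (l.take j).sum from hij] at h1
      simpa using h1

theorem sum_take_ofFn_sub {V : Type*} [AddCommGroup V] {n : ℕ} (ω : Fin (n + 1) → V)
    (i : Fin (n + 1)) :
    ((List.ofFn fun k : Fin n => ω k.succ - ω k.castSucc).take i).sum = ω i - ω 0 := by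
  induction i using Fin.induction with
  | zero => simp
  | succ i ih =>
    rw [Fin.val_succ, List.sum_take_succ _ _ (by simp)]
    rw [Fin.val_castSucc] at ih
    rw [ih]
    simp

theorem ncard_sawSet_unitSteps (d n : ℕ) : (sawSet (unitSteps d) n).ncard = sawCount d n := by
  have himage : {ω | IsSAW d n ω} =
      Set.image (fun (l : List (Fin d → ℤ)) (i : Fin (n + 1)) => (l.take i).sum)
        (sawSet (unitSteps d) n) := by
    ext ω
    constructor
    · rintro ⟨h0, h1, h2⟩
      set l := List.ofFn fun k : Fin n => ω k.succ - ω k.castSucc with hl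
      have hω : (fun i : Fin (n + 1) => (l.take i).sum) = ω := by
        funext i
        rw [hl, sum_take_ofFn_sub, h0, sub_zero]
      have hlen : l.length = n := by simp [hl]
      refine ⟨l, ⟨⟨fun v hv => ?_, (take_sum_injective_iff hlen).1 (hω.symm ▸ h2)⟩, hlen⟩, hω⟩
      obtain ⟨k, rfl⟩ := List.mem_ofFn.1 hv
      exact h1 k
    · rintro ⟨l, ⟨⟨h1, h2⟩, hlen⟩, rfl⟩
      refine ⟨by simp, fun i => ?_, (take_sum_injective_iff hlen).2 h2⟩
      have hi : (i : ℕ) < l.length := hlen.symm ▸ i.is_lt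
      have : ∑ j, |l[(i : ℕ)] j| = 1 := h1 _ (List.getElem_mem hi)
      simpa [List.sum_take_succ _ _ hi] using this
  rw [sawCount, himage, Set.InjOn.ncard_image]
  rintro l ⟨-, hl⟩ m ⟨-, hm⟩ h
  refine List.ext_getElem (hl.trans hm.symm) fun i hil him => ?_
  have h1 : (l.take i).sum = (m.take i).sum := congrFun h ⟨i, by omega⟩
  have h2 : (l.take (i + 1)).sum = (m.take (i + 1)).sum := congrFun h ⟨i + 1, by omega⟩
  rwa [List.sum_take_succ _ _ hil, List.sum_take_succ _ _ him, h1, add_right_inj] at h2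

end Lattice

/-- **Hammersley–Welsh.** For `ℤ^d` with `d ≥ 2` there is a constant `γ > 1` such that
`σ_n ≤ κ^n γ^{√n}` for all `n ≥ 1`, where `κ = lim σ_n^{1/n}` is the connective constant. -/
theorem hammersley_welsh (d : ℕ) (hd : 2 ≤ d) (κ : ℝ)
    (hκ : Tendsto (fun n : ℕ => (sawCount d n : ℝ) ^ (1 / (n : ℝ))) atTop (𝓝 κ)) :
    ∃ γ : ℝ, 1 < γ ∧ ∀ n : ℕ, 1 ≤ n →
      (sawCount d n : ℝ) ≤ κ ^ n * γ ^ (Real.sqrt n) := by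
  simp only [← ncard_sawSet_unitSteps] at hκ ⊢
  let i : Fin d := ⟨0, by omega⟩
  have hφe : 0 < Pi.evalAddMonoidHom (fun _ : Fin d => ℤ) i (Pi.single i 1) := by simp
  have hκ1 := one_le_of_tendsto_ncard_sawSet (finite_unitSteps d) (single_mem_unitSteps i) hφe hκ
  refine ⟨κ * Real.exp 4, ?_, fun n hn => ?_⟩
  · exact one_lt_mul_of_le_of_lt hκ1 (Real.one_lt_exp_iff.2 (by norm_num))
  · exact ncard_sawSet_le (finite_unitSteps d) neg_mem_unitSteps
      (fun v hv => (le_abs_self _).trans (abs_apply_le_one hv i)) (single_mem_unitSteps i) hφe hκ hn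
end

section
/- For the square lattice ℤ², there exist constants ε > 0 and C > 0 such that for all n ≥ 1, σ_n ≤ κ^n · exp(C n^{1/2 − ε}), where κ is the connective constant of ℤ². -/
open Filter Topology

open scoped ENNReal

namespace SAWBound

/-- A lattice step: the first component says whether it is vertical, the second gives its sign. -/
abbrev Step := Bool × Bool

/-- A lattice path up to translation, as the list of its steps. -/
abbrev Word := List Step

/-- Horizontal component of a step. -/
def dx (s : Step) : ℤ := if s.1 then 0 else if s.2 then 1 else -1

/-- Vertical component of a step. -/
def dy (s : Step) : ℤ := if s.1 then (if s.2 then 1 else -1) else 0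

/-- Horizontal displacement of a word. -/
def xd (w : Word) : ℤ := (w.map dx).sum

/-- Vertical displacement of a word. -/
def yd (w : Word) : ℤ := (w.map dy).sum

/-- Reflection of a word in a horizontal line. -/
def vflip (w : Word) : Word := w.map fun s => if s.1 then (s.1, !s.2) else s

@[simp] lemma xd_nil : xd [] = 0 := rfl
@[simp] lemma yd_nil : yd [] = 0 := rfl
@[simp] lemma xd_cons (s : Step) (w : Word) : xd (s :: w) = dx s + xd w := by simp [xd]
@[simp] lemma yd_cons (s : Step) (w : Word) : yd (s :: w) = dy s + yd w := by simp [yd]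
@[simp] lemma xd_append (a b : Word) : xd (a ++ b) = xd a + xd b := by simp [xd]
@[simp] lemma yd_append (a b : Word) : yd (a ++ b) = yd a + yd b := by simp [yd]
@[simp] lemma vflip_nil : vflip [] = [] := rfl
@[simp] lemma vflip_append (a b : Word) : vflip (a ++ b) = vflip a ++ vflip b := by simp [vflip]
@[simp] lemma length_vflip (a : Word) : (vflip a).length = a.length := by simp [vflip]
@[simp] lemma vflip_eq_nil (a : Word) : vflip a = [] ↔ a = [] := by simp [vflip]

@[simp] lemma vflip_vflip (a : Word) : vflip (vflip a) = a := by
  induction a with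
  | nil => rfl
  | cons s w ih =>
    simp only [vflip, List.map_cons] at ih ⊢
    rw [ih]
    rcases s with ⟨_ | _, _ | _⟩ <;> rfl

@[simp] lemma xd_vflip (a : Word) : xd (vflip a) = xd a := by
  induction a with
  | nil => rfl
  | cons s w ih =>
    simp only [vflip, List.map_cons, xd_cons] at ih ⊢
    rw [ih]
    rcases s with ⟨_ | _, _ | _⟩ <;> rfl

@[simp] lemma yd_vflip (a : Word) : yd (vflip a) = -yd a := by
  induction a with
  | nil => rfl
  | cons s w ih =>
    simp only [vflip, List.map_cons, yd_cons] at ih ⊢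
    rw [ih]
    rcases s with ⟨_ | _, _ | _⟩ <;> simp [dy] <;> ring

lemma abs_xd_le (a : Word) : |xd a| ≤ a.length := by
  induction a with
  | nil => simp
  | cons s w ih =>
    have : |dx s| ≤ 1 := by rcases s with ⟨_ | _, _ | _⟩ <;> simp [dx]
    simp only [xd_cons, List.length_cons]
    have := abs_add_le (dx s) (xd w)
    push_cast; linarith

lemma abs_yd_le (a : Word) : |yd a| ≤ a.length := by
  induction a with
  | nil => simp
  | cons s w ih =>
    have : |dy s| ≤ 1 := by rcases s with ⟨_ | _, _ | _⟩ <;> simp [dy]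
    simp only [yd_cons, List.length_cons]
    have := abs_add_le (dy s) (yd w)
    push_cast; linarith

lemma yd_le_length (a : Word) : yd a ≤ a.length := (le_abs_self _).trans (abs_yd_le a)

/-- A word is self-avoiding when no nonempty factor has zero displacement. -/
def Avoid (w : Word) : Prop := ∀ a b c, w = a ++ (b ++ c) → b ≠ [] → xd b = 0 → yd b ≠ 0

lemma Avoid.of_infix {w a b c : Word} (h : Avoid w) (e : w = a ++ (b ++ c)) : Avoid b := by
  rintro a' b' c' rfl hb
  exact h (a ++ a') b' (c' ++ c) (by simp [e]) hb

lemma Avoid.left {a b : Word} (h : Avoid (a ++ b)) : Avoid a :=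
  h.of_infix (a := []) (c := b) (by simp)

lemma Avoid.right {a b : Word} (h : Avoid (a ++ b)) : Avoid b :=
  h.of_infix (a := a) (c := []) (by simp)

lemma Avoid.vflip {w : Word} (h : Avoid w) : Avoid (vflip w) := by
  intro a b c e hb hx hy
  refine h (SAWBound.vflip a) (SAWBound.vflip b) (SAWBound.vflip c) ?_ (by simpa) (by simpa)
    (by simpa)
  rw [← vflip_append, ← vflip_append, ← e, vflip_vflip]

lemma avoid_append {u v : Word} (hu : Avoid u) (hv : Avoid v)
    (h : ∀ u₁ u₂ v₁ v₂, u = u₁ ++ u₂ → v = v₁ ++ v₂ → u₂ ≠ [] → v₁ ≠ [] →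
      xd u₂ + xd v₁ = 0 → yd u₂ + yd v₁ ≠ 0) : Avoid (u ++ v) := by
  intro a b c e hb
  rcases List.append_eq_append_iff.1 e with ⟨t, rfl, ht⟩ | ⟨t, rfl, ht⟩
  · exact hv t b c ht hb
  · rcases List.append_eq_append_iff.1 ht with ⟨s, rfl, hs⟩ | ⟨s, rfl, hs⟩
    · exact hu a b s rfl hb
    · by_cases hs' : s = []
      · subst hs'
        simp only [List.append_nil] at hb ⊢
        exact hu a t [] (by simp) hb
      by_cases ht' : t = []
      · subst ht'
        simp only [List.nil_append]
        exact hv [] s c (by simpa using hs) hs'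
      simpa using h a t s c rfl hs ht' hs'

/-- A bridge: after its start it stays strictly above the starting level and it ends at its
maximal level. -/
structure Bridge (w : Word) : Prop where
  avoid : Avoid w
  pos : ∀ a b, w = a ++ b → a ≠ [] → 0 < yd a
  top : ∀ a b, w = a ++ b → 0 ≤ yd b

lemma avoid_nil : Avoid [] := by
  intro a b c e hb
  simp at e
  exact absurd e.2.1 hb

lemma Bridge.nil : Bridge [] :=
  ⟨avoid_nil, fun a b e ha => by simp at e; exact absurd e.1 ha,
    fun a b e => by simp at e; simp [e]⟩

lemma Bridge.yd_nonneg {w : Word} (h : Bridge w) : 0 ≤ yd w := h.top [] w rfl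

lemma Bridge.yd_pos {w : Word} (h : Bridge w) (hw : w ≠ []) : 0 < yd w := h.pos w [] (by simp) hw

lemma Bridge.pos' {a b : Word} (h : Bridge (a ++ b)) : 0 ≤ yd a := by
  by_cases ha : a = []
  · simp [ha]
  · exact (h.pos a b rfl ha).le

lemma Bridge.append {u v : Word} (hu : Bridge u) (hv : Bridge v) : Bridge (u ++ v) := by
  refine ⟨avoid_append hu.avoid hv.avoid ?_, ?_, ?_⟩
  · intro u₁ u₂ v₁ v₂ e₁ e₂ _ h₂ _
    have := hu.top _ _ e₁
    have := hv.pos _ _ e₂ h₂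
    omega
  · intro a b e ha
    rcases List.append_eq_append_iff.1 e with ⟨t, rfl, ht⟩ | ⟨t, rfl, ht⟩
    · by_cases ht' : t = []
      · subst ht'
        simp only [List.append_nil] at ha ⊢
        exact hu.yd_pos ha
      · have := hu.yd_nonneg
        have := hv.pos _ _ ht ht'
        simp; omega
    · exact hu.pos _ _ rfl ha
  · intro a b e
    rcases List.append_eq_append_iff.1 e with ⟨t, rfl, ht⟩ | ⟨t, rfl, ht⟩
    · exact hv.top _ _ ht
    · have := hu.top _ _ rfl
      have := hv.yd_nonneg
      subst ht
      simp; omega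

/-- An irreducible bridge: a nonempty bridge that is not a concatenation of shorter bridges. -/
structure Irr (w : Word) : Prop where
  bridge : Bridge w
  ne_nil : w ≠ []
  irred : ∀ a b, w = a ++ b → Bridge a → Bridge b → a = [] ∨ b = []

lemma Irr.yd_pos {w : Word} (h : Irr w) : 0 < yd w := h.bridge.yd_pos h.ne_nil

lemma Bridge.middle {a c b : Word} (h₁ : Bridge (a ++ c)) (h₂ : Bridge (c ++ b)) : Bridge c :=
  ⟨h₁.avoid.right, fun p q e hp => h₂.pos p (q ++ b) (by simp [e]) hp,
    fun p q e => h₁.top (a ++ p) q (by simp [e])⟩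

lemma irr_prefix_unique {J J' b b' : Word} (hJ : Irr J) (hJ' : Irr J') (hb : Bridge b)
    (hb' : Bridge b') (e : J ++ b = J' ++ b') : J = J' := by
  rcases List.append_eq_append_iff.1 e with ⟨t, rfl, rfl⟩ | ⟨t, rfl, rfl⟩
  · rcases hJ'.irred J t rfl hJ.bridge (hJ'.bridge.middle hb) with h | h
    · exact absurd h hJ.ne_nil
    · simp [h]
  · rcases hJ.irred J' t rfl hJ'.bridge (hJ.bridge.middle hb') with h | h
    · exact absurd h hJ'.ne_nil
    · simp [h]

lemma exists_irr_prefix : ∀ {w : Word}, Bridge w → w ≠ [] →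
    ∃ J b, w = J ++ b ∧ Irr J ∧ Bridge b := by
  intro w hw hne
  classical
  have hex : ∃ n, ∃ a b, w = a ++ b ∧ a ≠ [] ∧ Bridge a ∧ Bridge b ∧ a.length = n :=
    ⟨_, w, [], by simp, hne, hw, Bridge.nil, rfl⟩
  obtain ⟨a, b, e, ha, hba, hbb, hl⟩ := Nat.find_spec hex
  refine ⟨a, b, e, ⟨hba, ha, ?_⟩, hbb⟩
  intro p q epq hp hq
  by_contra! hcon
  refine Nat.find_min hex (m := p.length) ?_
    ⟨p, q ++ b, by simp [e, epq], hcon.1, hp, hq.append hbb, rfl⟩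
  rw [← hl, epq, List.length_append]
  have := List.length_pos_of_ne_nil hcon.2
  omega

/-- The irreducible piece of a bridge containing a given position. -/
lemma exists_irr_piece : ∀ (n : ℕ) {w a b : Word}, w.length = n → Bridge w → w = a ++ b → a ≠ [] →
    ∃ W J W', w = W ++ (J ++ W') ∧ Bridge W ∧ Irr J ∧ Bridge W' ∧ W.length < a.length ∧
      a.length ≤ W.length + J.length := by
  intro n
  induction n using Nat.strong_induction_on with
  | _ n ih =>
  intro w a b hn hw e ha
  have hwne : w ≠ [] := by rintro rfl; simp at e; exact ha e.1
  obtain ⟨J, c, hJc, hJ, hc⟩ := exists_irr_prefix hw hwne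
  have hJl := List.length_pos_of_ne_nil hJ.ne_nil
  by_cases hle : a.length ≤ J.length
  · exact ⟨[], J, c, by simpa using hJc, Bridge.nil, hJ, hc,
      by simpa using List.length_pos_of_ne_nil ha, by simpa using hle⟩
  · rw [hJc] at e
    rcases List.append_eq_append_iff.1 e with ⟨t, rfl, ht⟩ | ⟨t, rfl, ht⟩
    · have htne : t ≠ [] := by rintro rfl; simp at hle
      obtain ⟨W, K, W', h1, h2, h3, h4, h5, h6⟩ := ih c.length
        (by rw [← hn, hJc, List.length_append]; omega) rfl hc ht htne
      refine ⟨J ++ W, K, W', by simp [hJc, h1], hJ.bridge.append h2, h3, h4, ?_, ?_⟩ <;>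
        simp only [List.length_append] <;> omega
    · simp at hle

/-- The generating weight of a set of words at parameter `z`. -/
noncomputable def wt (z : ℝ≥0∞) (S : Set Word) : ℝ≥0∞ := ∑' w : S, z ^ w.1.length

lemma wt_mono (z : ℝ≥0∞) {S T : Set Word} (h : S ⊆ T) : wt z S ≤ wt z T :=
  ENNReal.tsum_mono_subtype (fun w : Word => z ^ w.length) h

lemma wt_union_le (z : ℝ≥0∞) (S T : Set Word) : wt z (S ∪ T) ≤ wt z S + wt z T :=
  ENNReal.tsum_union_le (fun w : Word => z ^ w.length) S T

lemma wt_biUnion_le {ι : Type*} (z : ℝ≥0∞) (s : Finset ι) (S : ι → Set Word) :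
    wt z (⋃ i ∈ s, S i) ≤ ∑ i ∈ s, wt z (S i) :=
  ENNReal.tsum_biUnion_le (fun w : Word => z ^ w.length) s S

lemma wt_mono_left {y z : ℝ≥0∞} (h : y ≤ z) (S : Set Word) : wt y S ≤ wt z S :=
  ENNReal.tsum_le_tsum fun _ => pow_le_pow_left' h _

lemma wt_le_mul (z C : ℝ≥0∞) {S A : Set Word} (B : Word → Set Word) (F : Word → Word → Word)
    (hF : ∀ a b, (F a b).length = a.length + b.length)
    (hS : ∀ w ∈ S, ∃ a ∈ A, ∃ b ∈ B a, w = F a b) (hB : ∀ a ∈ A, wt z (B a) ≤ C) :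
    wt z S ≤ wt z A * C := by
  choose! f hf g hg hfg using hS
  have hinj : Function.Injective (fun w : S => (⟨⟨f w, hf w w.2⟩, ⟨g w, hg w w.2⟩⟩ :
      Σ a : A, B a)) := by
    rintro ⟨w, hw⟩ ⟨w', hw'⟩ h
    simp only [Sigma.mk.injEq, Subtype.mk.injEq] at h
    obtain ⟨h1, h2⟩ := h
    have h3 : g w = g w' := by
      have : B (f w) = B (f w') := by rw [h1]
      have := (Subtype.heq_iff_coe_eq (fun x => by rw [this])).1 h2
      exact this
    ext1
    simp only
    rw [hfg w hw, hfg w' hw', h1, h3]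
  calc wt z S = ∑' w : S, (fun p : Σ a : A, B a => z ^ p.1.1.length * z ^ p.2.1.length)
        ⟨⟨f w, hf w w.2⟩, ⟨g w, hg w w.2⟩⟩ := by
        refine tsum_congr fun w => ?_
        show z ^ w.1.length = z ^ (f w).length * z ^ (g w).length
        rw [← pow_add, ← hF, ← hfg w w.2]
    _ ≤ ∑' p : Σ a : A, B a, z ^ p.1.1.length * z ^ p.2.1.length :=
        ENNReal.tsum_comp_le_tsum_of_injective hinj _
    _ = ∑' a : A, ∑' b : B a, z ^ a.1.length * z ^ b.1.length := ENNReal.tsum_sigma' _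
    _ = ∑' a : A, z ^ a.1.length * wt z (B a) := by simp only [ENNReal.tsum_mul_left, wt]
    _ ≤ ∑' a : A, z ^ a.1.length * C :=
        ENNReal.tsum_le_tsum fun a => mul_le_mul_right (hB a a.2) _
    _ = wt z A * C := by rw [ENNReal.tsum_mul_right, wt]

lemma mul_le_wt (z : ℝ≥0∞) {S A B : Set Word} (hS : ∀ a ∈ A, ∀ b ∈ B, a ++ b ∈ S)
    (hinj : ∀ a ∈ A, ∀ b ∈ B, ∀ a' ∈ A, ∀ b' ∈ B, a ++ b = a' ++ b' → a = a') :
    wt z A * wt z B ≤ wt z S := by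
  have : Function.Injective (fun p : A × B => (⟨p.1 ++ p.2, hS _ p.1.2 _ p.2.2⟩ : S)) := by
    rintro ⟨⟨a, ha⟩, ⟨b, hb⟩⟩ ⟨⟨a', ha'⟩, ⟨b', hb'⟩⟩ h
    simp only [Subtype.mk.injEq] at h
    have h1 := hinj a ha b hb a' ha' b' hb' h
    subst h1
    simp at h
    simp [h]
  calc wt z A * wt z B = ∑' p : A × B, z ^ (p.1.1.length) * z ^ p.2.1.length := by
        rw [ENNReal.tsum_prod' (f := fun p : A × B => z ^ (p.1.1.length) * z ^ p.2.1.length)]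
        simp only [ENNReal.tsum_mul_left, ENNReal.tsum_mul_right, wt]
    _ = ∑' p : A × B, (fun w : S => z ^ w.1.length) ⟨p.1 ++ p.2, hS _ p.1.2 _ p.2.2⟩ := by
        refine tsum_congr fun p => ?_
        simp [pow_add]
    _ ≤ wt z S := ENNReal.tsum_comp_le_tsum_of_injective this _

/-- The set of all bridges. -/
def BR : Set Word := {w | Bridge w}

/-- Bridges of height `h`. -/
def Br (h : ℤ) : Set Word := {w | Bridge w ∧ yd w = h}

/-- The set of all irreducible bridges. -/
def IR : Set Word := {w | Irr w}

/-- Irreducible bridges of length at least `m`. -/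
def IRge (m : ℕ) : Set Word := {w | Irr w ∧ m ≤ w.length}

@[simp] lemma wt_nil (z : ℝ≥0∞) : wt z {[]} = 1 := by simp [wt]

@[simp] lemma wt_empty (z : ℝ≥0∞) : wt z ∅ = 0 := by simp [wt]

lemma wt_union_disjoint (z : ℝ≥0∞) {S T : Set Word} (h : Disjoint S T) :
    wt z (S ∪ T) = wt z S + wt z T :=
  ENNReal.summable.tsum_union_disjoint (f := fun w : Word => z ^ w.length) h ENNReal.summable

lemma wt_le_mul' (z : ℝ≥0∞) {S A B : Set Word} (F : Word → Word → Word)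
    (hF : ∀ a b, (F a b).length = a.length + b.length)
    (hS : ∀ w ∈ S, ∃ a ∈ A, ∃ b ∈ B, w = F a b) : wt z S ≤ wt z A * wt z B :=
  wt_le_mul z (wt z B) (fun _ => B) F hF hS fun _ _ => le_rfl

lemma one_le_wt_BR (z : ℝ≥0∞) : 1 ≤ wt z BR := by
  rw [← wt_nil z]
  exact wt_mono z (by simpa [BR] using Bridge.nil)

lemma wt_IR_le_one {z : ℝ≥0∞} (h : wt z BR ≠ ∞) : wt z IR ≤ 1 := by
  have h1 : wt z IR * wt z BR ≤ wt z BR := by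
    refine mul_le_wt z (fun a ha b hb => Bridge.append ha.bridge hb) ?_
    exact fun a ha b hb a' ha' b' hb' e => irr_prefix_unique ha ha' hb hb' e
  have h0 : wt z BR ≠ 0 := (zero_lt_one.trans_le (one_le_wt_BR z)).ne'
  exact (ENNReal.mul_le_mul_iff_left h0 h).1 (by simpa using h1)

lemma one_le_wt_IR_add {z : ℝ≥0∞} (h : wt z BR ≠ ∞) : 1 ≤ wt z IR + (wt z BR)⁻¹ := by
  have h1 : wt z BR ≤ 1 + wt z IR * wt z BR := by
    calc wt z BR ≤ wt z ({[]} ∪ {w | Bridge w ∧ w ≠ []}) := wt_mono z fun w hw => by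
          by_cases h : w = []
          · simp [h]
          · exact Or.inr ⟨hw, h⟩
      _ ≤ wt z {[]} + wt z {w | Bridge w ∧ w ≠ []} := wt_union_le z _ _
      _ ≤ 1 + wt z IR * wt z BR := by
          rw [wt_nil]
          gcongr
          refine wt_le_mul' z (· ++ ·) (by simp) ?_
          rintro w ⟨hw, hne⟩
          obtain ⟨J, b, e, hJ, hb⟩ := exists_irr_prefix hw hne
          exact ⟨J, hJ, b, hb, e⟩
  have h0 : wt z BR ≠ 0 := (zero_lt_one.trans_le (one_le_wt_BR z)).ne'
  refine (ENNReal.mul_le_mul_iff_left h0 h).1 ?_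
  rw [add_mul, ENNReal.inv_mul_cancel h0 h, one_mul, add_comm]
  exact h1

lemma Bridge.length_eq_zero {w : Word} (h : Bridge w) (h0 : yd w = 0) : w = [] := by
  by_contra hw
  have := h.yd_pos hw
  omega

lemma wt_Br_le_one {z : ℝ≥0∞} (hI : wt z IR ≤ 1) (h : ℤ) : wt z (Br h) ≤ 1 := by
  rcases lt_trichotomy h 0 with hh | rfl | hh
  · have : Br h = ∅ := by
      ext w
      simp only [Br, Set.mem_ofPred_eq, Set.mem_empty_iff_false, iff_false, not_and]
      intro hw
      have := hw.yd_nonneg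
      omega
    simp [this]
  · rw [← wt_nil z]
    exact wt_mono z fun w hw => hw.1.length_eq_zero hw.2
  · lift h to ℕ using hh.le
    induction h using Nat.strong_induction_on with
    | _ h ih =>
    refine (wt_le_mul z 1 (A := IR) (fun J => Br (h - yd J)) (· ++ ·) (by simp) ?_ ?_).trans
      (by simpa using hI)
    · rintro w ⟨hw, hy⟩
      obtain ⟨J, b, rfl, hJ, hb⟩ := exists_irr_prefix hw (by rintro rfl; simp at hy; omega)
      exact ⟨J, hJ, b, ⟨hb, by simp at hy; omega⟩, rfl⟩
    · intro J hJ
      have hJp : 0 < yd J := Irr.yd_pos hJ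
      rcases lt_trichotomy ((h : ℤ) - yd J) 0 with h' | h' | h'
      · have : Br ((h : ℤ) - yd J) = ∅ := by
          ext w
          simp only [Br, Set.mem_ofPred_eq, Set.mem_empty_iff_false, iff_false, not_and]
          intro hw
          have := hw.yd_nonneg
          omega
        simp [this]
      · rw [h', ← wt_nil z]
        exact wt_mono z fun w hw => hw.1.length_eq_zero hw.2
      · have := ih ((h : ℤ) - yd J).toNat (by omega) (by omega)
        rwa [Int.toNat_of_nonneg h'.le] at this

/-- Words obtained by prepending a bridge to a word of `Y`, with prescribed height. -/
lemma wt_pinned_right {z : ℝ≥0∞} (hI : wt z IR ≤ 1) (Y : Set Word) (h : ℤ) :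
    wt z {w | ∃ a b, w = a ++ b ∧ Bridge a ∧ b ∈ Y ∧ yd w = h} ≤ wt z Y := by
  refine (wt_le_mul z 1 (A := Y) (fun b => Br (h - yd b)) (fun b a => a ++ b)
    (by simp [add_comm]) ?_ fun b _ => wt_Br_le_one hI _).trans (by simp)
  rintro w ⟨a, b, rfl, ha, hb, hy⟩
  exact ⟨b, hb, a, ⟨ha, by simp at hy; omega⟩, rfl⟩

lemma wt_pinned_left {z : ℝ≥0∞} (hI : wt z IR ≤ 1) (Y : Set Word) (h : ℤ) :
    wt z {w | ∃ b a, w = b ++ a ∧ Bridge a ∧ b ∈ Y ∧ yd w = h} ≤ wt z Y := by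
  refine (wt_le_mul z 1 (A := Y) (fun b => Br (h - yd b)) (fun b a => b ++ a)
    (by simp) ?_ fun b _ => wt_Br_le_one hI _).trans (by simp)
  rintro w ⟨b, a, rfl, ha, hb, hy⟩
  exact ⟨b, hb, a, ⟨ha, by simp at hy; omega⟩, rfl⟩

lemma wt_mul_le (y q : ℝ≥0∞) (hq : q ≤ 1) {S : Set Word} {m : ℕ} (hS : ∀ w ∈ S, m ≤ w.length) :
    wt (y * q) S ≤ q ^ m * wt y S := by
  rw [wt, wt, ← ENNReal.tsum_mul_left]
  refine ENNReal.tsum_le_tsum fun w => ?_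
  rw [mul_pow, mul_comm]
  gcongr ?_ * _
  exact pow_le_pow_right_of_le_one' hq (hS w w.2)

lemma wt_Br_le_pow {y q : ℝ≥0∞} (hI : wt y IR ≤ 1) (hq : q ≤ 1) (h : ℕ) :
    wt (y * q) (Br h) ≤ q ^ h := by
  refine (wt_mul_le y q hq (m := h) fun w hw => ?_).trans ?_
  · have := yd_le_length w
    rw [hw.2] at this
    exact_mod_cast this
  · simpa using mul_le_mul_right (wt_Br_le_one hI h) (q ^ h)

/-- Long irreducible bridges carry little weight. -/
lemma wt_IRge_le {y q : ℝ≥0∞} (hI : wt y IR ≤ 1) (hq : q ≤ 1) (hB : wt (y * q) BR ≠ ∞) (m : ℕ) :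
    wt y (IRge m) ≤ q ^ m * wt y (IRge m) + (wt (y * q) BR)⁻¹ := by
  have hyq : y * q ≤ y := by simpa using mul_le_mul_right hq y
  have hsplit : IR = {w | Irr w ∧ w.length < m} ∪ IRge m := by
    ext w
    simp only [IR, IRge, Set.mem_ofPred_eq, Set.mem_union]
    by_cases hw : w.length < m
    · simp [hw]
    · simp [hw, not_lt.1 hw]
  have hd : Disjoint {w : Word | Irr w ∧ w.length < m} (IRge m) := by
    rw [Set.disjoint_left]
    rintro w ⟨_, h1⟩ ⟨_, h2⟩
    omega
  have h1 := one_le_wt_IR_add hB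
  have h2 : wt (y * q) IR ≤ wt y {w | Irr w ∧ w.length < m} + q ^ m * wt y (IRge m) := by
    rw [hsplit, wt_union_disjoint _ hd]
    exact add_le_add (wt_mono_left hyq _) (wt_mul_le y q hq fun w hw => hw.2)
  have h3 := hI
  rw [hsplit, wt_union_disjoint _ hd] at h3
  set S := wt y {w | Irr w ∧ w.length < m}
  have hS : S ≠ ∞ := ne_top_of_le_ne_top ENNReal.one_ne_top (le_self_add.trans h3)
  refine (ENNReal.add_le_add_iff_left hS).1 (h3.trans (h1.trans ?_))
  rw [← add_assoc]
  gcongr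

/-! ### Half-space walks -/

/-- Half-space walks with heights at most `m`. -/
def HS (m : ℕ) : Set Word := {w | Avoid w ∧ (∀ a b, w = a ++ b → a ≠ [] → 0 < yd a) ∧
  ∀ a b, w = a ++ b → yd a ≤ m}

lemma HS_mono {m n : ℕ} (h : m ≤ n) : HS m ⊆ HS n := fun _ hw =>
  ⟨hw.1, hw.2.1, fun a b e => (hw.2.2 a b e).trans (by exact_mod_cast h)⟩

lemma HS_zero : HS 0 ⊆ {[]} := by
  intro w hw
  by_contra hne
  have h1 := hw.2.1 w [] (by simp) hne
  have h2 := hw.2.2 w [] (by simp)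
  simp at h2; omega

lemma exists_last_max {w : Word} {m : ℤ} (h : ∃ a b, w = a ++ b ∧ yd a = m) :
    ∃ a b, w = a ++ b ∧ yd a = m ∧ ∀ c d, b = c ++ d → c ≠ [] → yd c ≠ 0 := by
  classical
  have hex : ∃ n, ∃ a b, w = a ++ b ∧ yd a = m ∧ b.length = n := by
    obtain ⟨a, b, e, h⟩ := h
    exact ⟨_, a, b, e, h, rfl⟩
  obtain ⟨a, b, e, hm, hl⟩ := Nat.find_spec hex
  refine ⟨a, b, e, hm, ?_⟩
  rintro c d rfl hc h0
  refine Nat.find_min hex (m := d.length) ?_ ⟨a ++ c, d, by simp [e], by simp [hm, h0], rfl⟩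
  rw [← hl, List.length_append]
  have := List.length_pos_of_ne_nil hc
  omega

lemma HS_split {m : ℕ} {w : Word} (hw : w ∈ HS (m + 1)) (hn : w ∉ HS m) :
    ∃ V w', w = V ++ vflip w' ∧ V ∈ Br (m + 1) ∧ w' ∈ HS m := by
  obtain ⟨hA, hpos, hle⟩ := hw
  have hex : ∃ a b, w = a ++ b ∧ yd a = (m + 1 : ℤ) := by
    by_contra! hcon
    refine hn ⟨hA, hpos, fun a b e => ?_⟩
    have h1 := hle a b e
    have h2 := hcon a b e
    push_cast at h1
    omega
  obtain ⟨V, u, rfl, hV, hu⟩ := exists_last_max hex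
  push_cast at hle
  have hle' : ∀ c d, u = c ++ d → yd c ≤ 0 := by
    rintro c d rfl
    have := hle (V ++ c) d (by simp)
    simp at this
    omega
  refine ⟨V, vflip u, by simp, ⟨⟨hA.left, fun a b e ha => hpos a (b ++ u) (by simp [e]) ha, ?_⟩,
    hV⟩, hA.right.vflip, ?_, ?_⟩
  · rintro a b rfl
    have := hle a (b ++ u) (by simp)
    simp at hV
    omega
  · intro a b e ha
    have e' : u = vflip a ++ vflip b := by rw [← vflip_append, ← e, vflip_vflip]
    have h1 := hle' _ _ e'
    have h2 := hu _ _ e' (by simpa)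
    simp at h1 h2
    omega
  · intro a b e
    have e' : u = vflip a ++ vflip b := by rw [← vflip_append, ← e, vflip_vflip]
    have h1 := hpos (V ++ vflip a) (vflip b) (by simp [e']) (by
      rintro h
      simp at h
      rw [h.1] at hV
      simp at hV
      omega)
    simp at h1
    omega

lemma wt_HS_zero (z : ℝ≥0∞) : wt z (HS 0) ≤ 1 := by
  rw [← wt_nil z]
  exact wt_mono z HS_zero

lemma wt_HS_succ (z : ℝ≥0∞) (m : ℕ) :
    wt z (HS (m + 1)) ≤ wt z (HS m) * (1 + wt z (Br (m + 1))) := by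
  have hsub : HS (m + 1) ⊆ HS m ∪ (HS (m + 1) \ HS m) := by simp
  refine (wt_mono z hsub).trans ((wt_union_le z _ _).trans ?_)
  rw [mul_add, mul_one]
  gcongr
  rw [mul_comm]
  refine wt_le_mul' z (fun a b => a ++ vflip b) (by simp) ?_
  rintro w ⟨hw, hn⟩
  obtain ⟨V, w', e, hV, hw'⟩ := HS_split hw hn
  exact ⟨V, hV, w', hw', e⟩

/-- Three-strand words: bridges of heights `h₁`, `h₂`, `h₃` traversed up, down and up. -/
def T3 (h₁ h₂ h₃ : ℤ) : Set Word := {u | ∃ V₁ V₂ V₃, u = V₁ ++ (vflip V₂ ++ V₃) ∧ Avoid u ∧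
  V₁ ∈ Br h₁ ∧ V₂ ∈ Br h₂ ∧ V₃ ∈ Br h₃}

lemma wt_two_strands (z : ℝ≥0∞) (S T : Set Word) :
    wt z {u | ∃ a b, u = a ++ vflip b ∧ a ∈ S ∧ b ∈ T} ≤ wt z S * wt z T := by
  refine wt_le_mul' z (fun a b => a ++ vflip b) (by simp) ?_
  rintro w ⟨a, b, e, ha, hb⟩
  exact ⟨a, ha, b, hb, e⟩

lemma wt_T3_le_one {z : ℝ≥0∞} (hI : wt z IR ≤ 1) (h₁ h₂ h₃ : ℤ) : wt z (T3 h₁ h₂ h₃) ≤ 1 := by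
  have := wt_le_mul' z (S := T3 h₁ h₂ h₃) (A := Br h₁)
    (B := {u | ∃ a b, u = vflip a ++ b ∧ a ∈ Br h₂ ∧ b ∈ Br h₃}) (· ++ ·) (by simp) (by
      rintro w ⟨V₁, V₂, V₃, e, _, h1, h2, h3⟩
      exact ⟨V₁, h1, _, ⟨V₂, V₃, rfl, h2, h3⟩, e⟩)
  refine this.trans (mul_le_one' (wt_Br_le_one hI _) ?_)
  have := wt_le_mul' z (S := {u | ∃ a b, u = vflip a ++ b ∧ a ∈ Br h₂ ∧ b ∈ Br h₃}) (A := Br h₂)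
    (B := Br h₃) (fun a b => vflip a ++ b) (by simp) (by
      rintro w ⟨a, b, e, h1, h2⟩
      exact ⟨a, h1, b, h2, e⟩)
  exact this.trans (mul_le_one' (wt_Br_le_one hI _) (wt_Br_le_one hI _))

lemma exists_HS_level {m : ℕ} {w : Word} (hw : w ∈ HS m) :
    w = [] ∨ ∃ k < m, w ∈ HS (k + 1) ∧ w ∉ HS k := by
  induction m with
  | zero => exact Or.inl (HS_zero hw)
  | succ m ih =>
    by_cases h : w ∈ HS m
    · rcases ih h with h | ⟨k, hk, h⟩
      · exact Or.inl h
      · exact Or.inr ⟨k, by omega, h⟩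
    · exact Or.inr ⟨m, by omega, hw, h⟩

/-- Extraction of the first three strands of a half-space walk. -/
lemma wt_HS_succ_le_triples {z : ℝ≥0∞} (hI : wt z IR ≤ 1) (m : ℕ) :
    wt z (HS (m + 1)) ≤ wt z (HS m) + (1 + m +
      ∑ i ∈ Finset.range m, ∑ j ∈ Finset.range i,
        wt z (T3 (m + 1) (i + 1) (j + 1)) * wt z (HS j)) := by
  have hsub : HS (m + 1) ⊆ HS m ∪ (Br (m + 1) ∪ ((⋃ i ∈ Finset.range m,
      {u | ∃ a b, u = a ++ vflip b ∧ a ∈ Br (m + 1) ∧ b ∈ Br (i + 1)}) ∪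
      ⋃ i ∈ Finset.range m, ⋃ j ∈ Finset.range i,
        {u | ∃ a b, u = a ++ vflip b ∧ a ∈ T3 (m + 1) (i + 1) (j + 1) ∧ b ∈ HS j})) := by
    intro w hw
    by_cases hn : w ∈ HS m
    · exact Or.inl hn
    right
    obtain ⟨V₁, w', rfl, hV₁, hw'⟩ := HS_split hw hn
    rcases exists_HS_level hw' with rfl | ⟨i, hi, hwi, hni⟩
    · left
      simpa using hV₁
    right
    obtain ⟨V₂, w'', rfl, hV₂, hw''⟩ := HS_split hwi hni
    rcases exists_HS_level hw'' with rfl | ⟨j, hj, hwj, hnj⟩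
    · left
      simp only [Set.mem_iUnion, Finset.mem_range]
      exact ⟨i, hi, V₁, V₂, by simp, hV₁, hV₂⟩
    right
    obtain ⟨V₃, w3, rfl, hV₃, hw3⟩ := HS_split hwj hnj
    simp only [Set.mem_iUnion, Finset.mem_range]
    refine ⟨i, hi, j, hj, V₁ ++ (vflip V₂ ++ V₃), w3, by simp,
      ⟨V₁, V₂, V₃, rfl, ?_, hV₁, hV₂, hV₃⟩, hw3⟩
    refine hw.1.of_infix (a := []) (c := vflip w3) (by simp)
  refine (wt_mono z hsub).trans ((wt_union_le z _ _).trans ?_)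
  gcongr
  refine (wt_union_le z _ _).trans ?_
  rw [add_assoc]
  gcongr
  · exact wt_Br_le_one hI _
  refine (wt_union_le z _ _).trans ?_
  gcongr
  · refine (wt_biUnion_le z _ _).trans ?_
    calc _ ≤ ∑ i ∈ Finset.range m, (1 : ℝ≥0∞) := Finset.sum_le_sum fun i _ =>
          (wt_two_strands z _ _).trans (mul_le_one' (wt_Br_le_one hI _) (wt_Br_le_one hI _))
      _ = m := by simp
  · refine (wt_biUnion_le z _ _).trans (Finset.sum_le_sum fun i _ => ?_)
    exact (wt_biUnion_le z _ _).trans (Finset.sum_le_sum fun j _ => wt_two_strands z _ _)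

lemma sum_wt_Br_le (z : ℝ≥0∞) (k : ℕ) :
    ∑ h ∈ Finset.range k, wt z (Br (h + 1)) ≤ wt z BR := by
  suffices h : ∑ h ∈ Finset.range k, wt z (Br (h + 1)) ≤ wt z {w | Bridge w ∧ yd w ≤ k} from
    h.trans (wt_mono z fun w hw => hw.1)
  induction k with
  | zero => simp
  | succ k ih =>
    rw [Finset.sum_range_succ]
    refine (add_le_add_left ih _).trans ?_
    rw [← wt_union_disjoint]
    · refine wt_mono z ?_
      rintro w (⟨h1, h2⟩ | ⟨h1, h2⟩)
      · exact ⟨h1, by push_cast; omega⟩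
      · exact ⟨h1, by push_cast; omega⟩
    · rw [Set.disjoint_left]
      rintro w ⟨_, h1⟩ ⟨_, h2⟩
      omega

section Lists

variable {α : Type*}

/-- The total product weight of a set of lists over an alphabet with letter weights `p`. -/
noncomputable def lw (p : α → ℝ≥0∞) (S : Set (List α)) : ℝ≥0∞ := ∑' s : S, (s.1.map p).prod

lemma lw_mono (p : α → ℝ≥0∞) {S T : Set (List α)} (h : S ⊆ T) : lw p S ≤ lw p T :=
  ENNReal.tsum_mono_subtype (fun s : List α => (s.map p).prod) h

lemma lw_union_le (p : α → ℝ≥0∞) (S T : Set (List α)) : lw p (S ∪ T) ≤ lw p S + lw p T :=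
  ENNReal.tsum_union_le (fun s : List α => (s.map p).prod) S T

lemma lw_nil (p : α → ℝ≥0∞) : lw p {[]} = 1 := by simp [lw]

lemma lw_empty (p : α → ℝ≥0∞) : lw p ∅ = 0 := by simp [lw]

lemma lw_cons_le (p : α → ℝ≥0∞) {S : Set (List α)} (B : α → Set (List α))
    (hS : ∀ s ∈ S, ∃ a s', s = a :: s' ∧ s' ∈ B a) : lw p S ≤ ∑' a, p a * lw p (B a) := by
  choose f g hfg hg using fun w : S => hS w.1 w.2
  have hinj : Function.Injective (fun w : S => (⟨f w, ⟨g w, hg w⟩⟩ : Σ a : α, B a)) := by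
    intro w w' h
    simp only [Sigma.mk.injEq] at h
    obtain ⟨h1, h2⟩ := h
    have h3 : g w = g w' := (Subtype.heq_iff_coe_eq (fun x => by rw [h1])).1 h2
    ext1
    rw [hfg w, hfg w', h1, h3]
  calc lw p S = ∑' w : S, (fun q : Σ a : α, B a => p q.1 * (q.2.1.map p).prod)
        ⟨f w, ⟨g w, hg w⟩⟩ := by
        refine tsum_congr fun w => ?_
        show (w.1.map p).prod = p (f w) * ((g w).map p).prod
        rw [← List.prod_cons, ← List.map_cons, ← hfg w]
    _ ≤ ∑' q : Σ a : α, B a, p q.1 * (q.2.1.map p).prod :=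
        ENNReal.tsum_comp_le_tsum_of_injective hinj _
    _ = ∑' a : α, ∑' b : B a, p a * (b.1.map p).prod := ENNReal.tsum_sigma' _
    _ = ∑' a, p a * lw p (B a) := by simp only [ENNReal.tsum_mul_left, lw]

/-- The renewal bound: lists of prescribed total height have total weight at most `1`. -/
lemma lw_height_le_one (p : α → ℝ≥0∞) (hp : ∑' a, p a ≤ 1) (ht : α → ℕ) (h1 : ∀ a, 1 ≤ ht a)
    (h : ℕ) : lw p {s | (s.map ht).sum = h} ≤ 1 := by
  induction h using Nat.strong_induction_on with
  | _ h ih =>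
  rcases Nat.eq_zero_or_pos h with rfl | hpos
  · rw [← lw_nil p]
    refine lw_mono p fun s hs => ?_
    rcases s with _ | ⟨a, s⟩
    · rfl
    · have := h1 a
      simp at hs
      omega
  · refine (lw_cons_le p (fun a => {s | ht a + (s.map ht).sum = h}) ?_).trans
      ((ENNReal.tsum_le_tsum fun a => ?_).trans hp)
    · intro s hs
      rcases s with _ | ⟨a, s⟩
      · simp at hs; omega
      · exact ⟨a, s, rfl, by simpa using hs⟩
    · refine mul_le_of_le_one_right' ?_
      have := h1 a
      rcases le_or_gt (ht a) h with hle | hlt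
      · have h2 := ih (h - ht a) (by omega)
        refine (lw_mono p fun s hs => ?_).trans h2
        simp only [Set.mem_ofPred_eq] at hs ⊢
        omega
      · refine (lw_mono p (T := ∅) fun s hs => ?_).trans (by simp [lw_empty])
        simp only [Set.mem_ofPred_eq] at hs
        omega

lemma lw_height_le_one' (p : α → ℝ≥0∞) (hp : ∑' a, p a ≤ 1) (ht : α → ℕ) (h1 : ∀ a, 1 ≤ ht a)
    (c h : ℕ) : lw p {s | c + (s.map ht).sum = h} ≤ 1 := by
  refine (lw_mono p fun s hs => ?_).trans (lw_height_le_one p hp ht h1 (h - c))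
  simp only [Set.mem_ofPred_eq] at hs ⊢
  omega

/-- Short lists of prescribed height containing a bad letter. -/
lemma lw_bad_le (p : α → ℝ≥0∞) (hp : ∑' a, p a ≤ 1) (ht : α → ℕ) (h1 : ∀ a, 1 ≤ ht a)
    (bad : Set α) (m c h : ℕ) :
    lw p {s | s.length ≤ m ∧ c + (s.map ht).sum = h ∧ ∃ a ∈ s, a ∈ bad} ≤
      m * ∑' a : bad, p a := by
  induction m generalizing c with
  | zero =>
    refine (lw_mono p (T := ∅) fun s hs => ?_).trans (by simp [lw_empty])
    obtain ⟨h1, _, a, h3, _⟩ := hs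
    simp at h1
    simp [h1] at h3
  | succ m ih =>
    refine (lw_mono p (T := {s | c + (s.map ht).sum = h ∧ ∃ a s', s = a :: s' ∧ a ∈ bad} ∪
      {s | ∃ a s', s = a :: s' ∧ s'.length ≤ m ∧ (c + ht a) + (s'.map ht).sum = h ∧
        ∃ a ∈ s', a ∈ bad}) fun s hs => ?_).trans ((lw_union_le p _ _).trans ?_)
    · obtain ⟨hl, hh, a, ha, hb⟩ := hs
      rcases s with _ | ⟨b, s⟩
      · simp at ha
      rcases List.mem_cons.1 ha with rfl | ha'
      · exact Or.inl ⟨hh, a, s, rfl, hb⟩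
      · exact Or.inr ⟨b, s, rfl, by simpa using hl, by simp at hh; omega, a, ha', hb⟩
    · rw [add_comm]
      push_cast
      rw [add_mul, one_mul]
      refine add_le_add ?_ ?_
      · refine (lw_cons_le p (fun a => {s' | s'.length ≤ m ∧ (c + ht a) + (s'.map ht).sum = h ∧
          ∃ a ∈ s', a ∈ bad}) ?_).trans ((ENNReal.tsum_le_tsum fun a =>
          mul_le_mul_right (ih (c + ht a)) (p a)).trans ?_)
        · rintro s ⟨a, s', h⟩
          exact ⟨a, s', h⟩
        · rw [ENNReal.tsum_mul_right]
          exact mul_le_of_le_one_left' hp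
      · classical
        refine (lw_cons_le p (fun a => if a ∈ bad then {s' | (c + ht a) + (s'.map ht).sum = h}
          else ∅) ?_).trans ?_
        · rintro s ⟨hs, a, s', rfl, ha⟩
          exact ⟨a, s', rfl, by simp [ha] at hs ⊢; omega⟩
        · rw [tsum_subtype]
          refine ENNReal.tsum_le_tsum fun a => ?_
          by_cases ha : a ∈ bad
          · simp only [ha, if_true, Set.indicator_of_mem]
            exact mul_le_of_le_one_right' (lw_height_le_one' p hp ht h1 _ _)
          · simp [ha, lw_empty]

/-- Long lists of prescribed height with few marked letters. -/
lemma lw_few_le (p : α → ℝ≥0∞) (hp : ∑' a, p a ≤ 1) (ht : α → ℕ) (h1 : ∀ a, 1 ≤ ht a)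
    (mark : α → Bool) (m k c h : ℕ) :
    lw p {s | m ≤ s.length ∧ c + (s.map ht).sum = h ∧ s.countP mark < k} ≤
      2 ^ k * (∑' a, p a * (if mark a then 2⁻¹ else 1)) ^ m := by
  induction m generalizing c k with
  | zero =>
    rw [pow_zero, mul_one]
    refine (lw_mono p fun s hs => hs.2.1).trans ((lw_height_le_one' p hp ht h1 c h).trans ?_)
    exact one_le_pow_of_one_le' (by norm_num) _
  | succ m ih =>
    refine (lw_cons_le p (fun a => {s' | m ≤ s'.length ∧ (c + ht a) + (s'.map ht).sum = h ∧
      s'.countP mark + (if mark a then 1 else 0) < k}) ?_).trans ?_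
    · rintro s ⟨hl, hs, hk⟩
      rcases s with _ | ⟨a, s⟩
      · simp at hl
      refine ⟨a, s, rfl, by simpa using hl, by simp at hs; omega, ?_⟩
      rwa [List.countP_cons] at hk
    · rw [pow_succ', ← mul_assoc, mul_comm (2 ^ k : ℝ≥0∞), mul_assoc, ← ENNReal.tsum_mul_right]
      refine ENNReal.tsum_le_tsum fun a => ?_
      rw [mul_assoc]
      gcongr p a * ?_
      by_cases ha : mark a
      · simp only [ha, if_true]
        rcases k with _ | k
        · refine (lw_mono p (T := ∅) fun s hs => ?_).trans (by simp [lw_empty])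
          exact absurd hs.2.2 (by omega)
        · refine (lw_mono p fun s hs => ?_).trans ((ih k (c + ht a)).trans ?_)
          · exact ⟨hs.1, hs.2.1, by have := hs.2.2; omega⟩
          · rw [← mul_assoc, pow_succ', ← mul_assoc, ENNReal.inv_mul_cancel (by norm_num)
              (by norm_num), one_mul]
      · simp only [ha]
        simpa [add_assoc] using ih k (c + ht a)

end Lists

lemma lw_bool_count_le (k j : ℕ) :
    lw (fun _ : Bool => 1) {σ | σ.length = k ∧ σ.count true = j} ≤ k.choose j := by
  induction k generalizing j with
  | zero =>
    rcases j with _ | j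
    · refine (lw_mono _ (T := {[]}) fun s hs => ?_).trans (by simp [lw_nil])
      simpa using hs.1
    · refine (lw_mono _ (T := ∅) fun s hs => ?_).trans (by simp [lw_empty])
      obtain ⟨h1, h2⟩ := hs
      simp at h1
      simp [h1] at h2
  | succ k ih =>
    refine (lw_cons_le _ (fun b => {σ | σ.length = k ∧
      σ.count true + (if b then 1 else 0) = j}) ?_).trans ?_
    · rintro s ⟨hl, hk⟩
      rcases s with _ | ⟨a, s⟩
      · simp at hl
      refine ⟨a, s, rfl, by simpa using hl, ?_⟩
      rw [List.count_cons] at hk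
      simpa using hk
    · rw [tsum_bool]
      rcases j with _ | j
      · refine (add_le_add (mul_le_mul_right (ih 0) _) (b := 1 * _) (d := 0) ?_).trans (by simp)
        refine le_of_eq ?_
        have : {σ : List Bool | σ.length = k ∧
          σ.count true + (if (true : Bool) = true then 1 else 0) = 0} = ∅ := by
          ext; simp
        rw [this, lw_empty, mul_zero]
      · rw [Nat.choose_succ_succ]
        push_cast
        rw [add_comm, one_mul, one_mul]
        refine add_le_add ?_ ?_
        · simpa using ih j
        · simpa using ih (j + 1)

lemma centralBinom_sq_le (n : ℕ) : n.centralBinom ^ 2 * (2 * n + 1) ≤ 16 ^ n := by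
  induction n with
  | zero => simp
  | succ n ih =>
    have h := Nat.succ_mul_centralBinom_succ n
    have h2 : (n + 1) ^ 2 * ((n + 1).centralBinom ^ 2 * (2 * (n + 1) + 1)) ≤
        (n + 1) ^ 2 * 16 ^ (n + 1) := by
      calc (n + 1) ^ 2 * ((n + 1).centralBinom ^ 2 * (2 * (n + 1) + 1))
          = ((n + 1) * (n + 1).centralBinom) ^ 2 * (2 * n + 3) := by ring
        _ = (2 * (2 * n + 1) * n.centralBinom) ^ 2 * (2 * n + 3) := by rw [h]
        _ = (4 * (2 * n + 1) * (2 * n + 3)) * (n.centralBinom ^ 2 * (2 * n + 1)) := by ring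
        _ ≤ (16 * (n + 1) ^ 2) * 16 ^ n := by
            refine Nat.mul_le_mul ?_ ih
            nlinarith
        _ = (n + 1) ^ 2 * 16 ^ (n + 1) := by ring
    exact Nat.le_of_mul_le_mul_left h2 (by positivity)

lemma choose_half_sq_le (k : ℕ) : (k.choose (k / 2)) ^ 2 * (k + 1) ≤ 4 ^ k := by
  rcases Nat.even_or_odd' k with ⟨n, rfl | rfl⟩
  · have := centralBinom_sq_le n
    rw [Nat.centralBinom] at this
    rw [Nat.mul_div_cancel_left _ two_pos, pow_mul]
    simpa using this
  · have h := centralBinom_sq_le (n + 1)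
    have h2 : (n + 1).centralBinom = 2 * (2 * n + 1).choose n := by
      rw [Nat.centralBinom, show 2 * (n + 1) = (2 * n + 1) + 1 by ring, Nat.choose_succ_succ,
        show (2 * n + 1).choose (n + 1) = (2 * n + 1).choose n from
          Nat.choose_symm_half n]
      ring
    rw [h2] at h
    rw [show (2 * n + 1) / 2 = n by omega, pow_succ 4, pow_mul]
    norm_num
    have h3 : (16 : ℕ) ^ (n + 1) = 16 * 16 ^ n := by ring
    nlinarith

lemma mul_choose_le {k j r : ℕ} (hr : r ^ 2 ≤ k) : r * k.choose j ≤ 2 ^ k := by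
  have h1 := choose_half_sq_le k
  have h2 := Nat.choose_le_middle j k
  have h3 : (r * k.choose j) ^ 2 ≤ (2 ^ k) ^ 2 := by
    calc (r * k.choose j) ^ 2 = (k.choose j) ^ 2 * r ^ 2 := by ring
      _ ≤ (k.choose (k / 2)) ^ 2 * (k + 1) := by gcongr; omega
      _ ≤ 4 ^ k := h1
      _ = (2 ^ k) ^ 2 := by rw [← pow_mul, mul_comm, pow_mul]; norm_num
  exact (Nat.pow_le_pow_iff_left two_ne_zero).1 h3

/-- The irreducible bridge going up and then right. -/
def upRight : Word := [(true, true), (false, true)]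

/-- The irreducible bridge going up and then left. -/
def upLeft : Word := [(true, true), (false, false)]

lemma irr_up_side (b : Bool) : Irr [(true, true), (false, b)] := by
  have hsplit : ∀ (u v : Step) (p q : Word), [u, v] = p ++ q →
      (p = [] ∧ q = [u, v]) ∨ (p = [u] ∧ q = [v]) ∨ (p = [u, v] ∧ q = []) := by
    intro u v p q e
    rcases p with _ | ⟨x, _ | ⟨x', _ | ⟨x'', p⟩⟩⟩
    · simp at e; simp [e]
    · simp at e; simp [e]
    · simp at e; simp [e]
    · simp at e
  refine ⟨⟨?_, ?_, ?_⟩, by simp, ?_⟩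
  · intro p q r e hq hx hy
    have h1 : yd [(true, true), (false, b)] = yd p + (yd q + yd r) := by rw [e]; simp
    rcases hsplit _ _ _ _ e with ⟨rfl, h⟩ | ⟨rfl, h⟩ | ⟨rfl, h⟩
    · rcases hsplit _ _ _ _ h.symm with ⟨rfl, h⟩ | ⟨rfl, h⟩ | ⟨rfl, h⟩
      · exact hq rfl
      · simp [dy] at hy
      · simp [dy] at hy
    · rcases q with _ | ⟨x, q⟩
      · exact hq rfl
      · simp at h
        obtain ⟨rfl, rfl, rfl⟩ := h
        cases b <;> simp [dx] at hx
    · simp at h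
      exact hq h.1
  · intro p q e hp
    rcases hsplit _ _ _ _ e with ⟨rfl, h⟩ | ⟨rfl, h⟩ | ⟨rfl, h⟩
    · exact absurd rfl hp
    · simp [dy]
    · simp [dy]
  · intro p q e
    rcases hsplit _ _ _ _ e with ⟨rfl, rfl⟩ | ⟨rfl, rfl⟩ | ⟨rfl, rfl⟩ <;> simp [dy]
  · intro p q e _ hq
    rcases hsplit _ _ _ _ e with ⟨rfl, rfl⟩ | ⟨rfl, rfl⟩ | ⟨rfl, rfl⟩
    · exact Or.inl rfl
    · have := hq.yd_pos (by simp)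
      simp [dy] at this
    · exact Or.inr rfl

/-- The skeleton alphabet: irreducible bridges with `upLeft` identified with `upRight`. -/
abbrev Letter := {J : Word // Irr J ∧ J ≠ upLeft}

namespace Letter

/-- Whether a letter stands for both `upRight` and `upLeft`. -/
def mark (a : Letter) : Bool := a.1 = upRight

/-- The height of a letter. -/
def ht (a : Letter) : ℕ := (yd a.1).toNat

/-- The weight of a letter. -/
noncomputable def weight (z : ℝ≥0∞) (a : Letter) : ℝ≥0∞ :=
  z ^ a.1.length * if a.mark then 2 else 1

/-- The letter standing for `upRight` and `upLeft`. -/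
def side : Letter := ⟨upRight, irr_up_side true, by simp [upRight, upLeft]⟩

lemma mark_eq_true {a : Letter} : a.mark = true ↔ a = side := by
  simp [mark, side, Subtype.ext_iff]

lemma ht_eq (a : Letter) : (a.ht : ℤ) = yd a.1 := Int.toNat_of_nonneg a.2.1.yd_pos.le

lemma one_le_ht (a : Letter) : 1 ≤ a.ht := by
  have := a.2.1.yd_pos
  have := a.ht_eq
  omega

lemma ht_le_length (a : Letter) : a.ht ≤ a.1.length := by
  have := yd_le_length a.1
  have := a.ht_eq
  omega

lemma tsum_pow_add (z : ℝ≥0∞) : ∑' a : Letter, z ^ a.1.length + z ^ 2 = wt z IR := by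
  have h1 : IR = {J | Irr J ∧ J ≠ upLeft} ∪ {upLeft} := by
    ext J
    by_cases h : J = upLeft
    · subst h
      simpa [IR] using show Irr upLeft from irr_up_side false
    · simp [IR, h]
  rw [h1, wt_union_disjoint _ (by simp)]
  congr 1
  simp [wt, upLeft]

lemma tsum_mark (z : ℝ≥0∞) : ∑' a : Letter, z ^ a.1.length * (if a.mark then 1 else 0) = z ^ 2 := by
  rw [tsum_eq_single side]
  · rw [if_pos (mark_eq_true.2 rfl)]
    simp [side, upRight]
  · intro a ha
    rw [if_neg (fun h => ha (mark_eq_true.1 h)), mul_zero]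

lemma tsum_weight (z : ℝ≥0∞) : ∑' a, weight z a = wt z IR := by
  rw [← tsum_pow_add, ← tsum_mark, ← ENNReal.tsum_add]
  refine tsum_congr fun a => ?_
  rw [weight]
  split_ifs
  · ring
  · ring

lemma tsum_weight_half (z : ℝ≥0∞) :
    ∑' a, weight z a * (if a.mark then 2⁻¹ else 1) + z ^ 2 = wt z IR := by
  rw [← tsum_pow_add]
  congr 1
  refine tsum_congr fun a => ?_
  rw [weight]
  split_ifs
  · rw [mul_assoc, ENNReal.mul_inv_cancel (by norm_num) (by norm_num), mul_one]
  · ring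

lemma tsum_weight_bad (z : ℝ≥0∞) (L : ℕ) :
    ∑' a : {a : Letter | L ≤ a.1.length}, weight z a ≤ 2 * wt z (IRge L) := by
  rw [wt, ← ENNReal.tsum_mul_left]
  have hinj : Function.Injective (fun a : {a : Letter | L ≤ a.1.length} =>
      (⟨a.1.1, a.1.2.1, a.2⟩ : IRge L)) := by
    rintro ⟨⟨a, ha⟩, ha'⟩ ⟨⟨b, hb⟩, hb'⟩ h
    have h' : a = b := congrArg Subtype.val h
    subst h'
    rfl
  refine (ENNReal.tsum_le_tsum fun a => ?_).trans
    (ENNReal.tsum_comp_le_tsum_of_injective hinj fun w => 2 * z ^ w.1.length)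
  simp only [weight]
  rw [mul_comm]
  gcongr
  split_ifs
  · exact le_rfl
  · norm_num

end Letter

open Letter

/-- The bridge with a given skeleton and given choices of sides. -/
def build : List Letter → List Bool → Word
  | [], _ => []
  | a :: s, [] => a.1 ++ build s []
  | a :: s, b :: σ => if a.mark then (if b then upRight else upLeft) ++ build s σ
      else a.1 ++ build s (b :: σ)

lemma exists_build {w : Word} (hw : Bridge w) :
    ∃ s σ, w = build s σ ∧ σ.length = s.countP mark := by
  induction hn : w.length using Nat.strong_induction_on generalizing w with
  | _ n ih =>
  by_cases hne : w = []
  · exact ⟨[], [], by simp [hne, build], by simp⟩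
  obtain ⟨J, b, rfl, hJ, hb⟩ := exists_irr_prefix hw hne
  have hJl := List.length_pos_of_ne_nil hJ.ne_nil
  obtain ⟨s, σ, rfl, hσ⟩ := ih b.length (by rw [← hn, List.length_append]; omega) hb rfl
  by_cases h1 : J = upLeft
  · refine ⟨side :: s, false :: σ, ?_, ?_⟩
    · simp [build, mark_eq_true.2, h1]
    · rw [List.countP_cons_of_pos (mark_eq_true.2 rfl), List.length_cons, hσ]
  by_cases h2 : J = upRight
  · refine ⟨side :: s, true :: σ, ?_, ?_⟩
    · simp [build, mark_eq_true.2, h2]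
    · rw [List.countP_cons_of_pos (mark_eq_true.2 rfl), List.length_cons, hσ]
  · have hm : ¬ (mark ⟨J, hJ, h1⟩ = true) := by simp [mark, h2]
    refine ⟨⟨J, hJ, h1⟩ :: s, σ, ?_, ?_⟩
    · rcases σ with _ | ⟨b, σ⟩
      · simp [build]
      · simp [build, hm]
    · rw [List.countP_cons_of_neg hm, hσ]

lemma build_length (s : List Letter) : ∀ σ : List Bool, (build s σ).length =
    (s.map fun a => a.1.length).sum := by
  induction s with
  | nil => intro σ; simp [build]
  | cons a s ih =>
    rintro (_ | ⟨b, σ⟩)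
    · simp [build, ih]
    · by_cases hm : a.mark
      · have : a.1.length = 2 := by rw [mark_eq_true.1 hm]; rfl
        cases b <;> simp [build, ih, hm, this, upRight, upLeft] <;> ring
      · simp [build, ih, hm]

lemma build_yd (s : List Letter) : ∀ σ : List Bool, yd (build s σ) = (s.map ht).sum := by
  induction s with
  | nil => intro σ; simp [build]
  | cons a s ih =>
    rintro (_ | ⟨b, σ⟩)
    · simp [build, ih, ht_eq]
    · by_cases hm : a.mark
      · have : yd a.1 = 1 := by rw [mark_eq_true.1 hm]; rfl
        cases b <;> simp [build, ih, hm, this, upRight, upLeft, ht_eq, dy]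
      · simp [build, ih, hm, ht_eq]

lemma build_xd (s : List Letter) : ∃ X : ℤ, ∀ σ : List Bool, σ.length = s.countP mark →
    xd (build s σ) = X + 2 * σ.count true := by
  induction s with
  | nil => exact ⟨0, fun σ h => by simp at h; simp [build, h]⟩
  | cons a s ih =>
    obtain ⟨X, hX⟩ := ih
    by_cases hm : a.mark
    · refine ⟨X - 1, fun σ h => ?_⟩
      rw [List.countP_cons_of_pos hm] at h
      rcases σ with _ | ⟨b, σ⟩
      · simp at h
      · have := hX σ (by simpa using h)
        cases b
        · simp [build, hm, this, upLeft, dx]; ring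
        · simp [build, hm, this, upRight, dx]; ring
    · refine ⟨X + xd a.1, fun σ h => ?_⟩
      rw [List.countP_cons_of_neg hm] at h
      have := hX σ h
      rcases σ with _ | ⟨b, σ⟩
      · simp [build, this]; ring
      · simp [build, hm, this]; ring

lemma prod_weight (z : ℝ≥0∞) (s : List Letter) : (s.map (weight z)).prod =
    z ^ (s.map fun a => a.1.length).sum * 2 ^ s.countP mark := by
  induction s with
  | nil => simp
  | cons a s ih =>
    simp only [List.map_cons, List.prod_cons, ih, weight, List.sum_cons, pow_add,
      List.countP_cons]
    split_ifs
    · ring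
    · ring

lemma wt_le_skeleton (z : ℝ≥0∞) (h : ℕ) (y : ℤ) {k₀ r : ℕ} (hr : r ^ 2 ≤ k₀) (hr0 : r ≠ 0) :
    wt z {w | Bridge w ∧ yd w = h ∧ xd w = y} ≤
      (r : ℝ≥0∞)⁻¹ * lw (weight z) {s | (s.map ht).sum = h} +
        lw (weight z) {s | (s.map ht).sum = h ∧ s.countP mark < k₀} := by
  set S : Set Word := {w | Bridge w ∧ yd w = h ∧ xd w = y} with hS
  let H : Set (List Letter) := {s | (s.map ht).sum = h}
  let B : List Letter → Set (List Bool) := fun s => {σ | σ.length = s.countP mark ∧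
    xd (build s σ) = y}
  have hex : ∀ w : S, ∃ s, ∃ σ, s ∈ H ∧ σ ∈ B s ∧ w.1 = build s σ := by
    rintro ⟨w, hw, hy, hx⟩
    obtain ⟨s, σ, rfl, hσ⟩ := exists_build hw
    refine ⟨s, σ, ?_, ⟨hσ, hx⟩, rfl⟩
    rw [build_yd] at hy
    exact_mod_cast hy
  choose f g hf hg hfg using hex
  have hinj : Function.Injective (fun w : S => (⟨⟨f w, hf w⟩, ⟨g w, hg w⟩⟩ : Σ s : H, B s)) := by
    intro w w' e
    simp only [Sigma.mk.injEq, Subtype.mk.injEq] at e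
    obtain ⟨h1, h2⟩ := e
    have h3 : g w = g w' := (Subtype.heq_iff_coe_eq (fun x => by rw [h1])).1 h2
    ext1
    rw [hfg w, hfg w', h1, h3]
  have hB : ∀ s : List Letter, ∃ j, lw (fun _ : Bool => 1) (B s) ≤ (s.countP mark).choose j := by
    intro s
    obtain ⟨X, hX⟩ := build_xd s
    refine ⟨((y - X) / 2).toNat, le_trans (lw_mono _ fun σ hσ => ?_)
      (lw_bool_count_le (s.countP mark) _)⟩
    refine ⟨hσ.1, ?_⟩
    have := hX σ hσ.1
    rw [hσ.2] at this
    omega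
  have hmain : ∀ s : List Letter, z ^ (s.map fun a => a.1.length).sum *
      lw (fun _ : Bool => 1) (B s) ≤ (r : ℝ≥0∞)⁻¹ * (s.map (weight z)).prod +
        Set.indicator {s : List Letter | s.countP mark < k₀}
          (fun s => (s.map (weight z)).prod) s := by
    intro s
    obtain ⟨j, hj⟩ := hB s
    rw [prod_weight]
    by_cases hk : s.countP mark < k₀
    · refine le_add_left ?_
      rw [Set.indicator_of_mem (by exact hk), prod_weight]
      gcongr
      refine hj.trans ?_
      exact_mod_cast Nat.choose_le_two_pow _ _
    · refine le_add_right ?_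
      rw [mul_left_comm]
      gcongr
      refine hj.trans ?_
      rw [← ENNReal.div_eq_inv_mul, ENNReal.le_div_iff_mul_le (by simp [hr0]) (by simp), mul_comm]
      exact_mod_cast mul_choose_le (hr.trans (not_lt.1 hk))
  calc wt z S = ∑' w : S, (fun p : Σ s : H, B s => z ^ (build p.1 p.2).length)
        ⟨⟨f w, hf w⟩, ⟨g w, hg w⟩⟩ := tsum_congr fun w => by
          show z ^ w.1.length = z ^ (build (f w) (g w)).length
          rw [← hfg w]
    _ ≤ ∑' p : Σ s : H, B s, z ^ (build p.1 p.2).length :=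
        ENNReal.tsum_comp_le_tsum_of_injective hinj _
    _ = ∑' s : H, ∑' σ : B s, z ^ (build s σ).length := ENNReal.tsum_sigma' _
    _ = ∑' s : H, z ^ (s.1.map fun a => a.1.length).sum * lw (fun _ : Bool => 1) (B s) := by
        refine tsum_congr fun s => ?_
        simp only [build_length, lw]
        rw [← ENNReal.tsum_mul_left]
        simp
    _ ≤ ∑' s : H, ((r : ℝ≥0∞)⁻¹ * (s.1.map (weight z)).prod +
        Set.indicator {s : List Letter | s.countP mark < k₀}
          (fun s => (s.map (weight z)).prod) s.1) := ENNReal.tsum_le_tsum fun s => hmain s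
    _ = _ := by
        rw [ENNReal.tsum_add, ENNReal.tsum_mul_left]
        congr 1
        rw [lw, tsum_subtype H (Set.indicator {s : List Letter | s.countP mark < k₀}
          fun s => (s.map (weight z)).prod), Set.indicator_indicator,
          ← tsum_subtype (H ∩ {s : List Letter | s.countP mark < k₀})]
        rfl

/-- Anticoncentration of the horizontal displacement of bridges of height `h`. -/
lemma wt_Br_xd_le {z : ℝ≥0∞} (hI : wt z IR ≤ 1) (hz : z ≠ ∞) {h : ℕ} (y : ℤ) {k₀ r m₀ L : ℕ}
    (hr : r ^ 2 ≤ k₀) (hr0 : r ≠ 0) (hL : m₀ * L < h) :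
    wt z {w | Bridge w ∧ yd w = h ∧ xd w = y} ≤
      (r : ℝ≥0∞)⁻¹ + (m₀ * (2 * wt z (IRge L)) + 2 ^ k₀ * (1 - z ^ 2) ^ m₀) := by
  have hp : ∑' a, weight z a ≤ 1 := by rwa [tsum_weight]
  refine (wt_le_skeleton z h y hr hr0).trans (add_le_add ?_ ?_)
  · exact mul_le_of_le_one_right' (lw_height_le_one _ hp ht one_le_ht h)
  refine (lw_mono _ (T := {s | s.length ≤ m₀ ∧ 0 + (s.map ht).sum = h ∧
      ∃ a ∈ s, a ∈ {a : Letter | L ≤ a.1.length}} ∪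
      {s | m₀ ≤ s.length ∧ 0 + (s.map ht).sum = h ∧ s.countP mark < k₀}) ?_).trans
    ((lw_union_le _ _ _).trans (add_le_add ?_ ?_))
  · rintro s ⟨h1, h2⟩
    by_cases hl : m₀ ≤ s.length
    · exact Or.inr ⟨hl, by simpa using h1, h2⟩
    · refine Or.inl ⟨by omega, by simpa using h1, ?_⟩
      by_contra! hcon
      have : (s.map ht).sum ≤ s.length * L := by
        have := List.sum_le_card_nsmul (s.map ht) L (by
          intro x hx
          obtain ⟨a, ha, rfl⟩ := List.mem_map.1 hx
          have := hcon a ha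
          simp only [Set.mem_ofPred_eq, not_le] at this
          exact a.ht_le_length.trans this.le)
        simpa using this
      have : s.length * L ≤ m₀ * L := Nat.mul_le_mul_right _ (by omega)
      omega
  · refine (lw_bad_le _ hp ht one_le_ht _ m₀ 0 h).trans ?_
    gcongr
    exact tsum_weight_bad z L
  · refine (lw_few_le _ hp ht one_le_ht mark m₀ k₀ 0 h).trans ?_
    gcongr
    refine ENNReal.le_sub_of_add_le_right (by simp [hz]) ?_
    rw [tsum_weight_half]
    exact hI

lemma exists_irr_suffix {w : Word} (hw : Bridge w) (hne : w ≠ []) :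
    ∃ b J, w = b ++ J ∧ Bridge b ∧ Irr J := by
  obtain ⟨W, J, W', e, hW, hJ, hW', h1, h2⟩ :=
    exists_irr_piece _ (b := []) rfl hw (by simp) hne
  refine ⟨W, J, ?_, hW, hJ⟩
  have h3 : W' = [] := by
    have := congrArg List.length e
    simp only [List.length_append] at this
    exact List.length_eq_zero_iff.1 (by omega)
  simpa [h3] using e

lemma long_prefix {r k : ℕ} : ∀ {w c d : Word}, Bridge w → w = c ++ d → yd c < k →
    k * r < c.length → ∃ W J W', w = W ++ (J ++ W') ∧ Bridge W ∧ J ∈ IRge r ∧ Bridge W' ∧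
      yd W ≤ yd c := by
  induction k with
  | zero =>
    rintro w c d hw rfl hc _
    have := hw.pos'
    push_cast at hc
    omega
  | succ k ih =>
    rintro w c d hw rfl hc hl
    have hcne : c ≠ [] := by rintro rfl; simp at hl
    obtain ⟨J, b, e, hJ, hb⟩ := exists_irr_prefix hw (by simp [hcne])
    by_cases hr : r ≤ J.length
    · exact ⟨[], J, b, by simpa using e, Bridge.nil, ⟨hJ, hr⟩, hb, by simpa using hw.pos'⟩
    · have hJy := hJ.yd_pos
      rw [Nat.succ_mul] at hl
      rcases List.append_eq_append_iff.1 e with ⟨t, rfl, ht⟩ | ⟨t, rfl, ht⟩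
      · simp only [List.length_append] at hr
        omega
      · simp only [List.length_append, yd_append] at hl hc ⊢
        push_cast at hc
        obtain ⟨W, K, W', h1, h2, h3, h4, h5⟩ := ih hb ht (by omega) (by omega)
        refine ⟨J ++ W, K, W', ?_, hJ.bridge.append h2, h3, h4, by simp; omega⟩
        rw [List.append_assoc, ← ht, h1, List.append_assoc]

lemma long_suffix {r k : ℕ} : ∀ {w c d : Word}, Bridge w → w = c ++ d → yd d < k →
    k * r < d.length → ∃ W J W', w = W ++ (J ++ W') ∧ Bridge W ∧ J ∈ IRge r ∧ Bridge W' ∧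
      yd W' ≤ yd d := by
  induction k with
  | zero =>
    rintro w c d hw rfl hc _
    have := hw.top c d rfl
    push_cast at hc
    omega
  | succ k ih =>
    rintro w c d hw rfl hc hl
    have hcne : d ≠ [] := by rintro rfl; simp at hl
    obtain ⟨b, J, e, hb, hJ⟩ := exists_irr_suffix hw (by simp [hcne])
    by_cases hr : r ≤ J.length
    · exact ⟨b, J, [], by simpa using e, hb, ⟨hJ, hr⟩, Bridge.nil, by simpa using hw.top c d rfl⟩
    · have hJy := hJ.yd_pos
      rw [Nat.succ_mul] at hl
      rcases List.append_eq_append_iff.1 e with ⟨t, rfl, rfl⟩ | ⟨t, rfl, rfl⟩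
      · simp only [List.length_append, yd_append] at hl hc ⊢
        push_cast at hc
        obtain ⟨W, K, W', h1, h2, h3, h4, h5⟩ := ih hb rfl (by omega) (by omega)
        refine ⟨W, K, W' ++ J, ?_, h2, h3, h4.append hJ.bridge, by simp; omega⟩
        rw [← List.append_assoc, h1]
        simp
      · simp only [List.length_append] at hr
        omega

lemma wt_low_bridges_le {z : ℝ≥0∞} (hI : wt z IR ≤ 1) (k : ℕ) :
    wt z {w | Bridge w ∧ yd w < k} ≤ k := by
  have hsub : {w | Bridge w ∧ yd w < k} ⊆ ⋃ i ∈ Finset.range k, Br i := by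
    rintro w ⟨hw, hk⟩
    have := hw.yd_nonneg
    simp only [Set.mem_iUnion, Finset.mem_range]
    exact ⟨(yd w).toNat, by omega, hw, by omega⟩
  refine (wt_mono z hsub).trans ((wt_biUnion_le z _ _).trans ?_)
  calc _ ≤ ∑ i ∈ Finset.range k, (1 : ℝ≥0∞) := Finset.sum_le_sum fun i _ => wt_Br_le_one hI i
    _ = k := by simp

/-- Bridges with a factor of low height but large length at their top. -/
def LongTop (g r : ℕ) : Set Word :=
  {w | ∃ c d, w = c ++ d ∧ yd d < g ∧ g * r < d.length}

/-- Bridges with a factor of low height but large length at their bottom. -/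
def LongBot (g r : ℕ) : Set Word :=
  {w | ∃ c d, w = c ++ d ∧ yd c < g ∧ g * r < c.length}

lemma wt_longTop_le {z : ℝ≥0∞} (hI : wt z IR ≤ 1) (g r : ℕ) (h : ℤ) :
    wt z (Br h ∩ LongTop g r) ≤ g * wt z (IRge r) := by
  refine (wt_mono z (T := {w | ∃ a b, w = a ++ b ∧ Bridge a ∧
    b ∈ {v | ∃ J W, v = J ++ W ∧ J ∈ IRge r ∧ Bridge W ∧ yd W < g} ∧ yd w = h}) ?_).trans
    ((wt_pinned_right hI _ h).trans ?_)
  · rintro w ⟨⟨hw, hh⟩, c, d, e, hd, hl⟩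
    obtain ⟨W, J, W', h1, h2, h3, h4, h5⟩ := long_suffix hw e hd hl
    exact ⟨W, J ++ W', h1, h2, ⟨J, W', rfl, h3, h4, by omega⟩, hh⟩
  · rw [mul_comm]
    refine (wt_le_mul' z (A := IRge r) (B := {w | Bridge w ∧ yd w < g}) (· ++ ·) (by simp)
      ?_).trans ?_
    · rintro w ⟨J, W, rfl, h1, h2, h3⟩
      exact ⟨J, h1, W, ⟨h2, h3⟩, rfl⟩
    · gcongr
      exact wt_low_bridges_le hI g

lemma wt_longBot_le {z : ℝ≥0∞} (hI : wt z IR ≤ 1) (g r : ℕ) (h : ℤ) :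
    wt z (Br h ∩ LongBot g r) ≤ g * wt z (IRge r) := by
  refine (wt_mono z (T := {w | ∃ b a, w = b ++ a ∧ Bridge a ∧
    b ∈ {v | ∃ W J, v = W ++ J ∧ Bridge W ∧ yd W < g ∧ J ∈ IRge r} ∧ yd w = h}) ?_).trans
    ((wt_pinned_left hI _ h).trans ?_)
  · rintro w ⟨⟨hw, hh⟩, c, d, e, hd, hl⟩
    obtain ⟨W, J, W', h1, h2, h3, h4, h5⟩ := long_prefix hw e hd hl
    exact ⟨W ++ J, W', by simpa using h1, h4, ⟨W, J, rfl, h2, by omega, h3⟩, hh⟩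
  · refine (wt_le_mul' z (A := {w | Bridge w ∧ yd w < g}) (B := IRge r) (· ++ ·) (by simp)
      ?_).trans ?_
    · rintro w ⟨W, J, rfl, h2, h3, h1⟩
      exact ⟨W, ⟨h2, h3⟩, J, h1, rfl⟩
    · gcongr
      exact wt_low_bridges_le hI g

/-- Irreducible bridges of length at most `r`. -/
def IRle (r : ℕ) : Set Word := {w | Irr w ∧ w.length ≤ r}

/-- Concatenations of `k` irreducible bridges of length at most `r`. -/
def Ext (r : ℕ) : ℕ → Set Word
  | 0 => {[]}
  | k + 1 => {w | ∃ J b, w = J ++ b ∧ J ∈ IRle r ∧ b ∈ Ext r k}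

lemma Ext_spec {r k : ℕ} : ∀ {w : Word}, w ∈ Ext r k →
    Bridge w ∧ (k : ℤ) ≤ yd w ∧ w.length ≤ k * r := by
  induction k with
  | zero =>
    rintro w rfl
    exact ⟨Bridge.nil, by simp, by simp⟩
  | succ k ih =>
    rintro w ⟨J, b, rfl, hJ, hb⟩
    obtain ⟨h1, h2, h3⟩ := ih hb
    have h4 := hJ.1.yd_pos
    have h5 := hJ.2
    refine ⟨hJ.1.bridge.append h1, ?_, ?_⟩
    · push_cast
      simp
      omega
    · rw [Nat.succ_mul, List.length_append]
      omega

lemma pow_le_wt_Ext (z : ℝ≥0∞) (r k : ℕ) : wt z (IRle r) ^ k ≤ wt z (Ext r k) := by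
  induction k with
  | zero => simp [Ext]
  | succ k ih =>
    rw [pow_succ']
    refine (mul_le_mul_right ih _).trans (mul_le_wt z ?_ ?_)
    · exact fun J hJ b hb => ⟨J, b, rfl, hJ, hb⟩
    · exact fun J hJ b hb J' hJ' b' hb' e =>
        irr_prefix_unique hJ.1 hJ'.1 (Ext_spec hb).1 (Ext_spec hb').1 e

/-- Three-strand words that can be extended by any element of `Ext r g`. -/
def Good (g r : ℕ) (h₁ h₂ h₃ : ℤ) : Set Word := {u | ∃ V₁ V₂ V₃, u = V₁ ++ (vflip V₂ ++ V₃) ∧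
  Avoid u ∧ V₁ ∈ Br h₁ ∧ V₂ ∈ Br h₂ ∧ V₃ ∈ Br h₃ ∧ V₁ ∉ LongTop g r ∧ V₂ ∉ LongBot g r ∧
  2 * (g * r : ℤ) < |xd V₂ + xd V₃|}

lemma Good.avoid_append {g r : ℕ} {h₁ h₂ h₃ : ℤ} (h12 : h₂ < h₁) (h13 : h₁ - h₃ ≤ g) {u v : Word}
    (hu : u ∈ Good g r h₁ h₂ h₃) (hv : v ∈ Ext r g) : Avoid (u ++ v) := by
  obtain ⟨V₁, V₂, V₃, rfl, hA, ⟨hV₁, hy₁⟩, ⟨hV₂, hy₂⟩, ⟨hV₃, hy₃⟩, hn₁, hn₂, hx⟩ := hu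
  obtain ⟨hvB, -, hvl⟩ := Ext_spec hv
  refine SAWBound.avoid_append hA hvB.avoid ?_
  rintro u₁ u₂ v₁ v₂ e e' hu₂ hv₁ hxd hyd
  have hv₁y := hvB.pos _ _ e' hv₁
  have hv₁x : |xd v₁| ≤ g * r := by
    have h1 := abs_xd_le v₁
    have h2 : v₁.length ≤ v.length := by simp [e']
    have h3 : (v₁.length : ℤ) ≤ (g * r : ℕ) := by exact_mod_cast h2.trans hvl
    push_cast at h3
    exact h1.trans h3
  have key : ∀ c : Word, ((c.length : ℕ) : ℤ) ≤ (g * r : ℕ) → |xd c| ≤ g * r := fun c hc => by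
    push_cast at hc
    exact (abs_xd_le c).trans hc
  have hlow : ∀ c d, V₁ = c ++ d → yd d < g → |xd d| ≤ g * r := fun c d ecd hd => by
    refine key d ?_
    by_contra! hcon
    exact hn₁ ⟨c, d, ecd, hd, by exact_mod_cast hcon⟩
  have hlow' : ∀ c d, V₂ = c ++ d → yd c < g → |xd c| ≤ g * r := fun c d ecd hc => by
    refine key c ?_
    by_contra! hcon
    exact hn₂ ⟨c, d, ecd, hc, by exact_mod_cast hcon⟩
  rcases List.append_eq_append_iff.1 e with ⟨t, rfl, ht⟩ | ⟨t, rfl, rfl⟩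
  · rcases List.append_eq_append_iff.1 ht with ⟨s, rfl, hs⟩ | ⟨s, hs, rfl⟩
    · have := hV₃.top _ _ hs
      omega
    · have hV₂e : V₂ = vflip t ++ vflip s := by rw [← vflip_append, ← hs, vflip_vflip]
      subst hV₂e
      simp only [yd_append, yd_vflip, xd_append, xd_vflip] at hy₂ hxd hyd hx
      have := hlow' _ _ rfl (by simp only [yd_vflip]; omega)
      simp only [xd_vflip] at this
      rw [abs_le] at this hv₁x
      have : |xd t + xd s + xd V₃| ≤ 2 * (g * r : ℤ) := by
        rw [abs_le]
        constructor <;> linarith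
      linarith
  · simp only [yd_append, yd_vflip, xd_append, xd_vflip] at hy₁ hxd hyd
    have := hlow _ _ rfl (by omega)
    rw [abs_le] at this hv₁x
    have : |xd V₂ + xd V₃| ≤ 2 * (g * r : ℤ) := by
      rw [abs_le]
      constructor <;> linarith
    linarith

lemma Good.bridge_append {g r : ℕ} {h₁ h₂ h₃ : ℤ} (h12 : h₂ < h₁)
    (h13 : h₁ - h₃ ≤ g) {u v : Word}
    (hu : u ∈ Good g r h₁ h₂ h₃) (hv : v ∈ Ext r g) : Bridge (u ++ v) := by
  have hA := Good.avoid_append h12 h13 hu hv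
  obtain ⟨V₁, V₂, V₃, rfl, -, ⟨hV₁, hy₁⟩, ⟨hV₂, hy₂⟩, ⟨hV₃, hy₃⟩, -, -, -⟩ := hu
  obtain ⟨hvB, hvy, -⟩ := Ext_spec hv
  have hB := hV₃.append hvB
  rw [List.append_assoc, List.append_assoc] at hA ⊢
  set V := V₃ ++ v with hV
  have hVy : yd V = h₃ + yd v := by simp [hV, hy₃]
  refine ⟨hA, ?_, ?_⟩
  · intro a b e ha
    rcases List.append_eq_append_iff.1 e with ⟨t, rfl, ht⟩ | ⟨t, rfl, rfl⟩
    · rcases List.append_eq_append_iff.1 ht with ⟨s, rfl, hs⟩ | ⟨s, hs, rfl⟩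
      · have := (hs ▸ hB).pos'
        simp only [yd_append, yd_vflip]
        omega
      · have hV₂e : V₂ = vflip t ++ vflip s := by rw [← vflip_append, ← hs, vflip_vflip]
        have h1 := hV₂.top _ _ hV₂e
        rw [hV₂e] at hy₂
        simp only [yd_append, yd_vflip] at hy₂ h1 ⊢
        omega
    · exact hV₁.pos _ _ rfl ha
  · intro a b e
    rcases List.append_eq_append_iff.1 e with ⟨t, rfl, ht⟩ | ⟨t, rfl, rfl⟩
    · rcases List.append_eq_append_iff.1 ht with ⟨s, rfl, hs⟩ | ⟨s, hs, rfl⟩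
      · exact hB.top _ _ hs
      · have hV₂e : V₂ = vflip t ++ vflip s := by rw [← vflip_append, ← hs, vflip_vflip]
        have h1 := (hV₂e ▸ hV₂).pos'
        rw [hV₂e] at hy₂
        simp only [yd_append, yd_vflip] at hy₂ h1 ⊢
        omega
    · have := hV₁.top _ _ rfl
      simp only [yd_append, yd_vflip]
      omega

lemma Good.yd_eq {g r : ℕ} {h₁ h₂ h₃ : ℤ} {u : Word} (hu : u ∈ Good g r h₁ h₂ h₃) :
    yd u = h₁ - h₂ + h₃ := by
  obtain ⟨V₁, V₂, V₃, rfl, -, ⟨hV₁, hy₁⟩, ⟨hV₂, hy₂⟩, ⟨hV₃, hy₃⟩, -, -, -⟩ := hu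
  simp only [yd_append, yd_vflip]
  omega

lemma Good.exists_piece {g r s₀ : ℕ} {h₁ h₂ h₃ : ℤ} (h12 : h₂ < h₁) (h23 : h₃ < h₂) (h0 : 0 < h₃)
    (h13 : h₁ - h₃ ≤ g) (hs : s₀ ≤ h₃) {u v : Word}
    (hu : u ∈ Good g r h₁ h₂ h₃) (hv : v ∈ Ext r g) :
    ∃ W J W', u ++ v = W ++ (J ++ W') ∧ Bridge W ∧ yd W < g ∧ J ∈ IRge s₀ ∧ Bridge W' ∧
      yd W' < (g * r + 1 : ℕ) := by
  have hB := Good.bridge_append h12 h13 hu hv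
  obtain ⟨V₁, V₂, V₃, rfl, -, ⟨hV₁, hy₁⟩, ⟨hV₂, hy₂⟩, ⟨hV₃, hy₃⟩, -, -, -⟩ := hu
  obtain ⟨hvB, hvy, hvl⟩ := Ext_spec hv
  have hne : V₁ ≠ [] := by
    rintro rfl
    simp at hy₁
    omega
  obtain ⟨W, J, W', e, hW, hJ, hW', hl, hl'⟩ :=
    exists_irr_piece _ (a := V₁) (b := vflip V₂ ++ (V₃ ++ v)) rfl hB (by simp) hne
  have e' : V₁ ++ (vflip V₂ ++ (V₃ ++ v)) = W ++ (J ++ W') := by simpa using e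
  have hWy : yd W < h₁ - h₂ := by
    rcases List.append_eq_append_iff.1 e' with ⟨t, rfl, ht⟩ | ⟨t, rfl, ht⟩
    · simp only [List.length_append] at hl
      omega
    · have h3 := (hJ.bridge.append hW').pos (t ++ vflip V₂) (V₃ ++ v) (by rw [ht]; simp) (by
        simp only [List.length_append] at hl
        intro h
        simp at h
        rw [h.1] at hl
        simp at hl)
      simp only [yd_append, yd_vflip] at hy₁ h3
      omega
  have hJy : h₁ ≤ yd W + yd J := by
    have e'' : V₁ ++ (vflip V₂ ++ (V₃ ++ v)) = (W ++ J) ++ W' := by simpa using e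
    rcases List.append_eq_append_iff.1 e'' with ⟨t, ht, _⟩ | ⟨t, rfl, ht⟩
    · have := (hW.append hJ.bridge).top _ _ ht
      have h3 := congrArg yd ht
      simp only [yd_append] at h3
      omega
    · have h3 : t = [] := by
        simp only [List.length_append] at hl'
        exact List.length_eq_zero_iff.1 (by omega)
      subst h3
      simp only [yd_append, yd_nil] at hy₁
      omega
  have htot := congrArg yd e'
  simp only [yd_append, yd_vflip] at htot
  have hvl' : yd v ≤ (g * r : ℕ) := (yd_le_length v).trans (by exact_mod_cast hvl)
  refine ⟨W, J, W', e, hW, by omega, ⟨hJ, ?_⟩, hW', by omega⟩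
  have := yd_le_length J
  omega

lemma wt_Good_mul_le {z : ℝ≥0∞} (hI : wt z IR ≤ 1) {g r s₀ : ℕ} {h₁ h₂ h₃ : ℤ} (h12 : h₂ < h₁)
    (h23 : h₃ < h₂) (h0 : 0 < h₃) (h13 : h₁ - h₃ ≤ g) (hs : s₀ ≤ h₃) :
    wt z (Good g r h₁ h₂ h₃) * wt z (IRle r) ^ g ≤
      g * (wt z (IRge s₀) * (g * r + 1 : ℕ)) := by
  refine (mul_le_mul_right (pow_le_wt_Ext z r g) _).trans ((mul_le_wt z
    (S := {w | ∃ W J W', w = W ++ (J ++ W') ∧ Bridge W ∧ yd W < g ∧ J ∈ IRge s₀ ∧ Bridge W' ∧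
      yd W' < (g * r + 1 : ℕ)}) ?_ ?_).trans ?_)
  · exact fun u hu v hv => Good.exists_piece h12 h23 h0 h13 hs hu hv
  · intro u hu v hv u' hu' v' hv' e
    have h1 := Good.yd_eq hu
    have h2 := Good.yd_eq hu'
    rcases List.append_eq_append_iff.1 e with ⟨t, rfl, ht⟩ | ⟨t, rfl, ht⟩
    · by_cases h : t = []
      · simp [h]
      · have := (Ext_spec hv).1.pos _ _ ht h
        simp only [yd_append] at h2
        omega
    · by_cases h : t = []
      · simp [h]
      · have := (Ext_spec hv').1.pos _ _ ht h
        simp only [yd_append] at h1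
        omega
  · refine (wt_le_mul' z (A := {w | Bridge w ∧ yd w < g})
      (B := {w | ∃ J W', w = J ++ W' ∧ J ∈ IRge s₀ ∧ Bridge W' ∧ yd W' < (g * r + 1 : ℕ)})
      (· ++ ·) (by simp) ?_).trans (mul_le_mul' (wt_low_bridges_le hI g) ?_)
    · rintro w ⟨W, J, W', e, h1, h2, h3, h4, h5⟩
      exact ⟨W, ⟨h1, h2⟩, J ++ W', ⟨J, W', rfl, h3, h4, h5⟩, e⟩
    · refine (wt_le_mul' z (A := IRge s₀) (B := {w | Bridge w ∧ yd w < (g * r + 1 : ℕ)})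
        (· ++ ·) (by simp) ?_).trans (mul_le_mul_right (wt_low_bridges_le hI _) _)
      rintro w ⟨J, W', e, h3, h4, h5⟩
      exact ⟨J, h3, W', ⟨h4, h5⟩, e⟩

lemma wt_three_le (z : ℝ≥0∞) (A B C : Set Word) :
    wt z {u | ∃ V₁ V₂ V₃, u = V₁ ++ (vflip V₂ ++ V₃) ∧ V₁ ∈ A ∧ V₂ ∈ B ∧ V₃ ∈ C} ≤
      wt z A * (wt z B * wt z C) := by
  refine (wt_le_mul' z (A := A) (B := {u | ∃ V₂ V₃, u = vflip V₂ ++ V₃ ∧ V₂ ∈ B ∧ V₃ ∈ C})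
    (· ++ ·) (by simp) ?_).trans (mul_le_mul_right ?_ _)
  · rintro w ⟨V₁, V₂, V₃, e, h1, h2, h3⟩
    exact ⟨V₁, h1, _, ⟨V₂, V₃, rfl, h2, h3⟩, e⟩
  · refine wt_le_mul' z (fun a b => vflip a ++ b) (by simp) ?_
    rintro w ⟨V₂, V₃, e, h2, h3⟩
    exact ⟨V₂, h2, V₃, h3, e⟩

/-- Three-strand words whose last two strands have prescribed small displacement. -/
lemma wt_close_le {z β : ℝ≥0∞} (hI : wt z IR ≤ 1) (h₁ h₂ h₃ : ℤ) (R : ℕ)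
    (hβ : ∀ y, wt z {w | Bridge w ∧ yd w = h₃ ∧ xd w = y} ≤ β) :
    wt z {u | ∃ V₁ V₂ V₃, u = V₁ ++ (vflip V₂ ++ V₃) ∧ V₁ ∈ Br h₁ ∧ V₂ ∈ Br h₂ ∧ V₃ ∈ Br h₃ ∧
      |xd V₂ + xd V₃| ≤ R} ≤ (2 * R + 1 : ℕ) * β := by
  refine (wt_le_mul' z (A := Br h₁) (B := {u | ∃ V₂ V₃, u = vflip V₂ ++ V₃ ∧ V₂ ∈ Br h₂ ∧
    V₃ ∈ Br h₃ ∧ |xd V₂ + xd V₃| ≤ R}) (· ++ ·) (by simp) ?_).trans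
    ((mul_le_of_le_one_left' (wt_Br_le_one hI _)).trans ?_)
  · rintro w ⟨V₁, V₂, V₃, e, h1, h2, h3, h4⟩
    exact ⟨V₁, h1, _, ⟨V₂, V₃, rfl, h2, h3, h4⟩, e⟩
  · refine (wt_le_mul z ((2 * R + 1 : ℕ) * β) (A := Br h₂)
      (fun V₂ => {V₃ | V₃ ∈ Br h₃ ∧ |xd V₂ + xd V₃| ≤ R})
      (fun a b => vflip a ++ b) (by simp) ?_ ?_).trans
      (mul_le_of_le_one_left' (wt_Br_le_one hI _))
    · rintro w ⟨V₂, V₃, e, h2, h3, h4⟩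
      exact ⟨V₂, h2, V₃, ⟨h3, h4⟩, e⟩
    · intro V₂ _
      refine (wt_mono z (T := ⋃ i ∈ Finset.range (2 * R + 1),
        {w | Bridge w ∧ yd w = h₃ ∧ xd w = i - R - xd V₂}) ?_).trans
        ((wt_biUnion_le z _ _).trans ((Finset.sum_le_sum fun i _ => hβ _).trans (by simp)))
      rintro w ⟨⟨h1, h2⟩, h3⟩
      rw [abs_le] at h3
      simp only [Set.mem_iUnion, Finset.mem_range]
      exact ⟨(xd V₂ + xd w + R).toNat, by omega, h1, h2, by omega⟩

lemma wt_T3_le {z β : ℝ≥0∞} (hI : wt z IR ≤ 1) (g r : ℕ) (h₁ h₂ h₃ : ℤ)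
    (hβ : ∀ y, wt z {w | Bridge w ∧ yd w = h₃ ∧ xd w = y} ≤ β) :
    wt z (T3 h₁ h₂ h₃) ≤ 2 * (g * wt z (IRge r)) + ((4 * (g * r) + 1 : ℕ) * β +
      wt z (Good g r h₁ h₂ h₃)) := by
  have hone := wt_Br_le_one hI
  refine (wt_mono z (T := ({u | ∃ V₁ V₂ V₃, u = V₁ ++ (vflip V₂ ++ V₃) ∧
      V₁ ∈ Br h₁ ∩ LongTop g r ∧ V₂ ∈ Br h₂ ∧ V₃ ∈ Br h₃} ∪
    {u | ∃ V₁ V₂ V₃, u = V₁ ++ (vflip V₂ ++ V₃) ∧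
      V₁ ∈ Br h₁ ∧ V₂ ∈ Br h₂ ∩ LongBot g r ∧ V₃ ∈ Br h₃}) ∪
    ({u | ∃ V₁ V₂ V₃, u = V₁ ++ (vflip V₂ ++ V₃) ∧ V₁ ∈ Br h₁ ∧ V₂ ∈ Br h₂ ∧ V₃ ∈ Br h₃ ∧
      |xd V₂ + xd V₃| ≤ (2 * (g * r) : ℕ)} ∪ Good g r h₁ h₂ h₃)) ?_).trans
    ((wt_union_le z _ _).trans (add_le_add ((wt_union_le z _ _).trans ?_)
      ((wt_union_le z _ _).trans (add_le_add ?_ le_rfl))))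
  · rintro u ⟨V₁, V₂, V₃, e, hA, h1, h2, h3⟩
    by_cases hb₁ : V₁ ∈ LongTop g r
    · exact Or.inl (Or.inl ⟨V₁, V₂, V₃, e, ⟨h1, hb₁⟩, h2, h3⟩)
    by_cases hb₂ : V₂ ∈ LongBot g r
    · exact Or.inl (Or.inr ⟨V₁, V₂, V₃, e, h1, ⟨h2, hb₂⟩, h3⟩)
    by_cases hx : |xd V₂ + xd V₃| ≤ (2 * (g * r) : ℕ)
    · exact Or.inr (Or.inl ⟨V₁, V₂, V₃, e, h1, h2, h3, hx⟩)
    · exact Or.inr (Or.inr ⟨V₁, V₂, V₃, e, hA, h1, h2, h3, hb₁, hb₂, by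
        push_cast at hx
        exact not_le.1 hx⟩)
  · rw [two_mul]
    refine add_le_add ((wt_three_le z _ _ _).trans ?_) ((wt_three_le z _ _ _).trans ?_)
    · exact (mul_le_of_le_one_right' (mul_le_one' (hone _) (hone _))).trans
        (wt_longTop_le hI g r h₁)
    · exact (mul_le_of_le_one_left' (hone _)).trans ((mul_le_of_le_one_right' (hone _)).trans
        (wt_longBot_le hI g r h₂))
  · refine (wt_close_le hI h₁ h₂ h₃ _ hβ).trans (le_of_eq ?_)
    congr 2
    ring

lemma card_close_le (m g : ℕ) :
    ∑ i ∈ Finset.range m, (if m ≤ g + i then (1 : ℝ) else 0) ≤ g := by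
  rw [Finset.sum_boole]
  have h : (Finset.range m).filter (fun i => m ≤ g + i) ⊆ Finset.Ico (m - g) m := by
    intro i
    simp only [Finset.mem_filter, Finset.mem_range, Finset.mem_Ico]
    omega
  have := Finset.card_le_card h
  rw [Nat.card_Ico] at this
  exact_mod_cast this.trans (by omega)

/-- The renewal-type inequality satisfied by half-space walks forces slow growth. -/
lemma growth_of_recursion {a : ℕ → ℝ} {c : ℕ → ℕ → ℕ → ℝ} {g s₀ M : ℕ} {η lam : ℝ}
    (hmono : Monotone a) (ha : ∀ m, 0 ≤ a m) (ha2 : ∀ m, a m ≤ 2 ^ m)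
    (hrec : ∀ m, a (m + 1) ≤ a m + (1 + m + ∑ i ∈ Finset.range m, ∑ j ∈ Finset.range i,
      c m i j * a j))
    (hc1 : ∀ m i j, c m i j ≤ 1)
    (hcη : ∀ m i j, j < i → i < m → s₀ ≤ j + 1 → m ≤ g + j → c m i j ≤ η)
    (hη : 0 ≤ η) (hlam : 0 < lam) (hlam1 : lam ≤ 1) (hM : 1 ≤ M) (h1 : (g : ℝ) ^ 2 * η ≤ lam / 4)
    (h2 : (M : ℝ) ^ 2 * Real.exp (-(lam * g)) ≤ lam / 2) :
    ∀ m ≤ M, a m ≤ (2 ^ s₀ * 16 * M ^ 2 / lam) * Real.exp (lam * m) := by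
  set X : ℝ := 2 ^ s₀ * 16 * M ^ 2 / lam with hX
  have hM' : (1 : ℝ) ≤ M := by exact_mod_cast hM
  have h2s : (1 : ℝ) ≤ 2 ^ s₀ := one_le_pow₀ (by norm_num)
  have hM2 : (M : ℝ) ≤ M ^ 2 := by nlinarith
  have hXl : lam / 4 * X = 4 * 2 ^ s₀ * M ^ 2 := by rw [hX]; field_simp; ring
  have hX1 : 1 ≤ X := by
    rw [hX, le_div_iff₀ hlam]
    nlinarith [mul_le_mul h2s (hM'.trans hM2) zero_le_one (by positivity)]
  intro m
  induction m using Nat.strong_induction_on with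
  | _ m ih =>
  intro hm
  rcases m with _ | m
  · have := ha2 0
    simp at this ⊢
    linarith
  have hmM : (m : ℝ) ≤ M := by exact_mod_cast (by omega : m ≤ M)
  have hm0 : (0 : ℝ) ≤ m := by positivity
  have hterm : ∀ i ∈ Finset.range m, ∀ j ∈ Finset.range i, c m i j * a j ≤
      (2 ^ s₀ + a (m - g)) + (if m ≤ g + i then (1 : ℝ) else 0) *
        ((if m ≤ g + j then (1 : ℝ) else 0) * (η * a m)) := by
    intro i hi j hj
    rw [Finset.mem_range] at hi hj
    have h0 : c m i j * a j ≤ a j := mul_le_of_le_one_left (ha j) (hc1 m i j)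
    have hnn : 0 ≤ (if m ≤ g + i then (1 : ℝ) else 0) *
        ((if m ≤ g + j then (1 : ℝ) else 0) * (η * a m)) := by
      have := ha m
      split_ifs <;> positivity
    by_cases hs : j + 1 < s₀
    · have h3 : a j ≤ 2 ^ s₀ :=
        (ha2 j).trans (pow_le_pow_right₀ (by norm_num) (by omega))
      linarith [ha (m - g)]
    by_cases hg : m ≤ g + j
    · have h3 : c m i j * a j ≤ η * a m :=
        mul_le_mul (hcη m i j hj hi (by omega) hg) (hmono (by omega)) (ha j) hη
      rw [if_pos hg, if_pos (by omega), one_mul, one_mul]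
      linarith [ha (m - g)]
    · have h3 : a j ≤ a (m - g) := hmono (by omega)
      linarith
  have hsum : ∑ i ∈ Finset.range m, ∑ j ∈ Finset.range i, c m i j * a j ≤
      m ^ 2 * (2 ^ s₀ + a (m - g)) + g ^ 2 * (η * a m) := by
    calc _ ≤ ∑ i ∈ Finset.range m, ∑ j ∈ Finset.range i, ((2 ^ s₀ + a (m - g)) +
          (if m ≤ g + i then (1 : ℝ) else 0) * ((if m ≤ g + j then (1 : ℝ) else 0) * (η * a m))) :=
          Finset.sum_le_sum fun i hi => Finset.sum_le_sum fun j hj => hterm i hi j hj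
      _ ≤ ∑ i ∈ Finset.range m, ∑ j ∈ Finset.range m, ((2 ^ s₀ + a (m - g)) +
          (if m ≤ g + i then (1 : ℝ) else 0) *
            ((if m ≤ g + j then (1 : ℝ) else 0) * (η * a m))) := by
          refine Finset.sum_le_sum fun i hi => Finset.sum_le_sum_of_subset_of_nonneg ?_ ?_
          · exact Finset.range_subset_range.2 (Finset.mem_range.1 hi).le
          · intro j _ _
            have := ha (m - g)
            have := ha m
            split_ifs <;> positivity
      _ = m ^ 2 * (2 ^ s₀ + a (m - g)) + (∑ i ∈ Finset.range m, (if m ≤ g + i then (1 : ℝ) else 0))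
          * ((∑ i ∈ Finset.range m, (if m ≤ g + i then (1 : ℝ) else 0)) * (η * a m)) := by
          simp only [Finset.sum_add_distrib, ← Finset.mul_sum, ← Finset.sum_mul, Finset.sum_const,
            Finset.card_range, nsmul_eq_mul]
          ring
      _ ≤ m ^ 2 * (2 ^ s₀ + a (m - g)) + g * (g * (η * a m)) := by
          have := card_close_le m g
          have hnn : 0 ≤ ∑ i ∈ Finset.range m, (if m ≤ g + i then (1 : ℝ) else 0) :=
            Finset.sum_nonneg fun i _ => by split_ifs <;> norm_num
          have := ha m
          gcongr
      _ = _ := by ring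
  have ihm := ih m (by omega) (by omega)
  set E := Real.exp (lam * m) with hE
  have hE1 : 1 ≤ E := Real.one_le_exp (by positivity)
  have hfar : a (m - g) ≤ 1 + X * E * Real.exp (-(lam * g)) := by
    have hpos : 0 ≤ X * E * Real.exp (-(lam * g)) := by positivity
    rcases le_or_gt g m with h | h
    · have := ih (m - g) (by omega) (by omega)
      rw [mul_assoc, hE, ← Real.exp_add]
      rw [Nat.cast_sub h] at this
      have e : lam * (m - g : ℝ) = lam * m + -(lam * g) := by ring
      rw [e] at this
      linarith
    · have h3 : m - g = 0 := by omega
      have := ha2 0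
      rw [h3]
      simp at this
      linarith
  have hfinal : a (m + 1) ≤ X * E * (1 + lam) := by
    have hm2 : (m : ℝ) ^ 2 ≤ M ^ 2 := by gcongr
    have hXE : 0 ≤ X * E := by positivity
    have s1 : (g : ℝ) ^ 2 * (η * a m) ≤ lam / 4 * (X * E) := by
      rw [← mul_assoc]
      exact mul_le_mul h1 ihm (ha m) (by positivity)
    have s2 : (m : ℝ) ^ 2 * (2 ^ s₀ + a (m - g)) ≤
        M ^ 2 * 2 ^ s₀ + M ^ 2 + lam / 2 * (X * E) := by
      calc (m : ℝ) ^ 2 * (2 ^ s₀ + a (m - g)) ≤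
          M ^ 2 * (2 ^ s₀ + (1 + X * E * Real.exp (-(lam * g)))) := by
            have := ha (m - g)
            gcongr
        _ = M ^ 2 * 2 ^ s₀ + M ^ 2 + (M ^ 2 * Real.exp (-(lam * g))) * (X * E) := by ring
        _ ≤ _ := by gcongr
    have s3 : M ^ 2 * 2 ^ s₀ + M ^ 2 + 1 + m ≤ lam / 4 * (X * E) := by
      calc M ^ 2 * 2 ^ s₀ + M ^ 2 + 1 + (m : ℝ) ≤ 4 * 2 ^ s₀ * M ^ 2 := by nlinarith
        _ = lam / 4 * X := hXl.symm
        _ ≤ lam / 4 * (X * E) := by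
            gcongr
            exact le_mul_of_one_le_right (by positivity) hE1
    have := hrec m
    nlinarith
  refine hfinal.trans ?_
  rw [mul_assoc]
  gcongr
  push_cast
  rw [show lam * ((m : ℝ) + 1) = lam * m + lam by ring, Real.exp_add, ← hE]
  gcongr
  linarith [Real.add_one_le_exp lam]

lemma wt_HS_le_two_pow {z : ℝ≥0∞} (hI : wt z IR ≤ 1) (m : ℕ) : wt z (HS m) ≤ 2 ^ m := by
  induction m with
  | zero => simpa using wt_HS_zero z
  | succ m ih =>
    refine (wt_HS_succ z m).trans ?_
    rw [pow_succ]
    refine mul_le_mul' ih ?_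
    rw [← one_add_one_eq_two]
    gcongr
    exact wt_Br_le_one hI _

lemma wt_HS_ne_top {z : ℝ≥0∞} (hI : wt z IR ≤ 1) (m : ℕ) : wt z (HS m) ≠ ∞ :=
  ne_top_of_le_ne_top (by simp) (wt_HS_le_two_pow hI m)

lemma toReal_wt_HS_add_le {z : ℝ≥0∞} (hI : wt z IR ≤ 1) (M k : ℕ) :
    (wt z (HS (M + k))).toReal ≤ (wt z (HS M)).toReal *
      Real.exp (∑ h ∈ Finset.range k, (wt z (Br (M + h + 1))).toReal) := by
  induction k with
  | zero => simp
  | succ k ih =>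
    have hfin : wt z (Br (M + k + 1)) ≠ ∞ :=
      ne_top_of_le_ne_top ENNReal.one_ne_top (wt_Br_le_one hI _)
    have h1 := ENNReal.toReal_mono (ENNReal.mul_ne_top (wt_HS_ne_top hI _)
      (ENNReal.add_ne_top.2 ⟨ENNReal.one_ne_top, by push_cast; exact hfin⟩))
      (wt_HS_succ z (M + k))
    rw [ENNReal.toReal_mul, ENNReal.toReal_add ENNReal.one_ne_top (by push_cast; exact hfin),
      ENNReal.toReal_one] at h1
    push_cast at h1
    rw [Finset.sum_range_succ, Real.exp_add, ← mul_assoc]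
    refine h1.trans (mul_le_mul ih ?_ (by positivity) (by positivity))
    rw [add_comm]
    exact Real.add_one_le_exp _

lemma toReal_wt_HS_le_exp {z : ℝ≥0∞} (hI : wt z IR ≤ 1) (hB : wt z BR ≠ ∞) (m : ℕ) :
    (wt z (HS m)).toReal ≤ Real.exp (wt z BR).toReal := by
  have h1 := toReal_wt_HS_add_le hI 0 m
  have h2 : (wt z (HS 0)).toReal ≤ 1 := by
    simpa using ENNReal.toReal_mono ENNReal.one_ne_top (wt_HS_zero z)
  have h3 : ∑ h ∈ Finset.range m, (wt z (Br (((0 : ℕ) : ℤ) + h + 1))).toReal ≤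
      (wt z BR).toReal := by
    have h4 := ENNReal.toReal_mono hB (sum_wt_Br_le z m)
    rw [ENNReal.toReal_sum fun h _ =>
      ne_top_of_le_ne_top ENNReal.one_ne_top (wt_Br_le_one hI _)] at h4
    simpa using h4
  rw [zero_add] at h1
  refine h1.trans ((mul_le_mul h2 (Real.exp_le_exp.2 h3) (by positivity) zero_le_one).trans ?_)
  rw [one_mul]

lemma toReal_recursion {z : ℝ≥0∞} (hI : wt z IR ≤ 1) (m : ℕ) :
    (wt z (HS (m + 1))).toReal ≤ (wt z (HS m)).toReal + (1 + m +
      ∑ i ∈ Finset.range m, ∑ j ∈ Finset.range i,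
        (wt z (T3 (m + 1) (i + 1) (j + 1))).toReal * (wt z (HS j)).toReal) := by
  have hT : ∀ a b c, wt z (T3 a b c) ≠ ∞ := fun a b c =>
    ne_top_of_le_ne_top ENNReal.one_ne_top (wt_T3_le_one hI a b c)
  have hmul : ∀ i j : ℕ, wt z (T3 (m + 1) (i + 1) (j + 1)) * wt z (HS j) ≠ ∞ := fun i j =>
    ENNReal.mul_ne_top (hT _ _ _) (wt_HS_ne_top hI j)
  have hs : ∀ i : ℕ, ∑ j ∈ Finset.range i, wt z (T3 (m + 1) (i + 1) (j + 1)) * wt z (HS j) ≠ ∞ :=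
    fun i => ENNReal.sum_ne_top.2 fun j _ => hmul i j
  have hss : ∑ i ∈ Finset.range m, ∑ j ∈ Finset.range i,
      wt z (T3 (m + 1) (i + 1) (j + 1)) * wt z (HS j) ≠ ∞ := ENNReal.sum_ne_top.2 fun i _ => hs i
  have h1m : (1 + m : ℝ≥0∞) ≠ ∞ := by simp
  have h := ENNReal.toReal_mono (ENNReal.add_ne_top.2 ⟨wt_HS_ne_top hI m,
    ENNReal.add_ne_top.2 ⟨h1m, hss⟩⟩) (wt_HS_succ_le_triples hI m)
  rw [ENNReal.toReal_add (wt_HS_ne_top hI m) (ENNReal.add_ne_top.2 ⟨h1m, hss⟩),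
    ENNReal.toReal_add h1m hss, ENNReal.toReal_sum fun i _ => hs i,
    ENNReal.toReal_add (by simp) (by simp)] at h
  simp only [ENNReal.toReal_sum fun j _ => hmul _ j, ENNReal.toReal_mul, ENNReal.toReal_one,
    ENNReal.toReal_natCast] at h
  exact h

lemma exp_neg_le_one_sub_half {x : ℝ} (h0 : 0 ≤ x) (h1 : x ≤ 1) : Real.exp (-x) ≤ 1 - x / 2 := by
  have h := Real.add_one_le_exp x
  rw [Real.exp_neg, inv_le_comm₀ (Real.exp_pos x) (by linarith)]
  refine le_trans ?_ h
  rw [inv_le_iff_one_le_mul₀ (by linarith)]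
  nlinarith

lemma wt_IRge_ne_top {z : ℝ≥0∞} (hI : wt z IR ≤ 1) (m : ℕ) : wt z (IRge m) ≠ ∞ :=
  ne_top_of_le_ne_top ENNReal.one_ne_top ((wt_mono z fun _ hw => hw.1).trans hI)

/-- A large bridge generating function at `y * q` forces the irreducible tail at `y` to be small. -/
lemma toReal_wt_IRge_le {y : ℝ≥0∞} {n : ℕ} (hI : wt y IR ≤ 1)
    (hB : wt (y * ENNReal.ofReal (Real.exp (-(1 / (2 * n))))) BR ≠ ∞) {m : ℕ} (hm : m ≤ n)
    (hn : 0 < n) :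
    (wt y (IRge m)).toReal * (m * (wt (y * ENNReal.ofReal (Real.exp (-(1 / (2 * n))))) BR).toReal)
      ≤ 4 * n := by
  set q := ENNReal.ofReal (Real.exp (-(1 / (2 * n)))) with hq
  have hn' : (0 : ℝ) < n := by exact_mod_cast hn
  have hq1 : q ≤ 1 := by
    rw [hq, ENNReal.ofReal_le_one, Real.exp_le_one_iff]
    simp only [Left.neg_nonpos_iff]
    positivity
  have hone := one_le_wt_BR (y * q)
  have hB0 : (wt (y * q) BR) ≠ 0 := fun h => by simp [h] at hone
  have hBpos : 0 < (wt (y * q) BR).toReal := ENNReal.toReal_pos hB0 hB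
  have h := wt_IRge_le hI hq1 hB m
  have hT := wt_IRge_ne_top hI m
  have hqm : q ^ m ≠ ∞ := ENNReal.pow_ne_top ENNReal.ofReal_ne_top
  have hinv : (wt (y * q) BR)⁻¹ ≠ ∞ := ENNReal.inv_ne_top.2 hB0
  have h' := ENNReal.toReal_mono (ENNReal.add_ne_top.2 ⟨ENNReal.mul_ne_top hqm hT, hinv⟩) h
  rw [ENNReal.toReal_add (ENNReal.mul_ne_top hqm hT) hinv, ENNReal.toReal_mul, ENNReal.toReal_inv,
    ENNReal.toReal_pow, hq, ENNReal.toReal_ofReal (Real.exp_pos _).le, ← Real.exp_nat_mul, ← hq]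
    at h'
  have hx : Real.exp (m * -(1 / (2 * n))) ≤ 1 - m / (4 * n) := by
    have h3 : (m : ℝ) ≤ n := by exact_mod_cast hm
    have := exp_neg_le_one_sub_half (x := m / (2 * n)) (by positivity)
      (by rw [div_le_one (by positivity)]; linarith)
    convert this using 2 <;> ring
  set T := (wt y (IRge m)).toReal
  set B := (wt (y * q) BR).toReal
  have hT0 : 0 ≤ T := ENNReal.toReal_nonneg
  have h4 : T * (m / (4 * n)) ≤ B⁻¹ := by nlinarith
  calc T * (m * B) = 4 * n * (T * (m / (4 * n)) * B) := by field_simp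
    _ ≤ 4 * n * (B⁻¹ * B) := by gcongr
    _ = 4 * n := by rw [inv_mul_cancel₀ hBpos.ne', mul_one]

/-- A parametric real form of the bound on the triple coefficients. -/
lemma toReal_wt_T3_le {z : ℝ≥0∞} (hI : wt z IR ≤ 1) (hz : z ≠ ∞) {g r s₀ k₀ R m₀ L : ℕ}
    {h₁ h₂ h₃ : ℕ} (h12 : h₂ < h₁) (h23 : h₃ < h₂) (h0 : 0 < h₃) (h13 : h₁ ≤ g + h₃)
    (hs : s₀ ≤ h₃) (hR : R ^ 2 ≤ k₀) (hR0 : R ≠ 0) (hL : m₀ * L < h₃)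
    (hu : 1 / 2 ≤ (wt z (IRle r)).toReal ^ g) {c : ℝ} (hc : 0 ≤ c) (hc1 : c ≤ 1)
    (hcz : ENNReal.ofReal c ≤ z) :
    (wt z (T3 h₁ h₂ h₃)).toReal ≤ 2 * (g * (wt z (IRge r)).toReal) +
      ((4 * (g * r) + 1) * ((R : ℝ)⁻¹ + (m₀ * (2 * (wt z (IRge L)).toReal) +
        2 ^ k₀ * (1 - c ^ 2) ^ m₀)) + 2 * (g * ((wt z (IRge s₀)).toReal * (g * r + 1)))) := by
  have hρ : 1 - z ^ 2 ≤ ENNReal.ofReal (1 - c ^ 2) := by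
    rw [ENNReal.ofReal_sub _ (by positivity), ENNReal.ofReal_one, ENNReal.ofReal_pow hc]
    gcongr
  have hρ0 : 0 ≤ 1 - c ^ 2 := by nlinarith
  have ha := wt_IRge_ne_top hI r
  have hb := wt_IRge_ne_top hI L
  have hcc := wt_IRge_ne_top hI s₀
  have hIr : wt z (IRle r) ≠ ∞ :=
    ne_top_of_le_ne_top ENNReal.one_ne_top ((wt_mono z fun _ hw => hw.1).trans hI)
  obtain ⟨a, ha0, haeq⟩ : ∃ a : ℝ, 0 ≤ a ∧ wt z (IRge r) = ENNReal.ofReal a :=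
    ⟨_, ENNReal.toReal_nonneg, (ENNReal.ofReal_toReal ha).symm⟩
  obtain ⟨b, hb0, hbeq⟩ : ∃ a : ℝ, 0 ≤ a ∧ wt z (IRge L) = ENNReal.ofReal a :=
    ⟨_, ENNReal.toReal_nonneg, (ENNReal.ofReal_toReal hb).symm⟩
  obtain ⟨d, hd0, hdeq⟩ : ∃ a : ℝ, 0 ≤ a ∧ wt z (IRge s₀) = ENNReal.ofReal a :=
    ⟨_, ENNReal.toReal_nonneg, (ENNReal.ofReal_toReal hcc).symm⟩
  have hgood : wt z (Good g r h₁ h₂ h₃) ≤ 2 * (g * (wt z (IRge s₀) * (g * r + 1 : ℕ))) := by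
    have h := wt_Good_mul_le hI (g := g) (r := r) (s₀ := s₀) (h₁ := h₁) (h₂ := h₂) (h₃ := h₃)
      (by exact_mod_cast h12) (by exact_mod_cast h23) (by exact_mod_cast h0) (by omega)
      (by exact_mod_cast hs)
    have hhalf : (2 : ℝ≥0∞)⁻¹ ≤ wt z (IRle r) ^ g := by
      rw [← ENNReal.toReal_le_toReal (by simp) (ENNReal.pow_ne_top hIr), ENNReal.toReal_pow]
      simpa using hu
    calc wt z (Good g r h₁ h₂ h₃) = 2 * (wt z (Good g r h₁ h₂ h₃) * 2⁻¹) := by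
          rw [mul_comm, mul_assoc, ENNReal.inv_mul_cancel (by simp) (by simp), mul_one]
      _ ≤ 2 * (wt z (Good g r h₁ h₂ h₃) * wt z (IRle r) ^ g) := by gcongr
      _ ≤ _ := by gcongr
  have h := wt_T3_le hI g r h₁ h₂ h₃ fun y => wt_Br_xd_le hI hz y hR hR0 hL
  refine ENNReal.toReal_le_of_le_ofReal (by positivity) ?_
  rw [haeq, hbeq, hdeq, ENNReal.toReal_ofReal ha0, ENNReal.toReal_ofReal hb0,
    ENNReal.toReal_ofReal hd0]
  refine h.trans ?_
  have hRpos : (0 : ℝ) < R := by positivity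
  calc _ ≤ 2 * (g * ENNReal.ofReal a) + ((4 * (g * r) + 1 : ℕ) * ((R : ℝ≥0∞)⁻¹ +
        (m₀ * (2 * ENNReal.ofReal b) + 2 ^ k₀ * ENNReal.ofReal (1 - c ^ 2) ^ m₀)) +
        2 * (g * (ENNReal.ofReal d * (g * r + 1 : ℕ)))) := by
        rw [← haeq, ← hbeq, ← hdeq]
        gcongr
    _ = _ := by
        have e1 : ∀ k : ℕ, (k : ℝ≥0∞) = ENNReal.ofReal k := fun k => by simp
        have e2 : (2 : ℝ≥0∞) = ENNReal.ofReal 2 := by simp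
        rw [e2, e1 g, e1 m₀, e1 R, e1 (4 * (g * r) + 1), e1 (g * r + 1),
          ← ENNReal.ofReal_inv_of_pos hRpos, ← ENNReal.ofReal_pow hρ0,
          ← ENNReal.ofReal_pow (by norm_num)]
        push_cast
        repeat first
          | rw [← ENNReal.ofReal_mul (by positivity)]
          | rw [← ENNReal.ofReal_add (by positivity) (by positivity)]

/-- The choice of scales makes the triple coefficients negligible. -/
lemma triple_arith {t a b d X : ℝ} (ht : 100 ≤ t) (ha : a * t ^ 13 ≤ 4) (hb : b * t ^ 142 ≤ 4)
    (hd : d * t ^ 200 ≤ 4) (hX : X * t ^ 28 ≤ 1) :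
    2 * (t ^ 3 * a) + ((4 * (t ^ 3 * t ^ 14) + 1) * ((t ^ 28)⁻¹ + (t ^ 57 * (2 * b) + X)) +
      2 * (t ^ 3 * (d * (t ^ 3 * t ^ 14 + 1)))) ≤ (t ^ 9)⁻¹ := by
  have ht0 : 0 < t := by linarith
  obtain ⟨s, hs⟩ : ∃ s, s = t⁻¹ := ⟨_, rfl⟩
  have hs0 : 0 < s := by rw [hs]; positivity
  have hst : t * s = 1 := by rw [hs]; field_simp
  have hst' : ∀ k : ℕ, t ^ k * s ^ k = 1 := fun k => by rw [← mul_pow, hst, one_pow]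
  have hs1 : s ≤ 1 := by nlinarith
  have ht1 : 1 ≤ t ^ 17 := one_le_pow₀ (by linarith)
  have key : ∀ (x : ℝ) (C : ℝ) (k : ℕ), x * t ^ k ≤ C → x ≤ C * s ^ k := fun x C k h => by
    calc x = x * t ^ k * s ^ k := by rw [mul_assoc, hst', mul_one]
      _ ≤ _ := by gcongr
  have ha' := key _ _ _ ha
  have hb' := key _ _ _ hb
  have hd' := key _ _ _ hd
  have hX' := key _ _ _ hX
  have hinv : ∀ k : ℕ, (t ^ k)⁻¹ = s ^ k := fun k => by rw [hs, inv_pow]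
  rw [hinv, hinv]
  have e1 : 2 * (t ^ 3 * a) ≤ 8 * s ^ 10 := by
    calc 2 * (t ^ 3 * a) ≤ 2 * (t ^ 3 * (4 * s ^ 13)) := by gcongr
      _ = 8 * s ^ 10 * (t ^ 3 * s ^ 3) := by ring
      _ = _ := by rw [hst', mul_one]
  have e2 : t ^ 57 * (2 * b) ≤ 8 * s ^ 28 := by
    calc t ^ 57 * (2 * b) ≤ t ^ 57 * (2 * (4 * s ^ 142)) := by gcongr
      _ = 8 * s ^ 85 * (t ^ 57 * s ^ 57) := by ring
      _ = 8 * s ^ 28 * s ^ 57 := by rw [hst']; ring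
      _ ≤ 8 * s ^ 28 * 1 := by
        gcongr
        exact pow_le_one₀ hs0.le hs1
      _ = _ := mul_one _
  have e3 : (4 * (t ^ 3 * t ^ 14) + 1) * (s ^ 28 + (t ^ 57 * (2 * b) + X)) ≤ 50 * s ^ 10 := by
    calc _ ≤ (5 * t ^ 17) * (s ^ 28 + (8 * s ^ 28 + 1 * s ^ 28)) := by
          have : 4 * (t ^ 3 * t ^ 14) + 1 ≤ 5 * t ^ 17 := by
            rw [← pow_add]
            norm_num
            linarith
          refine (mul_le_mul_of_nonneg_left (by linarith) (by positivity)).trans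
            (mul_le_mul_of_nonneg_right this (by positivity))
      _ = 50 * s ^ 10 * s * (t ^ 17 * s ^ 17) := by ring
      _ = 50 * s ^ 10 * s := by rw [hst', mul_one]
      _ ≤ 50 * s ^ 10 * 1 := by gcongr
      _ = _ := mul_one _
  have e4 : 2 * (t ^ 3 * (d * (t ^ 3 * t ^ 14 + 1))) ≤ 16 * s ^ 10 := by
    calc _ = 2 * (t ^ 3 * (t ^ 17 + 1)) * d := by ring
      _ ≤ 2 * (t ^ 3 * (t ^ 17 + 1)) * (4 * s ^ 200) := by gcongr
      _ ≤ 2 * (t ^ 3 * (t ^ 17 + t ^ 17)) * (4 * s ^ 200) := by gcongr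
      _ = 16 * s ^ 10 * s ^ 170 * (t ^ 20 * s ^ 20) := by ring
      _ = 16 * s ^ 10 * s ^ 170 := by rw [hst', mul_one]
      _ ≤ 16 * s ^ 10 * 1 := by
        gcongr
        exact pow_le_one₀ hs0.le hs1
      _ = _ := mul_one _
  have e5 : 100 * s ^ 10 ≤ s ^ 9 := by
    have : 100 * s ≤ 1 := by nlinarith
    calc 100 * s ^ 10 = s ^ 9 * (100 * s) := by ring
      _ ≤ s ^ 9 * 1 := by gcongr
      _ = _ := mul_one _
  have : 0 ≤ s ^ 10 := by positivity
  linarith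

lemma sum_exp_tail_le {n M k : ℕ} {x : ℝ} (hn : 0 < n) (hx : x ≤ M / (2 * n)) :
    ∑ h ∈ Finset.range k, Real.exp (-(1 / (2 * n))) ^ (M + h + 1) ≤ Real.exp (-x) * (4 * n) := by
  have hn' : (1 : ℝ) ≤ n := by exact_mod_cast hn
  set q := Real.exp (-(1 / (2 * (n : ℝ)))) with hq
  have hq0 : 0 < q := Real.exp_pos _
  have h1 : q ≤ 1 - 1 / (4 * n) := by
    have := exp_neg_le_one_sub_half (x := 1 / (2 * n)) (by positivity)
      (by rw [div_le_one (by positivity)]; linarith)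
    refine this.trans (le_of_eq ?_)
    ring
  have hpos : (0 : ℝ) < 1 / (4 * n) := by positivity
  have hqM : q ^ M ≤ Real.exp (-x) := by
    rw [hq, ← Real.exp_nat_mul, Real.exp_le_exp]
    calc (M : ℝ) * -(1 / (2 * n)) = -(M / (2 * n)) := by ring
      _ ≤ -x := neg_le_neg hx
  have hgeom : ∑ h ∈ Finset.range k, q ^ h ≤ 4 * n := by
    have h2 : (∑ h ∈ Finset.range k, q ^ h) * (1 - q) = 1 - q ^ k := geom_sum_mul_neg q k
    have h3 : 0 ≤ ∑ h ∈ Finset.range k, q ^ h := Finset.sum_nonneg fun _ _ => by positivity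
    have h4 : 0 ≤ q ^ k := by positivity
    have h5 : (∑ h ∈ Finset.range k, q ^ h) * (1 / (4 * n)) ≤ 1 := by nlinarith
    rwa [mul_one_div, div_le_one (by positivity)] at h5
  calc ∑ h ∈ Finset.range k, q ^ (M + h + 1) = ∑ h ∈ Finset.range k, q ^ M * (q ^ h * q) :=
        Finset.sum_congr rfl fun h _ => by ring
    _ ≤ ∑ h ∈ Finset.range k, q ^ M * (q ^ h * 1) := by
        gcongr
        linarith
    _ = q ^ M * ∑ h ∈ Finset.range k, q ^ h := by simp [Finset.mul_sum]
    _ ≤ _ := by gcongr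

lemma pow_mul_pow_le_inv {ρ : ℝ} {t : ℕ} (hρ : 0 ≤ ρ) (h : ρ ^ t ≤ 1 / 4) :
    (2 ^ t ^ 56 * ρ ^ t ^ 57) * (t : ℝ) ^ 28 ≤ 1 := by
  have h1 : (2 : ℝ) ^ t ^ 56 * ρ ^ t ^ 57 ≤ (1 / 2) ^ t ^ 56 := by
    rw [pow_succ' t 56, pow_mul, ← mul_pow]
    gcongr
    linarith
  have h2 : (t : ℝ) ^ 28 ≤ 2 ^ t ^ 56 := by
    have h3 : t ^ 28 ≤ 2 ^ t ^ 28 := Nat.lt_two_pow_self.le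
    have h4 : t ^ 28 ≤ t ^ 56 := by
      rcases Nat.eq_zero_or_pos t with rfl | ht
      · simp
      · exact Nat.pow_le_pow_right ht (by norm_num)
    exact_mod_cast h3.trans (Nat.pow_le_pow_right (by norm_num) h4)
  calc _ ≤ (1 / 2 : ℝ) ^ t ^ 56 * 2 ^ t ^ 56 := by gcongr
    _ = 1 := by rw [← mul_pow]; norm_num

/-- Subexponential growth of half-space walks below the critical point, at the length scale
`t ^ 203`. -/
theorem exists_toReal_wt_HS_le {c : ℝ} (hc : 0 < c) (hc1 : c ≤ 1) : ∃ t₀ : ℕ, ∀ t ≥ t₀,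
    ∀ y q : ℝ≥0∞, wt y BR ≠ ∞ → y ≠ ∞ →
    q = ENNReal.ofReal (Real.exp (-(1 / (2 * (t ^ 203 : ℕ))))) → ENNReal.ofReal c ≤ y * q →
    ∀ m, (wt (y * q) (HS m)).toReal ≤ Real.exp (4 * (t : ℝ) ^ 202) := by
  have ev1 : ∀ᶠ t : ℕ in atTop, (1 - c ^ 2) ^ t ≤ 1 / 4 :=
    (tendsto_pow_atTop_nhds_zero_of_lt_one (r := 1 - c ^ 2) (by nlinarith)
      (by nlinarith)).eventually (ge_mem_nhds (by norm_num))
  have ev2 : ∀ᶠ t : ℕ in atTop, 2 * (t : ℝ) ^ 410 ≤ Real.exp t := by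
    have := ((Real.tendsto_pow_mul_exp_neg_atTop_nhds_zero 410).comp
      tendsto_natCast_atTop_atTop).eventually (ge_mem_nhds (show (0 : ℝ) < 1 / 2 by norm_num))
    filter_upwards [this] with t ht
    simp only [Function.comp_apply, Real.exp_neg, ← div_eq_mul_inv] at ht
    rw [div_le_iff₀ (Real.exp_pos _)] at ht
    linarith
  obtain ⟨t₀, ht₀⟩ := eventually_atTop.1 (ev1.and (ev2.and (eventually_ge_atTop 100)))
  refine ⟨t₀, fun t ht y q hBy hy hq hcz => ?_⟩
  obtain ⟨hρ, hexp, ht100⟩ := ht₀ t ht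
  have hT : (100 : ℝ) ≤ t := by exact_mod_cast ht100
  have hT1 : (1 : ℝ) ≤ t := by linarith
  have hn : 0 < t ^ 203 := by positivity
  have hq1 : q ≤ 1 := by
    rw [hq, ENNReal.ofReal_le_one, Real.exp_le_one_iff, Left.neg_nonpos_iff]
    positivity
  have hyz : y * q ≤ y := mul_le_of_le_one_right' hq1
  have hBz : wt (y * q) BR ≠ ∞ := ne_top_of_le_ne_top hBy (wt_mono_left hyz _)
  have hIy := wt_IR_le_one hBy
  have hI := wt_IR_le_one hBz
  have hz : y * q ≠ ∞ := ne_top_of_le_ne_top hy hyz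
  rcases le_or_gt (wt (y * q) BR).toReal ((t : ℝ) ^ 202) with hB | hB
  · intro m
    refine (toReal_wt_HS_le_exp hI hBz m).trans (Real.exp_le_exp.2 (hB.trans ?_))
    have : (0 : ℝ) ≤ (t : ℝ) ^ 202 := by positivity
    linarith
  have htail : ∀ k : ℕ, k ≤ 202 → (wt (y * q) (IRge (t ^ (k + 1)))).toReal * (t : ℝ) ^ k ≤ 4 := by
    intro k hk
    have h := toReal_wt_IRge_le hIy (hq ▸ hBz) (m := t ^ (k + 1)) (n := t ^ 203)
      (Nat.pow_le_pow_right (by omega) (by omega)) hn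
    rw [← hq] at h
    have h2 : (wt (y * q) (IRge (t ^ (k + 1)))).toReal ≤ (wt y (IRge (t ^ (k + 1)))).toReal :=
      ENNReal.toReal_mono (wt_IRge_ne_top hIy _) (wt_mono_left hyz _)
    set T := (wt (y * q) (IRge (t ^ (k + 1)))).toReal
    have h3 : T * (t : ℝ) ^ k * (t : ℝ) ^ 203 ≤ 4 * (t : ℝ) ^ 203 := by
      calc T * (t : ℝ) ^ k * (t : ℝ) ^ 203 = T * ((t : ℝ) ^ (k + 1) * (t : ℝ) ^ 202) := by ring
        _ ≤ (wt y (IRge (t ^ (k + 1)))).toReal * ((t : ℝ) ^ (k + 1) * (wt (y * q) BR).toReal) := by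
          gcongr
        _ ≤ _ := by exact_mod_cast h
    exact le_of_mul_le_mul_right h3 (by positivity)
  have hshort : 1 / 2 ≤ (wt (y * q) (IRle (t ^ 14))).toReal ^ (t ^ 3) := by
    have hle : wt (y * q) IR ≤ wt (y * q) (IRle (t ^ 14)) + wt (y * q) (IRge (t ^ 14)) := by
      refine (wt_mono _ fun w hw => ?_).trans (wt_union_le _ _ _)
      rcases le_total w.length (t ^ 14) with h | h
      · exact Or.inl ⟨hw, h⟩
      · exact Or.inr ⟨hw, h⟩
    have hIr : wt (y * q) (IRle (t ^ 14)) ≠ ∞ :=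
      ne_top_of_le_ne_top ENNReal.one_ne_top ((wt_mono _ fun _ hw => hw.1).trans hI)
    have hge := wt_IRge_ne_top hI (t ^ 14)
    have hinv : (wt (y * q) BR)⁻¹ ≠ ∞ := by
      have := one_le_wt_BR (y * q)
      exact ENNReal.inv_ne_top.2 fun h => by simp [h] at this
    have h1 := ENNReal.toReal_mono (ENNReal.add_ne_top.2 ⟨ENNReal.add_ne_top.2 ⟨hIr, hge⟩, hinv⟩)
      ((one_le_wt_IR_add hBz).trans (add_le_add_left hle _))
    rw [ENNReal.toReal_add (ENNReal.add_ne_top.2 ⟨hIr, hge⟩) hinv, ENNReal.toReal_add hIr hge,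
      ENNReal.toReal_inv, ENNReal.toReal_one] at h1
    have h2 := htail 13 (by norm_num)
    norm_num at h2
    set u := (wt (y * q) (IRle (t ^ 14))).toReal
    set a := (wt (y * q) (IRge (t ^ 14))).toReal
    have hBinv : (wt (y * q) BR).toReal⁻¹ * (t : ℝ) ^ 13 ≤ 1 := by
      have h3 : (t : ℝ) ^ 13 ≤ (wt (y * q) BR).toReal :=
        (pow_le_pow_right₀ hT1 (by norm_num)).trans hB.le
      rw [inv_mul_le_iff₀ (lt_of_lt_of_le (by positivity) h3)]
      linarith
    have hu : (1 - u) * (t : ℝ) ^ 13 ≤ 5 := by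
      have h13 : (0 : ℝ) < (t : ℝ) ^ 13 := by positivity
      nlinarith
    have hu2 : (t : ℝ) ^ 3 * (1 - u) ≤ 1 / 2 := by
      by_contra! hcon
      have h4 : 1 / 2 * (t : ℝ) ^ 10 < 5 := by
        calc 1 / 2 * (t : ℝ) ^ 10 < (t : ℝ) ^ 3 * (1 - u) * (t : ℝ) ^ 10 := by gcongr
          _ = (1 - u) * (t : ℝ) ^ 13 := by ring
          _ ≤ 5 := hu
      have h5 : (t : ℝ) ≤ (t : ℝ) ^ 10 := le_self_pow₀ hT1 (by norm_num)
      linarith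
    have hu0 : 0 ≤ u := ENNReal.toReal_nonneg
    have := one_add_mul_le_pow (a := u - 1) (by linarith) (t ^ 3)
    push_cast at this
    rw [add_sub_cancel] at this
    linarith
  have hη : ∀ m i j, j < i → i < m → t ^ 201 ≤ j + 1 → m ≤ t ^ 3 + j →
      (wt (y * q) (T3 (m + 1) (i + 1) (j + 1))).toReal ≤ ((t : ℝ) ^ 9)⁻¹ := by
    intro m i j hji him hs hg
    have h := toReal_wt_T3_le hI hz (g := t ^ 3) (r := t ^ 14) (s₀ := t ^ 201) (k₀ := t ^ 56)
      (R := t ^ 28) (m₀ := t ^ 57) (L := t ^ 143) (h₁ := m + 1) (h₂ := i + 1) (h₃ := j + 1)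
      (by omega) (by omega) (by omega) (by omega) hs (by rw [← pow_mul]) (by positivity)
      (lt_of_lt_of_le (by rw [← pow_add]; exact Nat.pow_lt_pow_right (by omega) (by norm_num)) hs)
      hshort hc.le hc1 hcz
    have harith := triple_arith hT (htail 13 (by norm_num)) (htail 142 (by norm_num))
      (htail 200 (by norm_num)) (pow_mul_pow_le_inv (by nlinarith) hρ)
    push_cast at h
    exact h.trans harith
  have hmono : Monotone fun m => (wt (y * q) (HS m)).toReal := fun m k hmk =>
    ENNReal.toReal_mono (wt_HS_ne_top hI k) (wt_mono _ (HS_mono hmk))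
  have hgrow := growth_of_recursion (a := fun m => (wt (y * q) (HS m)).toReal)
    (c := fun m i j => (wt (y * q) (T3 (m + 1) (i + 1) (j + 1))).toReal) (g := t ^ 3)
    (s₀ := t ^ 201) (M := t ^ 204) (η := ((t : ℝ) ^ 9)⁻¹) (lam := ((t : ℝ) ^ 2)⁻¹) hmono
    (fun m => ENNReal.toReal_nonneg) (fun m => by
      simpa using ENNReal.toReal_mono (by simp) (wt_HS_le_two_pow hI m))
    (toReal_recursion hI) (fun m i j => by
      simpa using ENNReal.toReal_mono ENNReal.one_ne_top (wt_T3_le_one hI (m + 1) (i + 1) (j + 1)))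
    hη (by positivity) (by positivity) (inv_le_one_of_one_le₀ (one_le_pow₀ hT1))
    (Nat.one_le_pow _ _ (by omega)) ?_ ?_ (t ^ 204) le_rfl
  · have hM : (wt (y * q) (HS (t ^ 204))).toReal ≤ Real.exp (3 * (t : ℝ) ^ 202) := by
      refine hgrow.trans ?_
      push_cast
      have e1 : ((t : ℝ) ^ 2)⁻¹ * (t : ℝ) ^ 204 = (t : ℝ) ^ 202 := by
        field_simp
      have e2 : (2 : ℝ) ^ t ^ 201 ≤ Real.exp ((t : ℝ) ^ 201) := by
        have : (2 : ℝ) ≤ Real.exp 1 := by linarith [Real.add_one_le_exp (1 : ℝ)]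
        calc (2 : ℝ) ^ t ^ 201 ≤ Real.exp 1 ^ t ^ 201 := by gcongr
          _ = _ := by
            rw [← Real.exp_nat_mul]
            push_cast
            rw [mul_one]
      have e3 : (8 : ℝ) ≤ Real.exp 8 := by linarith [Real.add_one_le_exp (8 : ℝ)]
      rw [e1]
      calc (2 : ℝ) ^ t ^ 201 * 16 * ((t : ℝ) ^ 204) ^ 2 / ((t : ℝ) ^ 2)⁻¹ *
            Real.exp ((t : ℝ) ^ 202) = 2 ^ t ^ 201 * 8 * (2 * (t : ℝ) ^ 410) *
            Real.exp ((t : ℝ) ^ 202) := by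
            field_simp
            ring
        _ ≤ Real.exp ((t : ℝ) ^ 201) * Real.exp 8 * Real.exp t * Real.exp ((t : ℝ) ^ 202) := by
            gcongr
        _ = Real.exp ((t : ℝ) ^ 201 + 8 + t + (t : ℝ) ^ 202) := by
            simp only [Real.exp_add]
        _ ≤ _ := by
            rw [Real.exp_le_exp]
            have h1 : (t : ℝ) ≤ (t : ℝ) ^ 201 := le_self_pow₀ hT1 (by norm_num)
            have h2 : (t : ℝ) ^ 202 = t * (t : ℝ) ^ 201 := by ring
            nlinarith
    intro m
    have hstep := toReal_wt_HS_add_le hI (t ^ 204) m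
    have hsum : ∑ h ∈ Finset.range m,
        (wt (y * q) (Br (((t ^ 204 : ℕ) : ℤ) + h + 1))).toReal ≤ 1 := by
      have h1 := sum_exp_tail_le (n := t ^ 203) (M := t ^ 204) (k := m) (x := t / 2) hn (by
        push_cast
        refine le_of_eq ?_
        field_simp)
      refine (Finset.sum_le_sum fun h _ => ?_).trans (h1.trans ?_)
      · have h2 := ENNReal.toReal_mono (ENNReal.pow_ne_top (hq ▸ ENNReal.ofReal_ne_top))
          (wt_Br_le_pow hIy hq1 (t ^ 204 + h + 1))
        rw [ENNReal.toReal_pow] at h2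
        nth_rw 2 [hq] at h2
        rw [ENNReal.toReal_ofReal (Real.exp_pos _).le] at h2
        exact_mod_cast h2
      · have h3 : (4 * (t : ℝ) ^ 203) ^ 2 ≤ Real.exp (t / 2) ^ 2 := by
          have e : Real.exp ((t : ℝ) / 2) ^ 2 = Real.exp t := by
            rw [← Real.exp_nat_mul]
            push_cast
            congr 1
            ring
          rw [e]
          refine le_trans ?_ hexp
          calc (4 * (t : ℝ) ^ 203) ^ 2 = 16 * (t : ℝ) ^ 406 := by ring
            _ ≤ 2 * (t : ℝ) ^ 4 * (t : ℝ) ^ 406 := by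
                gcongr
                have : (t : ℝ) ≤ (t : ℝ) ^ 4 := le_self_pow₀ hT1 (by norm_num)
                linarith
            _ = _ := by ring
        have h4 := (pow_le_pow_iff_left₀ (by positivity) (Real.exp_pos _).le two_ne_zero).1 h3
        rw [Real.exp_neg, inv_mul_le_iff₀ (Real.exp_pos _), mul_one]
        exact_mod_cast h4
    calc (wt (y * q) (HS m)).toReal ≤ (wt (y * q) (HS (t ^ 204 + m))).toReal :=
          hmono (Nat.le_add_left _ _)
      _ ≤ Real.exp (3 * (t : ℝ) ^ 202) * Real.exp 1 :=
          hstep.trans (mul_le_mul hM (Real.exp_le_exp.2 hsum) (by positivity) (by positivity))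
      _ ≤ _ := by
          rw [← Real.exp_add, Real.exp_le_exp]
          have : (1 : ℝ) ≤ (t : ℝ) ^ 202 := one_le_pow₀ hT1
          linarith
  · push_cast
    rw [← pow_mul, ← div_eq_mul_inv, div_le_div_iff₀ (by positivity) (by norm_num),
      inv_mul_eq_div, le_div_iff₀ (by positivity)]
    calc (t : ℝ) ^ (3 * 2) * 4 * (t : ℝ) ^ 2 = 4 * (t : ℝ) ^ 8 := by ring
      _ ≤ t * (t : ℝ) ^ 8 := by gcongr; linarith
      _ = _ := by ring
  · push_cast
    have e1 : ((t : ℝ) ^ 2)⁻¹ * (t : ℝ) ^ 3 = t := by field_simp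
    rw [e1, Real.exp_neg, ← div_eq_mul_inv, div_le_iff₀ (Real.exp_pos _)]
    calc ((t : ℝ) ^ 204) ^ 2 = ((t : ℝ) ^ 2)⁻¹ / 2 * (2 * (t : ℝ) ^ 410) := by
          field_simp
      _ ≤ _ := by gcongr

/-! ### Self-avoiding words and self-avoiding walks -/

/-- Self-avoiding words of length `n`. -/
def SAWords (n : ℕ) : Set Word := {w | Avoid w ∧ w.length = n}

/-- The walk traced by a word. -/
def walk (n : ℕ) (w : Word) : Fin (n + 1) → Fin 2 → ℤ := fun i => ![xd (w.take i), yd (w.take i)]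

/-- The step with a given displacement. -/
def stepOf (v : Fin 2 → ℤ) : Step := if v 0 = 0 then (true, decide (v 1 = 1)) else
  (false, decide (v 0 = 1))

lemma Step.ext_displacement {s s' : Step} (hx : dx s = dx s') (hy : dy s = dy s') : s = s' := by
  rcases s with ⟨_ | _, _ | _⟩ <;> rcases s' with ⟨_ | _, _ | _⟩ <;> simp_all [dx, dy]

lemma abs_dx_add_abs_dy (s : Step) : |dx s| + |dy s| = 1 := by
  rcases s with ⟨_ | _, _ | _⟩ <;> simp [dx, dy]

lemma dx_dy_stepOf {v : Fin 2 → ℤ} (h : |v 0| + |v 1| = 1) :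
    dx (stepOf v) = v 0 ∧ dy (stepOf v) = v 1 := by
  unfold stepOf
  rcases abs_cases (v 0) with h0 | h0 <;> rcases abs_cases (v 1) with h1 | h1 <;>
    by_cases h2 : v 0 = 0 <;> by_cases h3 : v 1 = 1 <;> by_cases h4 : v 0 = 1 <;>
    simp [dx, dy, h2, h3, h4] <;> omega

lemma take_succ_append {w : Word} {i : ℕ} (h : i < w.length) :
    w.take (i + 1) = w.take i ++ [w[i]] := (List.take_concat_get' w i h).symm

lemma xd_take_succ {w : Word} {i : ℕ} (h : i < w.length) :
    xd (w.take (i + 1)) = xd (w.take i) + dx w[i] := by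
  rw [take_succ_append h, xd_append, xd_cons, xd_nil, add_zero]

lemma yd_take_succ {w : Word} {i : ℕ} (h : i < w.length) :
    yd (w.take (i + 1)) = yd (w.take i) + dy w[i] := by
  rw [take_succ_append h, yd_append, yd_cons, yd_nil, add_zero]

lemma avoid_iff_take {w : Word} : Avoid w ↔ ∀ i j, i < j → j ≤ w.length →
    xd (w.take i) = xd (w.take j) → yd (w.take i) ≠ yd (w.take j) := by
  constructor
  · intro h i j hij hj hx hy
    have e : w.take j = w.take i ++ (w.take j).drop i := by
      conv_lhs => rw [← List.take_append_drop i (w.take j)]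
      rw [List.take_take, min_eq_left hij.le]
    refine h (w.take i) ((w.take j).drop i) (w.drop j) ?_ ?_ ?_ ?_
    · rw [← List.append_assoc, ← e, List.take_append_drop]
    · intro h0
      have := congrArg List.length h0
      simp at this
      omega
    · rw [e, xd_append] at hx
      linarith
    · rw [e, yd_append] at hy
      linarith
  · rintro h a b c rfl hb hx hy
    have hl := List.length_pos_of_ne_nil hb
    have e1 : (a ++ (b ++ c)).take a.length = a := by simp
    have e2 : (a ++ (b ++ c)).take (a.length + b.length) = a ++ b := by
      rw [← List.append_assoc]
      exact List.take_left' (by simp)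
    refine h a.length (a.length + b.length) (by omega) (by simp) ?_ ?_ <;> rw [e1, e2] <;> simp [*]

lemma walk_mem {n : ℕ} {w : Word} (hw : w ∈ SAWords n) : IsSAW 2 n (walk n w) := by
  obtain ⟨hA, hl⟩ := hw
  refine ⟨?_, fun i => ?_, ?_⟩
  · ext j
    fin_cases j <;> simp [walk]
  · have hi : (i : ℕ) < w.length := by omega
    simp only [Fin.sum_univ_two, walk, Fin.val_succ, Fin.val_castSucc, Matrix.cons_val_zero,
      Matrix.cons_val_one, xd_take_succ hi, yd_take_succ hi, add_sub_cancel_left]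
    exact abs_dx_add_abs_dy _
  · rw [avoid_iff_take] at hA
    have key : ∀ i j : Fin (n + 1), i < j → walk n w i ≠ walk n w j := by
      intro i j hij he
      have hx := congrFun he 0
      have hy := congrFun he 1
      simp only [walk, Matrix.cons_val_zero, Matrix.cons_val_one] at hx hy
      exact hA i j hij (by omega) hx hy
    intro i j he
    rcases lt_trichotomy i j with h | h | h
    · exact absurd he (key i j h)
    · exact h
    · exact absurd he.symm (key j i h)

lemma walk_injOn (n : ℕ) : Set.InjOn (walk n) (SAWords n) := by
  rintro w ⟨-, hl⟩ w' ⟨-, hl'⟩ he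
  refine List.ext_getElem (hl.trans hl'.symm) fun i hi hi' => ?_
  have hx : ∀ k : ℕ, k ≤ n → xd (w.take k) = xd (w'.take k) := fun k hk => by
    simpa [walk] using congrFun (congrFun he ⟨k, by omega⟩) 0
  have hy : ∀ k : ℕ, k ≤ n → yd (w.take k) = yd (w'.take k) := fun k hk => by
    simpa [walk] using congrFun (congrFun he ⟨k, by omega⟩) 1
  have hx1 := hx (i + 1) (by omega)
  have hy1 := hy (i + 1) (by omega)
  rw [xd_take_succ hi, xd_take_succ hi', hx i (by omega)] at hx1
  rw [yd_take_succ hi, yd_take_succ hi', hy i (by omega)] at hy1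
  exact Step.ext_displacement (by linarith) (by linarith)

lemma exists_walk_eq {n : ℕ} {ω : Fin (n + 1) → Fin 2 → ℤ} (h : IsSAW 2 n ω) :
    ∃ w ∈ SAWords n, walk n w = ω := by
  obtain ⟨h0, hs, hinj⟩ := h
  set w : Word := List.ofFn fun i : Fin n => stepOf (ω i.succ - ω i.castSucc) with hw
  have hl : w.length = n := by simp [hw]
  have hpos : ∀ i : ℕ, ∀ hi : i < n + 1, xd (w.take i) = ω ⟨i, hi⟩ 0 ∧
      yd (w.take i) = ω ⟨i, hi⟩ 1 := by
    intro i
    induction i with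
    | zero =>
      intro hi
      simp [h0]
    | succ i ih =>
      intro hi
      have hiw : i < w.length := by omega
      obtain ⟨ihx, ihy⟩ := ih (by omega)
      have hstep := hs ⟨i, by omega⟩
      rw [Fin.sum_univ_two] at hstep
      have hd := dx_dy_stepOf (v := ω (Fin.succ ⟨i, by omega⟩) - ω (Fin.castSucc ⟨i, by omega⟩))
        hstep
      have hget : w[i] = stepOf (ω (Fin.succ ⟨i, by omega⟩) - ω (Fin.castSucc ⟨i, by omega⟩)) := by
        simp [hw]
      rw [xd_take_succ hiw, yd_take_succ hiw, hget, hd.1, hd.2, ihx, ihy]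
      simp
  have hwalk : walk n w = ω := by
    ext i j
    fin_cases j
    · simpa [walk] using (hpos i i.2).1
    · simpa [walk] using (hpos i i.2).2
  refine ⟨w, ⟨avoid_iff_take.2 fun i j hij hj hx hy => ?_, hl⟩, hwalk⟩
  have hi := hpos i (by omega)
  have hj' := hpos j (by omega)
  have : ω ⟨i, by omega⟩ = ω ⟨j, by omega⟩ := by
    ext k
    fin_cases k
    · exact hi.1.symm.trans (hx.trans hj'.1)
    · exact hi.2.symm.trans (hy.trans hj'.2)
  have := congrArg Fin.val (hinj this)
  simp at this
  omega

lemma ncard_SAWords (n : ℕ) : (SAWords n).ncard = sawCount 2 n := by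
  have himg : walk n '' SAWords n = {ω | IsSAW 2 n ω} := by
    ext ω
    constructor
    · rintro ⟨w, hw, rfl⟩
      exact walk_mem hw
    · exact fun h => exists_walk_eq h
  rw [sawCount, ← himg, (walk_injOn n).ncard_image]

lemma finite_SAWords (n : ℕ) : (SAWords n).Finite :=
  (List.finite_length_eq Step n).subset fun _ hw => hw.2

lemma one_le_sawCount (n : ℕ) : 1 ≤ sawCount 2 n := by
  rw [← ncard_SAWords, Nat.one_le_iff_ne_zero, Ne, Set.ncard_eq_zero (finite_SAWords n)]
  refine Set.Nonempty.ne_empty ⟨List.replicate n (true, true), ?_, by simp⟩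
  intro a b c e hb hx hy
  have hall : ∀ s ∈ b, s = (true, true) := fun s hs =>
    List.eq_of_mem_replicate (e ▸ by simp [hs] : s ∈ List.replicate n (true, true))
  have : b = List.replicate b.length (true, true) := List.eq_replicate_iff.2 ⟨rfl, hall⟩
  rw [this] at hy
  have hl := List.length_pos_of_ne_nil hb
  simp [yd, dy] at hy
  exact hb hy

lemma wt_SAWords (z : ℝ≥0∞) (n : ℕ) : wt z (SAWords n) = sawCount 2 n * z ^ n := by
  have h : wt z (SAWords n) = ∑' _ : SAWords n, z ^ n :=
    tsum_congr fun w => by rw [w.2.2]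
  rw [h, ENNReal.tsum_set_const, ← ncard_SAWords, ← (finite_SAWords n).cast_ncard_eq]
  simp

lemma wt_BR_le_tsum (z : ℝ≥0∞) : wt z BR ≤ ∑' n, (sawCount 2 n : ℝ≥0∞) * z ^ n := by
  simp only [← wt_SAWords]
  refine (wt_mono z (T := ⋃ n, SAWords n) fun w hw => ?_).trans ?_
  · exact Set.mem_iUnion.2 ⟨w.length, hw.avoid, rfl⟩
  · exact ENNReal.tsum_iUnion_le_tsum (fun w : Word => z ^ w.length) SAWords

/-! ### Cutting a walk at its last lowest point -/

lemma exists_last_min (w : Word) : ∃ a b, w = a ++ b ∧ (∀ p s, a = p ++ s → yd s ≤ 0) ∧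
    ∀ p s, b = p ++ s → p ≠ [] → 0 < yd p := by
  induction w using List.reverseRecOn with
  | nil =>
    refine ⟨[], [], rfl, fun p s e => ?_, fun p s e hp => ?_⟩
    · simp at e
      simp [e.2]
    · simp at e
      exact absurd e.1 hp
  | append_singleton w s ih =>
    obtain ⟨a, b, rfl, ha, hb⟩ := ih
    by_cases h : 0 < yd (b ++ [s])
    · refine ⟨a, b ++ [s], by simp, ha, fun p r e hp => ?_⟩
      rcases List.eq_nil_or_concat r with rfl | ⟨r', x, rfl⟩
      · rw [List.append_nil] at e
        rwa [← e]
      · rw [List.concat_eq_append, ← List.append_assoc] at e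
        exact hb p r' (List.append_inj' e rfl).1 hp
    · have hb0 : ∀ p r, b ++ [s] = p ++ r → yd r ≤ 0 := by
        intro p r e
        rcases List.eq_nil_or_concat r with rfl | ⟨r', x, rfl⟩
        · simp
        · have e' := e
          rw [List.concat_eq_append, ← List.append_assoc] at e'
          have hp : 0 ≤ yd p := by
            by_cases hp : p = []
            · simp [hp]
            · exact (hb p r' (List.append_inj' e' rfl).1 hp).le
          rw [e, yd_append] at h
          linarith
      refine ⟨a ++ (b ++ [s]), [], by simp, fun p r e => ?_, fun p r e hp => ?_⟩
      · rcases List.append_eq_append_iff.1 e with ⟨t, rfl, ht⟩ | ⟨t, rfl, ht⟩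
        · exact hb0 t r ht
        · rw [ht, yd_append]
          linarith [ha p t rfl]
      · simp at e
        exact absurd e.1 hp

@[simp] lemma xd_reverse (w : Word) : xd w.reverse = xd w := by simp [xd]

@[simp] lemma yd_reverse (w : Word) : yd w.reverse = yd w := by simp [yd]

lemma Avoid.reverse {w : Word} (h : Avoid w) : Avoid w.reverse := by
  intro a b c e hb hx
  have e' : w = c.reverse ++ (b.reverse ++ a.reverse) := by
    rw [← List.reverse_reverse w, e]
    simp
  simpa using h _ _ _ e' (by simpa) (by simpa)

/-- Counting self-avoiding words by cutting them into two half-space walks. -/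
lemma mul_wt_SAWords_le (z : ℝ≥0∞) (n : ℕ) :
    z * wt z (SAWords n) ≤ wt z (HS (n + 1)) * wt z (HS (n + 1)) := by
  have h1 : wt z (SAWords n) ≤ wt z {u | (true, true) :: u ∈ HS (n + 1)} * wt z (HS (n + 1)) := by
    refine wt_le_mul' z (fun u v => (vflip u).reverse ++ v) (by simp) fun w hw => ?_
    obtain ⟨hA, hl⟩ := hw
    obtain ⟨a, b, rfl, ha, hb⟩ := exists_last_min w
    rw [List.length_append] at hl
    have hup : ∀ p s, vflip a.reverse = p ++ s → 0 ≤ yd p := by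
      intro p s e
      have e' : a = (vflip s).reverse ++ (vflip p).reverse := by
        rw [← List.reverse_append, ← vflip_append, ← e, vflip_vflip, List.reverse_reverse]
      simpa using ha _ _ e'
    refine ⟨vflip a.reverse, ⟨?_, ?_, ?_⟩, b, ⟨hA.right, hb, fun p s e => ?_⟩, by simp⟩
    · refine avoid_append (u := [(true, true)]) ?_ hA.left.reverse.vflip ?_
      · intro p c s e hc _ hy
        rcases p with _ | ⟨x, p⟩
        · rcases c with _ | ⟨x, c⟩
          · exact hc rfl
          · simp at e
            simp [← e.1, e.2.1, dy] at hy
        · simp at e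
          exact hc e.2.2.1
      · intro u₁ u₂ v₁ v₂ e ev hu _ _ hy
        have := hup v₁ v₂ ev
        rcases u₁ with _ | ⟨x, u₁⟩
        · simp at e
          simp [← e, dy] at hy
          linarith
        · simp at e
          exact hu e.2.2
    · intro p s e hp
      rcases p with _ | ⟨x, p⟩
      · exact absurd rfl hp
      · simp at e
        have := hup p s e.2
        simp [← e.1, dy]
        linarith
    · intro p s e
      have h2 := congrArg List.length e
      simp at h2
      have := yd_le_length p
      push_cast
      omega
    · have h2 := congrArg List.length e
      simp at h2
      have := yd_le_length p
      push_cast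
      omega
  have h2 : z * wt z {u | (true, true) :: u ∈ HS (n + 1)} ≤ wt z (HS (n + 1)) := by
    have : wt z {[(true, true)]} = z := by simp [wt]
    nth_rw 1 [← this]
    refine mul_le_wt z ?_ ?_
    · rintro a rfl b hb
      exact hb
    · rintro a rfl b hb a' rfl b' hb' _
      rfl
  calc z * wt z (SAWords n) ≤ z * (wt z {u | (true, true) :: u ∈ HS (n + 1)} *
        wt z (HS (n + 1))) := by gcongr
    _ = z * wt z {u | (true, true) :: u ∈ HS (n + 1)} * wt z (HS (n + 1)) := by ring
    _ ≤ _ := by gcongr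

/-! ### The connective constant -/

lemma one_le_of_tendsto {κ : ℝ}
    (hκ : Tendsto (fun n : ℕ => (sawCount 2 n : ℝ) ^ (1 / (n : ℝ))) atTop (𝓝 κ)) : 1 ≤ κ :=
  ge_of_tendsto' hκ fun n => Real.one_le_rpow (by exact_mod_cast one_le_sawCount n) (by positivity)

lemma wt_BR_ne_top {κ y : ℝ}
    (hκ : Tendsto (fun n : ℕ => (sawCount 2 n : ℝ) ^ (1 / (n : ℝ))) atTop (𝓝 κ)) (hy : 0 < y)
    (hyκ : κ * y < 1) : wt (ENNReal.ofReal y) BR ≠ ∞ := by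
  have hκ0 : 0 < κ := zero_lt_one.trans_le (one_le_of_tendsto hκ)
  obtain ⟨u, hu1, hu2⟩ := exists_between ((lt_div_iff₀ hy).2 hyκ)
  have huy : u * y < 1 := (lt_div_iff₀ hy).1 hu2
  have hu0 : 0 < u := hκ0.trans hu1
  have hsum : Summable fun n : ℕ => (sawCount 2 n : ℝ) * y ^ n := by
    refine (summable_geometric_of_lt_one (by positivity) huy).of_norm_bounded_eventually_nat ?_
    filter_upwards [hκ.eventually (gt_mem_nhds hu1), eventually_gt_atTop 0] with n hn hn0
    rw [Real.norm_of_nonneg (by positivity), mul_pow]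
    have hn0' : (n : ℝ) ≠ 0 := by positivity
    have : (sawCount 2 n : ℝ) ≤ u ^ n := by
      calc (sawCount 2 n : ℝ) = ((sawCount 2 n : ℝ) ^ (1 / (n : ℝ))) ^ n := by
            rw [← Real.rpow_natCast, ← Real.rpow_mul (by positivity), one_div,
              inv_mul_cancel₀ hn0', Real.rpow_one]
        _ ≤ u ^ n := by gcongr
    gcongr
  refine ne_top_of_le_ne_top hsum.tsum_ofReal_ne_top ((wt_BR_le_tsum _).trans (le_of_eq ?_))
  refine tsum_congr fun n => ?_
  rw [ENNReal.ofReal_mul (by positivity), ENNReal.ofReal_pow hy.le, ENNReal.ofReal_natCast]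

lemma exists_sawCount_le {κ : ℝ}
    (hκ : Tendsto (fun n : ℕ => (sawCount 2 n : ℝ) ^ (1 / (n : ℝ))) atTop (𝓝 κ)) :
    ∃ t₀ : ℕ, ∀ t ≥ t₀, 0 < t → ∀ n : ℕ, (sawCount 2 n : ℝ) ≤
      κ ^ n * Real.exp (κ + (n + 1) / (t : ℝ) ^ 203 + 8 * (t : ℝ) ^ 202) := by
  have hκ1 := one_le_of_tendsto hκ
  have hκ0 : 0 < κ := by linarith
  obtain ⟨t₀, ht₀⟩ := exists_toReal_wt_HS_le (c := κ⁻¹ * Real.exp (-1)) (by positivity)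
    (mul_le_one₀ (inv_le_one_of_one_le₀ hκ1) (Real.exp_pos _).le (by simp))
  refine ⟨t₀, fun t ht htpos n => ?_⟩
  have ht1 : (1 : ℝ) ≤ (t : ℝ) ^ 203 := one_le_pow₀ (by exact_mod_cast htpos)
  have ht0 : (0 : ℝ) < (t : ℝ) ^ 203 := by linarith
  obtain ⟨q, hq⟩ : ∃ q : ℝ, q = Real.exp (-(1 / (2 * (t ^ 203 : ℕ)))) := ⟨_, rfl⟩
  have hq0 : 0 < q := hq ▸ Real.exp_pos _
  have hqq : q * q = Real.exp (-(1 / (t : ℝ) ^ 203)) := by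
    rw [hq, ← Real.exp_add]
    congr 1
    push_cast
    field_simp
    ring
  have hq1 : q < 1 := by
    rw [hq, Real.exp_lt_one_iff, Left.neg_neg_iff]
    push_cast
    positivity
  have hz : ENNReal.ofReal (κ⁻¹ * q) * ENNReal.ofReal q = ENNReal.ofReal (κ⁻¹ * (q * q)) := by
    rw [← ENNReal.ofReal_mul (by positivity), mul_assoc]
  have hHS := ht₀ t ht (ENNReal.ofReal (κ⁻¹ * q)) (ENNReal.ofReal q)
    (wt_BR_ne_top hκ (by positivity) (by rw [mul_inv_cancel_left₀ hκ0.ne']; exact hq1))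
    ENNReal.ofReal_ne_top (by rw [hq]) (by
      rw [hz, hqq]
      gcongr
      rw [div_le_one ht0]
      exact ht1) (n + 1)
  rw [hz] at hHS
  obtain ⟨z, hzdef⟩ : ∃ z, z = κ⁻¹ * (q * q) := ⟨_, rfl⟩
  rw [← hzdef] at hHS
  have hz0 : 0 < z := by rw [hzdef]; positivity
  have hIz : wt (ENNReal.ofReal z) IR ≤ 1 := wt_IR_le_one (wt_BR_ne_top hκ hz0 (by
    rw [hzdef, mul_inv_cancel_left₀ hκ0.ne']
    nlinarith))
  have hfin := wt_HS_ne_top hIz (n + 1)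
  have h := ENNReal.toReal_mono (ENNReal.mul_ne_top hfin hfin)
    (mul_wt_SAWords_le (ENNReal.ofReal z) n)
  rw [wt_SAWords] at h
  simp only [ENNReal.toReal_mul, ENNReal.toReal_pow, ENNReal.toReal_ofReal hz0.le,
    ENNReal.toReal_natCast] at h
  have h2 : (sawCount 2 n : ℝ) * z ^ (n + 1) ≤ Real.exp (8 * (t : ℝ) ^ 202) := by
    calc (sawCount 2 n : ℝ) * z ^ (n + 1) = z * ((sawCount 2 n : ℝ) * z ^ n) := by ring
      _ ≤ _ := h
      _ ≤ Real.exp (4 * (t : ℝ) ^ 202) * Real.exp (4 * (t : ℝ) ^ 202) := by gcongr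
      _ = _ := by
        rw [← Real.exp_add]
        ring_nf
  have hzinv : z * (κ * Real.exp (1 / (t : ℝ) ^ 203)) = 1 := by
    rw [hzdef, hqq, Real.exp_neg]
    field_simp
  calc (sawCount 2 n : ℝ) = (sawCount 2 n : ℝ) * z ^ (n + 1) *
        (κ * Real.exp (1 / (t : ℝ) ^ 203)) ^ (n + 1) := by
        rw [mul_assoc, ← mul_pow, hzinv, one_pow, mul_one]
    _ ≤ Real.exp (8 * (t : ℝ) ^ 202) * (κ * Real.exp (1 / (t : ℝ) ^ 203)) ^ (n + 1) := by gcongr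
    _ = κ ^ n * (κ * Real.exp ((n + 1) / (t : ℝ) ^ 203) * Real.exp (8 * (t : ℝ) ^ 202)) := by
        rw [mul_pow, ← Real.exp_nat_mul]
        push_cast
        rw [mul_one_div]
        ring
    _ ≤ κ ^ n * (Real.exp κ * Real.exp ((n + 1) / (t : ℝ) ^ 203) *
        Real.exp (8 * (t : ℝ) ^ 202)) := by
        gcongr
        linarith [Real.add_one_le_exp κ]
    _ = _ := by rw [Real.exp_add, Real.exp_add]

end SAWBound

/-- On the square lattice `ℤ²` there exist `ε > 0` and `C > 0` with
`σ_n ≤ κ^n exp(C n^{1/2-ε})` for all `n ≥ 1`, where `κ` is the connective constant. -/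
theorem saw_count_upper_bound_two_dimensions (κ : ℝ)
    (hκ : Tendsto (fun n : ℕ => (sawCount 2 n : ℝ) ^ (1 / (n : ℝ))) atTop (𝓝 κ)) :
    ∃ ε : ℝ, 0 < ε ∧ ∃ C : ℝ, 0 < C ∧ ∀ n : ℕ, 1 ≤ n →
      (sawCount 2 n : ℝ) ≤ κ ^ n * Real.exp (C * (n : ℝ) ^ ((1 : ℝ) / 2 - ε)) := by
  have hκ0 : 0 < κ := zero_lt_one.trans_le (SAWBound.one_le_of_tendsto hκ)
  obtain ⟨t₀, ht₀⟩ := SAWBound.exists_sawCount_le hκ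
  refine ⟨1 / 810, by norm_num, κ + 2 + 8 * (t₀ + 2) ^ 202, by positivity, fun n hn => ?_⟩
  have hn1 : (1 : ℝ) ≤ n := by exact_mod_cast hn
  obtain ⟨x, hx⟩ : ∃ x : ℝ, x = (n : ℝ) ^ ((1 : ℝ) / 405) := ⟨_, rfl⟩
  have hx1 : 1 ≤ x := hx ▸ Real.one_le_rpow hn1 (by norm_num)
  have hx405 : x ^ 405 = n := by
    rw [hx, ← Real.rpow_natCast, ← Real.rpow_mul (by positivity)]
    norm_num
  have hx202 : (n : ℝ) ^ ((1 : ℝ) / 2 - 1 / 810) = x ^ 202 := by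
    rw [hx, ← Real.rpow_natCast, ← Real.rpow_mul (by positivity)]
    norm_num
  set t := max ⌈x⌉₊ t₀ with ht
  have hxt : x ≤ t := (Nat.le_ceil x).trans (by exact_mod_cast le_max_left _ _)
  have htx : (t : ℝ) ≤ (t₀ + 2) * x := by
    have h1 := Nat.ceil_lt_add_one (by linarith : 0 ≤ x)
    have h2 : (0 : ℝ) ≤ t₀ := by positivity
    rw [ht]
    push_cast
    refine max_le ?_ ?_ <;> nlinarith
  have ht0 : 0 < t := by exact_mod_cast (by linarith : (0 : ℝ) < t)
  have h := ht₀ t (le_max_right _ _) ht0 n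
  refine h.trans ?_
  have hX : 1 ≤ x ^ 202 := one_le_pow₀ hx1
  have e1 : ((n : ℝ) + 1) / (t : ℝ) ^ 203 ≤ 2 * x ^ 202 := by
    rw [div_le_iff₀ (by positivity)]
    calc (n : ℝ) + 1 ≤ 2 * x ^ 405 := by linarith
      _ = 2 * x ^ 202 * x ^ 203 := by ring
      _ ≤ _ := by gcongr
  have e2 : (t : ℝ) ^ 202 ≤ (t₀ + 2) ^ 202 * x ^ 202 := by
    rw [← mul_pow]
    gcongr
  rw [hx202]
  gcongr
  have e3 : κ ≤ κ * x ^ 202 := le_mul_of_one_le_right hκ0.le hX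
  generalize ((t₀ : ℝ) + 2) ^ 202 = A at e2 ⊢
  generalize x ^ 202 = X at e1 e2 e3 ⊢
  generalize (t : ℝ) ^ 202 = T at e2 ⊢
  rw [add_mul, add_mul, mul_assoc]
  linarith
end
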